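/- There exists n_0 such that for all n > n_0 the following holds: every 3-partite 3-graph H with n vertices in each class and δ_1(H) > (5n^2 − 6n)/9 when n ≡ 0 (mod 3), δ_1(H) > (5n^2 − 4n − 1)/9 when n ≡ 1 (mod 3), and δ_1(H) > (5n^2 − 8n + 5)/9 when n ≡ 2 (mod 3), contains a perfect matching. -/

import Mathlib

/-- The degree of the vertex `x` in class `c` of a 3-partite 3-graph, encoded as a
finite set of functions `Fin 3 → Fin n`. -/
def deg3 {n : ℕ} (H : Finset (Fin 3 → Fin n)) (c : Fin 3) (x : Fin n) : ℕ :=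
  (H.filter (fun e => e c = x)).card

/-- Nine times the degree threshold of the main theorem: `δ₁(H)` is required to exceed
`(5n²-6n)/9`, `(5n²-4n-1)/9` or `(5n²-8n+5)/9` according to `n mod 3` (all these
quantities being integers in the respective cases). -/
def threshold9 (n : ℕ) : ℕ :=
  if n % 3 = 0 then 5 * n ^ 2 - 6 * n
  else if n % 3 = 1 then 5 * n ^ 2 - 4 * n - 1
  else 5 * n ^ 2 - 8 * n + 5


namespace PM

/-- Pairwise disjointness of edges. -/
def IsM {n : ℕ} (N : Finset (Fin 3 → Fin n)) : Prop :=
  ∀ e ∈ N, ∀ f ∈ N, e ≠ f → ∀ i, e i ≠ f i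

/-- The edge with value `x` in class `c`, `y` in class `c+1`, `z` in class `c+2`. -/
def tri {n : ℕ} (c : Fin 3) (x y z : Fin n) : Fin 3 → Fin n :=
  fun i => if i = c then x else if i = c + 1 then y else z

lemma tri_0 {n : ℕ} (c : Fin 3) (x y z : Fin n) : tri c x y z c = x := by simp [tri]

lemma tri_1 {n : ℕ} (c : Fin 3) (x y z : Fin n) : tri c x y z (c + 1) = y := by
  fin_cases c <;> simp [tri]

lemma tri_2 {n : ℕ} (c : Fin 3) (x y z : Fin n) : tri c x y z (c + 2) = z := by
  fin_cases c <;> simp [tri]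

lemma forall_fin3 {P : Fin 3 → Prop} (c : Fin 3) (h0 : P c) (h1 : P (c + 1)) (h2 : P (c + 2)) :
    ∀ i, P i := by
  intro i
  have key : ∀ c i : Fin 3, i = c ∨ i = c + 1 ∨ i = c + 2 := by decide
  rcases key c i with rfl | rfl | rfl <;> assumption

lemma tri_eta {n : ℕ} (c : Fin 3) (e : Fin 3 → Fin n) :
    tri c (e c) (e (c + 1)) (e (c + 2)) = e := by
  funext i
  refine forall_fin3 (P := fun i => tri c (e c) (e (c + 1)) (e (c + 2)) i = e i) c ?_ ?_ ?_ i
  · rw [tri_0]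
  · rw [tri_1]
  · rw [tri_2]

lemma tri_inj {n : ℕ} {c : Fin 3} {x y z x' y' z' : Fin n} :
    tri c x y z = tri c x' y' z' ↔ x = x' ∧ y = y' ∧ z = z' := by
  constructor
  · intro h
    refine ⟨?_, ?_, ?_⟩
    · have := congrFun h c; rwa [tri_0, tri_0] at this
    · have := congrFun h (c + 1); rwa [tri_1, tri_1] at this
    · have := congrFun h (c + 2); rwa [tri_2, tri_2] at this
  · rintro ⟨rfl, rfl, rfl⟩; rfl

/-- Link of a vertex. -/
def link {n : ℕ} (H : Finset (Fin 3 → Fin n)) (c : Fin 3) (x : Fin n) : Finset (Fin n × Fin n) :=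
  Finset.univ.filter (fun p => tri c x p.1 p.2 ∈ H)

lemma mem_link {n : ℕ} {H : Finset (Fin 3 → Fin n)} {c : Fin 3} {x : Fin n} {p : Fin n × Fin n} :
    p ∈ link H c x ↔ tri c x p.1 p.2 ∈ H := by simp [link]

lemma deg3_eq {n : ℕ} (H : Finset (Fin 3 → Fin n)) (c : Fin 3) (x : Fin n) :
    deg3 H c x = (link H c x).card := by
  unfold deg3
  symm
  apply Finset.card_bij (fun p _ => tri c x p.1 p.2)
  · intro p hp
    rw [mem_link] at hp
    simp [hp, tri_0]
  · intro p _ q _ h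
    rw [tri_inj] at h
    exact Prod.ext h.2.1 h.2.2
  · intro e he
    rw [Finset.mem_filter] at he
    refine ⟨(e (c + 1), e (c + 2)), ?_, ?_⟩
    · rw [mem_link]; simp only; rw [← he.2, tri_eta]; exact he.1
    · simp only; rw [← he.2, tri_eta]

end PM


namespace PM

/-- Deterministic sampling lemma (method of conditional expectations). -/
lemma sampling_aux {Ω T : Type*} [Fintype Ω] [DecidableEq Ω] [Fintype T]
    (R : Ω → Ω → Prop) [DecidableRel R] (hR : ∀ ω, R ω ω)
    (ρ l : ℝ) (K : ℕ) (hl0 : 0 < l) (hl1 : l ≤ 1 / 2) (hK : K * ρ ≤ l ^ 2 / 2)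
    (hΩ : 0 < Fintype.card Ω)
    (hconf : ∀ ω, ((Finset.univ.filter (fun ω' => R ω ω')).card : ℝ) ≤ ρ * Fintype.card Ω)
    (h : T → Ω → ℝ) (h1 : ∀ t ω, |h t ω| ≤ 1) (h0 : ∀ t, ∑ ω, h t ω = 0) :
    ∀ j ≤ K, ∃ A : Finset Ω, A.card = j ∧ (∀ a ∈ A, ∀ b ∈ A, a ≠ b → ¬ (R a b ∧ R b a)) ∧
      ∑ t, Real.exp (-l * ∑ ω ∈ A, h t ω) ≤ Fintype.card T * Real.exp (2 * l ^ 2 * j) := by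
  intro j
  induction j with
  | zero => intro _; exact ⟨∅, by simp⟩
  | succ j ih =>
    intro hj
    obtain ⟨A, hA, hAR, hΦ⟩ := ih (by omega)
    set Ω' : Finset Ω := Finset.univ.filter (fun ω => ∀ a ∈ A, ¬ R a ω) with hΩ'
    set N : ℝ := ((Fintype.card Ω : ℕ) : ℝ) with hN
    have hNpos : 0 < N := by rw [hN]; exact_mod_cast hΩ
    have hρ : 0 ≤ ρ := by
      obtain ⟨ω⟩ := Fintype.card_pos_iff.1 hΩ
      have := hconf ω
      have h3 : (0 : ℝ) ≤ ρ * N := le_trans (by positivity) this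
      by_contra hneg
      push Not at hneg
      nlinarith
    have hcard : N - j * (ρ * N) ≤ Ω'.card := by
      have hc : (Finset.univ \ Ω') ⊆ A.biUnion (fun a => Finset.univ.filter (fun ω' => R a ω')) := by
        intro ω hω
        simp only [hΩ', Finset.mem_sdiff, Finset.mem_univ, true_and, Finset.mem_filter, not_forall,
          not_not] at hω
        obtain ⟨a, ha, hr⟩ := hω
        simp only [Finset.mem_biUnion, Finset.mem_filter, Finset.mem_univ, true_and]
        exact ⟨a, ha, hr⟩
      have h2 : ((Finset.univ \ Ω').card : ℝ) ≤ j * (ρ * N) := by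
        calc ((Finset.univ \ Ω').card : ℝ) ≤ ((A.biUnion (fun a => Finset.univ.filter (fun ω' => R a ω'))).card : ℝ) := by
              exact_mod_cast Finset.card_le_card hc
          _ ≤ ∑ a ∈ A, ((Finset.univ.filter (fun ω' => R a ω')).card : ℝ) := by
              exact_mod_cast Finset.card_biUnion_le
          _ ≤ ∑ a ∈ A, ρ * N := Finset.sum_le_sum (fun a _ => hconf a)
          _ = j * (ρ * N) := by rw [Finset.sum_const, hA, nsmul_eq_mul]
      have h3 : (Finset.univ \ Ω').card + Ω'.card = Fintype.card Ω := by
        rw [Finset.card_sdiff_add_card_eq_card (Finset.subset_univ _), Finset.card_univ]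
      have h4 : ((Finset.univ \ Ω').card : ℝ) + Ω'.card = N := by rw [hN]; exact_mod_cast h3
      linarith
    have hcard2 : N * (1 - l ^ 2 / 2) ≤ Ω'.card := by
      have : (j : ℝ) * ρ ≤ K * ρ := by
        apply mul_le_mul_of_nonneg_right _ hρ
        exact_mod_cast (by omega : j ≤ K)
      nlinarith
    have hpos' : (0 : ℝ) < Ω'.card := by
      have : 0 < N * (1 - l ^ 2 / 2) := by apply mul_pos hNpos; nlinarith
      linarith
    -- average
    set Φ : ℝ := ∑ t, Real.exp (-l * ∑ ω ∈ A, h t ω) with hΦdef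
    have hΦ0 : 0 ≤ Φ := Finset.sum_nonneg (fun t _ => (Real.exp_pos _).le)
    have hsum : ∑ ω ∈ Ω', ∑ t, Real.exp (-l * (h t ω + ∑ ω ∈ A, h t ω)) ≤
        Ω'.card * (Φ * Real.exp (2 * l ^ 2)) := by
      have e1 : ∀ t, ∑ ω, Real.exp (-l * h t ω) ≤ N * (1 + l ^ 2) := by
        intro t
        have : ∀ ω ∈ (Finset.univ : Finset Ω), Real.exp (-l * h t ω) ≤ 1 + (-l * h t ω) + l ^ 2 := by
          intro ω _
          have habs : |-l * h t ω| ≤ l := by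
            rw [abs_mul, abs_neg, abs_of_pos hl0]
            nlinarith [h1 t ω]
          have := Real.abs_exp_sub_one_sub_id_le (x := -l * h t ω) (by linarith)
          have h5 := (abs_le.1 this).2
          have h6 : (-l * h t ω) ^ 2 ≤ l ^ 2 := by
            rw [← sq_abs]; exact pow_le_pow_left₀ (abs_nonneg _) habs 2
          linarith
        refine (Finset.sum_le_sum this).trans ?_
        rw [Finset.sum_add_distrib, Finset.sum_add_distrib, ← Finset.mul_sum, h0 t]
        simp only [Finset.sum_const, Finset.card_univ, nsmul_eq_mul, mul_one, mul_zero, add_zero]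
        rw [← hN]; linarith
      calc ∑ ω ∈ Ω', ∑ t, Real.exp (-l * (h t ω + ∑ ω ∈ A, h t ω))
          ≤ ∑ ω, ∑ t, Real.exp (-l * (h t ω + ∑ ω ∈ A, h t ω)) :=
            Finset.sum_le_sum_of_subset_of_nonneg (Finset.subset_univ _)
              (fun ω _ _ => Finset.sum_nonneg (fun t _ => (Real.exp_pos _).le))
        _ = ∑ t, (Real.exp (-l * ∑ ω ∈ A, h t ω)) * ∑ ω, Real.exp (-l * h t ω) := by
            rw [Finset.sum_comm]
            apply Finset.sum_congr rfl
            intro t _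
            rw [Finset.mul_sum]
            apply Finset.sum_congr rfl
            intro ω _
            rw [← Real.exp_add]; ring_nf
        _ ≤ ∑ t, (Real.exp (-l * ∑ ω ∈ A, h t ω)) * (N * (1 + l ^ 2)) := by
            apply Finset.sum_le_sum
            intro t _
            exact mul_le_mul_of_nonneg_left (e1 t) (Real.exp_pos _).le
        _ = Φ * (N * (1 + l ^ 2)) := by rw [← Finset.sum_mul]
        _ ≤ Φ * (Ω'.card * Real.exp (2 * l ^ 2)) := by
            apply mul_le_mul_of_nonneg_left _ hΦ0
            have e2 : 1 + 2 * l ^ 2 ≤ Real.exp (2 * l ^ 2) := by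
              have := Real.add_one_le_exp (2 * l ^ 2); linarith
            have hl2 : l ^ 2 ≤ 1 / 4 := by nlinarith
            calc N * (1 + l ^ 2) ≤ N * ((1 - l ^ 2 / 2) * (1 + 2 * l ^ 2)) := by
                  apply mul_le_mul_of_nonneg_left _ hNpos.le
                  nlinarith [sq_nonneg l]
              _ = N * (1 - l ^ 2 / 2) * (1 + 2 * l ^ 2) := by ring
              _ ≤ Ω'.card * Real.exp (2 * l ^ 2) := by
                  apply mul_le_mul hcard2 e2 (by positivity) hpos'.le
        _ = Ω'.card * (Φ * Real.exp (2 * l ^ 2)) := by ring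
    have hex : ∃ ω ∈ Ω', ∑ t, Real.exp (-l * (h t ω + ∑ ω ∈ A, h t ω)) ≤ Φ * Real.exp (2 * l ^ 2) := by
      apply Finset.exists_le_of_sum_le
      · rw [← Finset.card_pos]; exact_mod_cast hpos'
      · simpa [Finset.sum_const, nsmul_eq_mul] using hsum
    obtain ⟨ω, hω, hle⟩ := hex
    rw [hΩ', Finset.mem_filter] at hω
    have hnot : ω ∉ A := fun hm => hω.2 ω hm (hR ω)
    refine ⟨insert ω A, ?_, ?_, ?_⟩
    · rw [Finset.card_insert_of_notMem hnot, hA]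
    · intro a ha b hb hab hr
      rw [Finset.mem_insert] at ha hb
      rcases ha with rfl | ha <;> rcases hb with rfl | hb
      · exact hab rfl
      · exact hω.2 b hb hr.2
      · exact hω.2 a ha hr.1
      · exact hAR a ha b hb hab hr
    · have : ∀ t, ∑ ω' ∈ insert ω A, h t ω' = h t ω + ∑ ω ∈ A, h t ω := by
        intro t; rw [Finset.sum_insert hnot]
      simp only [this]
      refine hle.trans ?_
      calc Φ * Real.exp (2 * l ^ 2) ≤ (Fintype.card T * Real.exp (2 * l ^ 2 * j)) * Real.exp (2 * l ^ 2) :=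
            mul_le_mul_of_nonneg_right hΦ (Real.exp_pos _).le
        _ = Fintype.card T * Real.exp (2 * l ^ 2 * (j + 1 : ℕ)) := by
            rw [mul_assoc, ← Real.exp_add]; push_cast; ring_nf

lemma sampling {Ω T : Type*} [Fintype Ω] [DecidableEq Ω] [Fintype T]
    (R : Ω → Ω → Prop) [DecidableRel R] (hR : ∀ ω, R ω ω) (hRs : ∀ a b, R a b → R b a)
    (ρ ε : ℝ) (K : ℕ) (hε0 : 0 < ε) (hε1 : ε ≤ 1) (hK : K * ρ ≤ ε ^ 2 / 32)
    (hΩ : 0 < Fintype.card Ω)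
    (hconf : ∀ ω, ((Finset.univ.filter (fun ω' => R ω ω')).card : ℝ) ≤ ρ * Fintype.card Ω)
    (hT : (Fintype.card T : ℝ) < Real.exp (ε ^ 2 * K / 8))
    (h : T → Ω → ℝ) (h0 : ∀ t ω, 0 ≤ h t ω) (h1 : ∀ t ω, h t ω ≤ 1) :
    ∃ A : Finset Ω, A.card = K ∧ (∀ a ∈ A, ∀ b ∈ A, a ≠ b → ¬ R a b) ∧
      ∀ t, ((∑ ω, h t ω) / Fintype.card Ω - ε) * K ≤ ∑ ω ∈ A, h t ω := by
  have hN : (0 : ℝ) < Fintype.card Ω := by exact_mod_cast hΩ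
  set N : ℝ := ((Fintype.card Ω : ℕ) : ℝ) with hNdef
  set μ : T → ℝ := fun t => (∑ ω, h t ω) / N with hμ
  have hμ0 : ∀ t, 0 ≤ μ t := fun t => div_nonneg (Finset.sum_nonneg (fun ω _ => h0 t ω)) hN.le
  have hμ1 : ∀ t, μ t ≤ 1 := by
    intro t
    rw [hμ]; simp only
    rw [div_le_one hN]
    calc ∑ ω, h t ω ≤ ∑ ω : Ω, (1 : ℝ) := Finset.sum_le_sum (fun ω _ => h1 t ω)
      _ = N := by simp [hNdef]
  obtain ⟨A, hA, hAR, hΦ⟩ := sampling_aux (T := T) R hR ρ (ε / 4) K (by linarith) (by linarith)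
    (by nlinarith) hΩ hconf (fun t ω => h t ω - μ t)
    (by intro t ω; rw [abs_le]; constructor <;> linarith [h0 t ω, h1 t ω, hμ0 t, hμ1 t])
    (by
      intro t
      rw [Finset.sum_sub_distrib, Finset.sum_const, Finset.card_univ, nsmul_eq_mul, ← hNdef, hμ]
      field_simp; simp) K le_rfl
  refine ⟨A, hA, fun a ha b hb hab hr => hAR a ha b hb hab ⟨hr, hRs _ _ hr⟩, ?_⟩
  intro t
  by_contra hcon
  push Not at hcon
  have hs : ∑ ω ∈ A, (h t ω - μ t) = ∑ ω ∈ A, h t ω - K * μ t := by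
    rw [Finset.sum_sub_distrib, Finset.sum_const, hA, nsmul_eq_mul]
  have hle : Real.exp (-(ε / 4) * ∑ ω ∈ A, (h t ω - μ t)) ≤ Fintype.card T * Real.exp (2 * (ε / 4) ^ 2 * K) := by
    refine le_trans ?_ hΦ
    exact Finset.single_le_sum (f := fun t => Real.exp (-(ε / 4) * ∑ ω ∈ A, (h t ω - μ t)))
      (fun t _ => (Real.exp_pos _).le) (Finset.mem_univ t)
  have hge : Real.exp (ε ^ 2 * K / 8) * Real.exp (2 * (ε / 4) ^ 2 * K) ≤ Real.exp (-(ε / 4) * ∑ ω ∈ A, (h t ω - μ t)) := by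
    rw [← Real.exp_add]
    apply Real.exp_le_exp.2
    rw [hs]
    nlinarith
  have := mul_lt_mul_of_pos_right hT (Real.exp_pos (2 * (ε / 4) ^ 2 * K))
  linarith

end PM


namespace PM

lemma IsM.insert {n : ℕ} {N : Finset (Fin 3 → Fin n)} (hN : IsM N) {g : Fin 3 → Fin n}
    (h : ∀ f ∈ N, ∀ i, g i ≠ f i) : IsM (insert g N) := by
  intro e he f hf hef i
  rw [Finset.mem_insert] at he hf
  rcases he with rfl | he <;> rcases hf with rfl | hf
  · exact absurd rfl hef
  · exact h f hf i
  · exact (h e he i).symm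
  · exact hN e he f hf hef i

lemma notMem_of_disj {n : ℕ} {N : Finset (Fin 3 → Fin n)} {g : Fin 3 → Fin n}
    (h : ∀ f ∈ N, ∀ i, g i ≠ f i) : g ∉ N := fun hg => h g hg 0 rfl

lemma IsM.mono {n : ℕ} {N N' : Finset (Fin 3 → Fin n)} (hN : IsM N) (h : N' ⊆ N) : IsM N' :=
  fun e he f hf hef i => hN e (h he) f (h hf) hef i

lemma IsM.union {n : ℕ} {N N' : Finset (Fin 3 → Fin n)} (hN : IsM N) (hN' : IsM N')
    (h : ∀ e ∈ N, ∀ f ∈ N', ∀ i, e i ≠ f i) : IsM (N ∪ N') := by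
  intro e he f hf hef i
  rw [Finset.mem_union] at he hf
  rcases he with he | he <;> rcases hf with hf | hf
  · exact hN e he f hf hef i
  · exact h e he f hf i
  · exact (h f hf e he i).symm
  · exact hN' e he f hf hef i

lemma card_union_of_disj {n : ℕ} {N N' : Finset (Fin 3 → Fin n)}
    (h : ∀ e ∈ N, ∀ f ∈ N', ∀ i, e i ≠ f i) : (N ∪ N').card = N.card + N'.card := by
  apply Finset.card_union_of_disjoint
  rw [Finset.disjoint_left]
  intro e he hee
  exact h e he e hee 0 rfl

/-- `ω = (e,f)` absorbs the triple `T`. -/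
def Absorbs {n : ℕ} (H : Finset (Fin 3 → Fin n)) (ω : (Fin 3 → Fin n) × (Fin 3 → Fin n))
    (T : Fin 3 → Fin n) : Prop :=
  ω.1 ∈ H ∧ ω.2 ∈ H ∧ (∀ i, ω.1 i ≠ ω.2 i) ∧ tri 0 (T 0) (ω.1 1) (ω.2 2) ∈ H ∧
    tri 0 (ω.1 0) (T 1) (ω.1 2) ∈ H ∧ tri 0 (ω.2 0) (ω.2 1) (T 2) ∈ H

/-- Two pairs of edges share a vertex. -/
def Conf {n : ℕ} (ω ω' : (Fin 3 → Fin n) × (Fin 3 → Fin n)) : Prop :=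
  ∃ i, ω.1 i = ω'.1 i ∨ ω.1 i = ω'.2 i ∨ ω.2 i = ω'.1 i ∨ ω.2 i = ω'.2 i

lemma tri0_0 {n : ℕ} (x y z : Fin n) : tri 0 x y z 0 = x := by simp [tri]
lemma tri0_1 {n : ℕ} (x y z : Fin n) : tri 0 x y z 1 = y := by simp [tri]
lemma tri0_2 {n : ℕ} (x y z : Fin n) : tri 0 x y z 2 = z := by simp [tri]

open Classical in
lemma absorb_finish {n : ℕ} (H : Finset (Fin 3 → Fin n)) (ℓ : ℕ) :
    ∀ (N : Finset (Fin 3 → Fin n)) (A : Finset ((Fin 3 → Fin n) × (Fin 3 → Fin n))),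
      N ⊆ H → IsM N → (∀ ω ∈ A, ω.1 ∈ H ∧ ω.2 ∈ H ∧ ∀ i, ω.1 i ≠ ω.2 i) →
      (∀ a ∈ A, ∀ b ∈ A, a ≠ b → ¬ Conf a b) →
      (∀ g ∈ N, ∀ ω ∈ A, ∀ i, g i ≠ ω.1 i ∧ g i ≠ ω.2 i) →
      N.card + 2 * A.card + ℓ = n →
      (∀ T, ℓ ≤ (A.filter (fun ω => Absorbs H ω T)).card) →
      ∃ M : Finset (Fin 3 → Fin n), M ⊆ H ∧ IsM M ∧ M.card = n := by
  induction ℓ with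
  | zero =>
    intro N A
    induction A using Finset.induction_on generalizing N with
    | empty => intro hNH hN _ _ _ hc _; exact ⟨N, hNH, hN, by simpa using hc⟩
    | insert ω A hω ih =>
      intro hNH hN hA hconf hdis hc _
      have h1 := hA ω (Finset.mem_insert_self _ _)
      have d2 : ∀ f ∈ N, ∀ i, ω.2 i ≠ f i := fun f hf i =>
        ((hdis f hf ω (Finset.mem_insert_self _ _) i).2).symm
      have hN2 := hN.insert d2
      have d1 : ∀ f ∈ insert ω.2 N, ∀ i, ω.1 i ≠ f i := by
        intro f hf i
        rw [Finset.mem_insert] at hf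
        rcases hf with rfl | hf
        · exact h1.2.2 i
        · exact ((hdis f hf ω (Finset.mem_insert_self _ _) i).1).symm
      have hN1 := hN2.insert d1
      refine ih (insert ω.1 (insert ω.2 N)) ?_ hN1 (fun a ha => hA a (Finset.mem_insert_of_mem ha))
        (fun a ha b hb => hconf a (Finset.mem_insert_of_mem ha) b (Finset.mem_insert_of_mem hb)) ?_ ?_ (by simp)
      · intro e he
        simp only [Finset.mem_insert] at he
        rcases he with rfl | rfl | he
        · exact h1.1
        · exact h1.2.1
        · exact hNH he
      · intro g hg a ha i
        have hne : ω ≠ a := by rintro rfl; exact hω ha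
        have hc := hconf ω (Finset.mem_insert_self _ _) a (Finset.mem_insert_of_mem ha) hne
        unfold Conf at hc
        push Not at hc
        have hci := hc i
        simp only [Finset.mem_insert] at hg
        rcases hg with rfl | rfl | hg
        · exact ⟨hci.1, hci.2.1⟩
        · exact ⟨hci.2.2.1, hci.2.2.2⟩
        · exact hdis g hg a (Finset.mem_insert_of_mem ha) i
      · rw [Finset.card_insert_of_notMem (notMem_of_disj d1),
          Finset.card_insert_of_notMem (notMem_of_disj d2)]
        rw [Finset.card_insert_of_notMem hω] at hc
        omega
  | succ ℓ ih =>
    intro N A hNH hN hA hconf hdis hc habs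
    -- find uncovered vertices
    have hunc : ∀ i : Fin 3, ∃ x : Fin n, (∀ g ∈ N, g i ≠ x) ∧ ∀ ω ∈ A, ω.1 i ≠ x ∧ ω.2 i ≠ x := by
      intro i
      by_contra hcon
      push Not at hcon
      have hsub : (Finset.univ : Finset (Fin n)) ⊆ (N.image (fun g => g i)) ∪
          ((A.image (fun ω => ω.1 i)) ∪ (A.image (fun ω => ω.2 i))) := by
        intro x _
        have := hcon x
        simp only [Finset.mem_union, Finset.mem_image]
        by_cases h : ∀ g ∈ N, g i ≠ x
        · obtain ⟨ω, hω, h2⟩ := this h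
          right
          by_cases h3 : ω.1 i = x
          · left; exact ⟨ω, hω, h3⟩
          · right; exact ⟨ω, hω, h2 h3⟩
        · push Not at h
          left; exact h
      have h1 := Finset.card_le_card hsub
      have h2 := Finset.card_union_le (N.image (fun g => g i)) ((A.image (fun ω => ω.1 i)) ∪ (A.image (fun ω => ω.2 i)))
      have h3 := Finset.card_union_le (A.image (fun ω => ω.1 i)) (A.image (fun ω => ω.2 i))
      have h4 := Finset.card_image_le (s := N) (f := fun g => g i)
      have h5 := Finset.card_image_le (s := A) (f := fun ω => ω.1 i)
      have h6 := Finset.card_image_le (s := A) (f := fun ω => ω.2 i)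
      rw [Finset.card_univ, Fintype.card_fin] at h1
      omega
    choose T hTN hTA using hunc
    obtain ⟨ω, hω⟩ : (A.filter (fun ω => Absorbs H ω T)).Nonempty := by
      rw [← Finset.card_pos]; have := habs T; omega
    rw [Finset.mem_filter] at hω
    obtain ⟨hωA, hω1, hω2, hωd, ha1, ha2, ha3⟩ := hω
    set g1 := tri 0 (T 0) (ω.1 1) (ω.2 2) with hg1
    set g2 := tri 0 (ω.1 0) (T 1) (ω.1 2) with hg2
    set g3 := tri 0 (ω.2 0) (ω.2 1) (T 2) with hg3
    have D : ∀ f ∈ N, ∀ i, ω.1 i ≠ f i ∧ ω.2 i ≠ f i ∧ T i ≠ f i := fun f hf i =>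
      ⟨((hdis f hf ω hωA i).1).symm, ((hdis f hf ω hωA i).2).symm, (hTN i f hf).symm⟩
    have TA := fun i => hTA i ω hωA
    have d3 : ∀ f ∈ N, ∀ i, g3 i ≠ f i := by
      intro f hf i
      fin_cases i
      · exact (D f hf 0).2.1
      · exact (D f hf 1).2.1
      · exact (D f hf 2).2.2
    have d2 : ∀ f ∈ insert g3 N, ∀ i, g2 i ≠ f i := by
      intro f hf i
      rw [Finset.mem_insert] at hf
      rcases hf with rfl | hf
      · fin_cases i
        · exact hωd 0
        · exact ((TA 1).2).symm
        · exact (TA 2).1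
      · fin_cases i
        · exact (D f hf 0).1
        · exact (D f hf 1).2.2
        · exact (D f hf 2).1
    have d1 : ∀ f ∈ insert g2 (insert g3 N), ∀ i, g1 i ≠ f i := by
      intro f hf i
      rw [Finset.mem_insert, Finset.mem_insert] at hf
      rcases hf with rfl | rfl | hf
      · fin_cases i
        · exact ((TA 0).1).symm
        · exact (TA 1).1
        · exact (hωd 2).symm
      · fin_cases i
        · exact ((TA 0).2).symm
        · exact hωd 1
        · exact (TA 2).2
      · fin_cases i
        · exact (D f hf 0).2.2
        · exact (D f hf 1).1
        · exact (D f hf 2).2.1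
    refine ih (insert g1 (insert g2 (insert g3 N))) (A.erase ω) ?_ (((hN.insert d3).insert d2).insert d1)
      (fun a ha => hA a (Finset.mem_of_mem_erase ha))
      (fun a ha b hb => hconf a (Finset.mem_of_mem_erase ha) b (Finset.mem_of_mem_erase hb)) ?_ ?_ ?_
    · intro e he
      simp only [Finset.mem_insert] at he
      rcases he with rfl | rfl | rfl | he
      · exact ha1
      · exact ha2
      · exact ha3
      · exact hNH he
    · intro g hg a ha i
      rw [Finset.mem_erase] at ha
      have hcf := hconf ω hωA a ha.2 ha.1.symm
      unfold Conf at hcf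
      push Not at hcf
      have HT := fun i => hTA i a ha.2
      simp only [Finset.mem_insert] at hg
      rcases hg with rfl | rfl | rfl | hg
      · fin_cases i
        · exact ⟨((HT 0).1).symm, ((HT 0).2).symm⟩
        · exact ⟨(hcf 1).1, (hcf 1).2.1⟩
        · exact ⟨(hcf 2).2.2.1, (hcf 2).2.2.2⟩
      · fin_cases i
        · exact ⟨(hcf 0).1, (hcf 0).2.1⟩
        · exact ⟨((HT 1).1).symm, ((HT 1).2).symm⟩
        · exact ⟨(hcf 2).1, (hcf 2).2.1⟩
      · fin_cases i
        · exact ⟨(hcf 0).2.2.1, (hcf 0).2.2.2⟩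
        · exact ⟨(hcf 1).2.2.1, (hcf 1).2.2.2⟩
        · exact ⟨((HT 2).1).symm, ((HT 2).2).symm⟩
      · exact hdis g hg a ha.2 i
    · rw [Finset.card_insert_of_notMem (notMem_of_disj d1),
        Finset.card_insert_of_notMem (notMem_of_disj d2),
        Finset.card_insert_of_notMem (notMem_of_disj d3), Finset.card_erase_of_mem hωA]
      have : 0 < A.card := Finset.card_pos.2 ⟨ω, hωA⟩
      omega
    · intro S
      rw [Finset.filter_erase]
      have := Finset.pred_card_le_card_erase (s := A.filter (fun ω => Absorbs H ω S)) (a := ω)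
      have := habs S
      omega

lemma card_fix {n : ℕ} (i : Fin 3) (a : Fin n) :
    ((Finset.univ : Finset (Fin 3 → Fin n)).filter (fun e => e i = a)).card = n ^ 2 := by
  have := deg3_eq (Finset.univ : Finset (Fin 3 → Fin n)) i a
  unfold deg3 at this
  rw [this]
  simp [link, pow_two]

lemma card_conf {n : ℕ} (hn : 0 < n) [DecidableRel (Conf (n := n))] (ω : (Fin 3 → Fin n) × (Fin 3 → Fin n)) :
    ((Finset.univ.filter (fun ω' => Conf ω ω')).card : ℝ) ≤
      12 / n * Fintype.card ((Fin 3 → Fin n) × (Fin 3 → Fin n)) := by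
  have hsub : (Finset.univ.filter (fun ω' => Conf ω ω')) ⊆
      Finset.univ.biUnion (fun i : Fin 3 =>
        ((((Finset.univ.filter (fun e : Fin 3 → Fin n => e i = ω.1 i)) ×ˢ Finset.univ) ∪
        ((Finset.univ.filter (fun e : Fin 3 → Fin n => e i = ω.2 i)) ×ˢ Finset.univ)) ∪
        ((Finset.univ ×ˢ (Finset.univ.filter (fun e : Fin 3 → Fin n => e i = ω.1 i))) ∪
        (Finset.univ ×ˢ (Finset.univ.filter (fun e : Fin 3 → Fin n => e i = ω.2 i)))))) := by
    intro ω' h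
    obtain ⟨i, h⟩ := (Finset.mem_filter.1 h).2
    simp only [Finset.mem_biUnion, Finset.mem_union, Finset.mem_product, Finset.mem_filter,
      Finset.mem_univ, true_and, and_true]
    refine ⟨i, ?_⟩
    rcases h with h | h | h | h
    · exact Or.inl (Or.inl h.symm)
    · exact Or.inr (Or.inl h.symm)
    · exact Or.inl (Or.inr h.symm)
    · exact Or.inr (Or.inr h.symm)
  have hcard : (Finset.univ.filter (fun ω' => Conf ω ω')).card ≤ 3 * (4 * n ^ 5) := by
    refine (Finset.card_le_card hsub).trans ?_
    refine (Finset.card_biUnion_le).trans ?_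
    refine (Finset.sum_le_card_nsmul _ _ (4 * n ^ 5) ?_).trans (by simp)
    intro i _
    refine (Finset.card_union_le _ _).trans ?_
    refine (Nat.add_le_add (Finset.card_union_le _ _) (Finset.card_union_le _ _)).trans ?_
    simp only [Finset.card_product, card_fix, Finset.card_univ, Fintype.card_pi, Fintype.card_fin,
      Finset.prod_const]
    ring_nf
    exact le_rfl
  have h2 : Fintype.card ((Fin 3 → Fin n) × (Fin 3 → Fin n)) = n ^ 6 := by
    rw [Fintype.card_prod, Fintype.card_pi]; simp; ring
  rw [h2]
  have hn' : (0 : ℝ) < n := by exact_mod_cast hn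
  have h3 : ((Finset.univ.filter (fun ω' => Conf ω ω')).card : ℝ) ≤ 3 * (4 * n ^ 5) := by exact_mod_cast hcard
  refine h3.trans (le_of_eq ?_)
  push_cast
  field_simp
  ring

lemma link_inter {n : ℕ} (H : Finset (Fin 3 → Fin n))
    (hδ : ∀ c x, (0.55 : ℝ) * n ^ 2 ≤ deg3 H c x) (c : Fin 3) (x y : Fin n) :
    (0.1 : ℝ) * n ^ 2 ≤ (link H c x ∩ link H c y).card := by
  have h1 := hδ c x
  have h2 := hδ c y
  rw [deg3_eq] at h1 h2
  have h3 := Finset.card_union_add_card_inter (link H c x) (link H c y)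
  have h4 : (link H c x ∪ link H c y).card ≤ n ^ 2 := by
    refine (Finset.card_le_univ _).trans ?_
    simp [pow_two]
  have h3' : ((link H c x ∪ link H c y).card : ℝ) + (link H c x ∩ link H c y).card =
      (link H c x).card + (link H c y).card := by exact_mod_cast h3
  have h4' : ((link H c x ∪ link H c y).card : ℝ) ≤ n ^ 2 := by exact_mod_cast h4
  linarith

open Classical in
lemma card_absorbs {n : ℕ} (hn : 6000 ≤ n) (H : Finset (Fin 3 → Fin n))
    (hδ : ∀ c x, (0.55 : ℝ) * n ^ 2 ≤ deg3 H c x) (T : Fin 3 → Fin n) :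
    (1 / 200 : ℝ) * n ^ 6 ≤ (Finset.univ.filter (fun ω => Absorbs H ω T)).card := by
  -- the raw family
  set S : Finset (Σ _ : Fin n × Fin n, (Fin n × Fin n) × (Fin n × Fin n)) :=
    (link H 0 (T 0)).sigma (fun p => (link H 1 p.1 ∩ link H 1 (T 1)) ×ˢ (link H 2 p.2 ∩ link H 2 (T 2))) with hS
  have hScard : (0.0055 : ℝ) * n ^ 6 ≤ S.card := by
    rw [hS, Finset.card_sigma]
    push_cast
    have h0 := hδ 0 (T 0)
    rw [deg3_eq] at h0
    calc (0.0055 : ℝ) * n ^ 6 = (0.55 * n ^ 2) * ((0.1 * n ^ 2) * (0.1 * n ^ 2)) := by ring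
      _ ≤ (((link H 0 (T 0)).card : ℕ) : ℝ) * (((0.1 : ℝ) * (n : ℝ) ^ 2) * ((0.1 : ℝ) * (n : ℝ) ^ 2)) :=
          mul_le_mul_of_nonneg_right h0 (by positivity)
      _ = ∑ p ∈ link H 0 (T 0), (((0.1 : ℝ) * (n : ℝ) ^ 2) * ((0.1 : ℝ) * (n : ℝ) ^ 2)) := by
          rw [Finset.sum_const, nsmul_eq_mul]
      _ ≤ _ := by
          apply Finset.sum_le_sum
          intro p _
          rw [Finset.card_product]
          push_cast
          exact mul_le_mul (link_inter H hδ _ _ _) (link_inter H hδ _ _ _) (by positivity) (by positivity)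
  set F : (Σ _ : Fin n × Fin n, (Fin n × Fin n) × (Fin n × Fin n)) → (Fin 3 → Fin n) × (Fin 3 → Fin n) :=
    fun s => (tri 1 s.1.1 s.2.1.1 s.2.1.2, tri 2 s.1.2 s.2.2.1 s.2.2.2) with hF
  have hFinj : Function.Injective F := by
    rintro ⟨⟨a, b⟩, ⟨c, d⟩, e, f⟩ ⟨⟨a', b'⟩, ⟨c', d'⟩, e', f'⟩ h
    simp only [hF, Prod.mk.injEq, tri_inj] at h
    obtain ⟨⟨rfl, rfl, rfl⟩, rfl, rfl, rfl⟩ := h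
    rfl
  set D : Finset ((Fin 3 → Fin n) × (Fin 3 → Fin n)) := Finset.univ.filter (fun ω => ∃ i, ω.1 i = ω.2 i) with hD
  have hDcard : D.card ≤ 3 * n ^ 5 := by
    have hsub : D ⊆ Finset.univ.biUnion (fun i : Fin 3 => (Finset.univ : Finset (Fin 3 → Fin n)).biUnion
        (fun e => (Finset.univ.filter (fun f : Fin 3 → Fin n => f i = e i)).image (fun f => (e, f)))) := by
      intro ω hω
      simp only [hD, Finset.mem_filter, Finset.mem_univ, true_and] at hω
      obtain ⟨i, hi⟩ := hω
      simp only [Finset.mem_biUnion, Finset.mem_univ, true_and, Finset.mem_image, Finset.mem_filter]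
      exact ⟨i, ω.1, ω.2, hi.symm, rfl⟩
    refine (Finset.card_le_card hsub).trans ?_
    refine (Finset.card_biUnion_le).trans ?_
    refine (Finset.sum_le_card_nsmul _ _ (n ^ 5) ?_).trans (by simp)
    intro i _
    refine (Finset.card_biUnion_le).trans ?_
    refine (Finset.sum_le_card_nsmul _ _ (n ^ 2) ?_).trans ?_
    · intro e _
      exact (Finset.card_image_le).trans (card_fix i (e i)).le
    · rw [Finset.card_univ, Fintype.card_pi]; simp; ring_nf; exact le_rfl
  have hsub : S.image F ⊆ (Finset.univ.filter (fun ω => Absorbs H ω T)) ∪ D := by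
    intro ω hω
    rw [Finset.mem_image] at hω
    obtain ⟨⟨⟨y, z⟩, ⟨q, p⟩, r, s⟩, hs, rfl⟩ := hω
    simp only [hS, Finset.mem_sigma, Finset.mem_product, Finset.mem_inter, mem_link] at hs
    obtain ⟨h1, ⟨h2, h3⟩, h4, h5⟩ := hs
    rw [Finset.mem_union]
    by_cases hd : ∃ i, (F ⟨(y, z), (q, p), r, s⟩).1 i = (F ⟨(y, z), (q, p), r, s⟩).2 i
    · right; rw [hD, Finset.mem_filter]; exact ⟨Finset.mem_univ _, hd⟩
    · left
      rw [Finset.mem_filter]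
      push Not at hd
      refine ⟨Finset.mem_univ _, h2, h4, hd, ?_, ?_, ?_⟩
      · have e1 : (F ⟨(y, z), (q, p), r, s⟩).1 1 = y := tri_0 1 y q p
        have e2 : (F ⟨(y, z), (q, p), r, s⟩).2 2 = z := tri_0 2 z r s
        rw [e1, e2]; exact h1
      · have e1 : (F ⟨(y, z), (q, p), r, s⟩).1 0 = p := tri_2 1 y q p
        have e2 : (F ⟨(y, z), (q, p), r, s⟩).1 2 = q := tri_1 1 y q p
        rw [e1, e2]
        convert h3 using 1
        funext i; fin_cases i <;> simp [tri]
      · have e1 : (F ⟨(y, z), (q, p), r, s⟩).2 0 = r := tri_1 2 z r s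
        have e2 : (F ⟨(y, z), (q, p), r, s⟩).2 1 = s := tri_2 2 z r s
        rw [e1, e2]
        convert h5 using 1
        funext i; fin_cases i <;> simp [tri]
  have h1 := Finset.card_le_card hsub
  rw [Finset.card_image_of_injective _ hFinj] at h1
  have h2 := h1.trans (Finset.card_union_le _ _)
  have h3 : (S.card : ℝ) ≤ (Finset.univ.filter (fun ω => Absorbs H ω T)).card + 3 * n ^ 5 := by
    exact_mod_cast h2.trans (Nat.add_le_add_left hDcard _)
  have hn' : (6000 : ℝ) ≤ n := by exact_mod_cast hn
  have h5 : (3 : ℝ) * n ^ 5 ≤ 0.0005 * n ^ 6 := by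
    have : (0 : ℝ) ≤ (n : ℝ) ^ 5 := by positivity
    nlinarith
  linarith

open Classical in
lemma absorb_exists {n : ℕ} (hn : 6000 ≤ n) (H : Finset (Fin 3 → Fin n))
    (hδ : ∀ c x, (0.55 : ℝ) * n ^ 2 ≤ deg3 H c x) (K : ℕ)
    (hK : (K : ℝ) * (12 / n) ≤ (1 / 400) ^ 2 / 32)
    (hexp : (n : ℝ) ^ 3 < Real.exp ((1 / 400) ^ 2 * K / 8)) :
    ∃ A : Finset ((Fin 3 → Fin n) × (Fin 3 → Fin n)), A.card = K ∧
      (∀ a ∈ A, ∀ b ∈ A, a ≠ b → ¬ Conf a b) ∧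
      ∀ T, (1 / 400 : ℝ) * K ≤ (A.filter (fun ω => Absorbs H ω T)).card := by
  have hn0 : 0 < n := by omega
  have h2 : Fintype.card ((Fin 3 → Fin n) × (Fin 3 → Fin n)) = n ^ 6 := by
    rw [Fintype.card_prod, Fintype.card_pi]; simp; ring
  obtain ⟨A, hA, hc, hs⟩ := sampling (Ω := (Fin 3 → Fin n) × (Fin 3 → Fin n)) (T := Fin 3 → Fin n)
    Conf (fun ω => ⟨0, Or.inl rfl⟩)
    (by
      rintro a b ⟨i, h⟩
      refine ⟨i, ?_⟩
      rcases h with h | h | h | h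
      · exact Or.inl h.symm
      · exact Or.inr (Or.inr (Or.inl h.symm))
      · exact Or.inr (Or.inl h.symm)
      · exact Or.inr (Or.inr (Or.inr h.symm)))
    (12 / n) (1 / 400) K (by norm_num) (by norm_num) hK (by rw [h2]; positivity)
    (card_conf hn0) (by rw [Fintype.card_pi]; simpa using hexp)
    (fun T ω => if Absorbs H ω T then 1 else 0)
    (by intro T ω; split_ifs <;> norm_num) (by intro T ω; split_ifs <;> norm_num)
  refine ⟨A, hA, hc, ?_⟩
  intro T
  have h3 := hs T
  rw [h2] at h3
  simp only [Finset.sum_boole] at h3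
  refine le_trans ?_ h3
  apply mul_le_mul_of_nonneg_right _ (by positivity)
  have h4 := card_absorbs hn H hδ T
  have hn' : (0 : ℝ) < n := by exact_mod_cast hn0
  have : (1 / 200 : ℝ) ≤ ((Finset.univ.filter (fun ω => Absorbs H ω T)).card : ℝ) / ((n ^ 6 : ℕ) : ℝ) := by
    rw [le_div_iff₀ (by positivity)]
    push_cast
    exact h4
  linarith

end PM


namespace PM

lemma card_pairs_le {p n : ℕ} (f g : Fin p → Fin n) (hf : Function.Injective f)
    (hg : Function.Injective g) (X Y : Finset (Fin n)) (hX : ∀ j, f j ∈ X) (hY : ∀ j, g j ∈ Y)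
    (P : Fin n × Fin n → Prop) [DecidablePred P] (D : Finset (Fin p × Fin p))
    (hD : ∀ q ∈ D, P (f q.1, g q.2)) :
    D.card ≤ ((X ×ˢ Y).filter P).card := by
  apply Finset.card_le_card_of_injOn (fun q => (f q.1, g q.2))
  · intro q hq
    simp only [Finset.coe_filter, Finset.mem_product, Set.mem_ofPred_eq]
    exact ⟨⟨hX _, hY _⟩, hD q hq⟩
  · rintro ⟨a, b⟩ _ ⟨a', b'⟩ _ h
    simp only [Prod.mk.injEq] at h
    rw [hf h.1, hg h.2]

lemma card_pairs_le' {p n : ℕ} (f g : Fin p → Fin n) (hf : Function.Injective f)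
    (hg : Function.Injective g) (X Y : Finset (Fin n)) (hX : ∀ j, f j ∈ X) (hY : ∀ j, g j ∈ Y)
    (P : Fin n × Fin n → Prop) [DecidablePred P] (D : Finset (Fin p × Fin p))
    (hD : ∀ q ∈ D, P (f q.2, g q.1)) :
    D.card ≤ ((X ×ˢ Y).filter P).card := by
  apply Finset.card_le_card_of_injOn (fun q => (f q.2, g q.1))
  · intro q hq
    simp only [Finset.coe_filter, Finset.mem_product, Set.mem_ofPred_eq]
    exact ⟨⟨hX _, hY _⟩, hD q hq⟩
  · rintro ⟨a, b⟩ _ ⟨a', b'⟩ _ h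
    simp only [Prod.mk.injEq] at h
    rw [hf h.1, hg h.2]

open Classical in
/-- An almost complete balanced block has a perfect matching. -/
lemma dense_block {n p : ℕ} (H : Finset (Fin 3 → Fin n)) (hp : 5 ≤ p)
    (X : Fin 3 → Finset (Fin n)) (hX : ∀ c, (X c).card = p)
    (hbad : ∀ c, ∀ x ∈ X c,
      10 * ((X (c + 1) ×ˢ X (c + 2)).filter (fun q => tri c x q.1 q.2 ∉ H)).card ≤ p ^ 2) :
    ∃ N ⊆ H, IsM N ∧ N.card = p ∧ ∀ e ∈ N, ∀ i, e i ∈ X i := by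
  have hψ : ∀ c, Nonempty (Fin p ≃ X c) := fun c =>
    ⟨(Fintype.equivFinOfCardEq (by simp [hX c])).symm⟩
  have ψ : ∀ c, Fin p ≃ X c := fun c => (hψ c).some
  set g : (Fin 3 → Equiv.Perm (Fin p)) → Fin p → (Fin 3 → Fin n) :=
    fun σ j c => (ψ c (σ c j)).1 with hg
  have ginj : ∀ σ c, Function.Injective (fun j => g σ j c) := by
    intro σ c a b h
    simp only [hg] at h
    exact (σ c).injective ((ψ c).injective (Subtype.ext h))
  have gmem : ∀ σ j c, g σ j c ∈ X c := fun σ j c => (ψ c (σ c j)).2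
  obtain ⟨σ, -, hσ⟩ := Finset.exists_max_image (Finset.univ : Finset (Fin 3 → Equiv.Perm (Fin p)))
    (fun σ => (Finset.univ.filter (fun j => g σ j ∈ H)).card) ⟨1, Finset.mem_univ _⟩
  have hall : ∀ j, g σ j ∈ H := by
    by_contra hne
    push Not at hne
    obtain ⟨x, hx⟩ := hne
    set B1 := Finset.univ.filter (fun q : Fin p × Fin p => tri 0 (g σ x 0) (g σ q.1 1) (g σ q.2 2) ∉ H)
    set B2 := Finset.univ.filter (fun q : Fin p × Fin p => tri 2 (g σ x 2) (g σ q.1 0) (g σ q.2 1) ∉ H)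
    set B3 := Finset.univ.filter (fun q : Fin p × Fin p => tri 1 (g σ x 1) (g σ q.1 2) (g σ q.2 0) ∉ H)
    set D1 := Finset.univ.image (fun a : Fin p => (x, a))
    set D2 := Finset.univ.image (fun a : Fin p => (a, x))
    set D3 := Finset.univ.image (fun a : Fin p => (a, a))
    have b1 : 10 * B1.card ≤ p ^ 2 := by
      refine le_trans (Nat.mul_le_mul_left 10 ?_) (hbad 0 (g σ x 0) (gmem _ _ _))
      exact card_pairs_le (fun j => g σ j 1) (fun j => g σ j 2) (ginj σ 1) (ginj σ 2) _ _
        (fun j => gmem σ j 1) (fun j => gmem σ j 2) _ B1 (fun q hq => (Finset.mem_filter.1 hq).2)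
    have b2 : 10 * B2.card ≤ p ^ 2 := by
      refine le_trans (Nat.mul_le_mul_left 10 ?_) (hbad 2 (g σ x 2) (gmem _ _ _))
      exact card_pairs_le (fun j => g σ j 0) (fun j => g σ j 1) (ginj σ 0) (ginj σ 1) _ _
        (fun j => gmem σ j 0) (fun j => gmem σ j 1) _ B2 (fun q hq => (Finset.mem_filter.1 hq).2)
    have b3 : 10 * B3.card ≤ p ^ 2 := by
      refine le_trans (Nat.mul_le_mul_left 10 ?_) (hbad 1 (g σ x 1) (gmem _ _ _))
      exact card_pairs_le (fun j => g σ j 2) (fun j => g σ j 0) (ginj σ 2) (ginj σ 0) _ _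
        (fun j => gmem σ j 2) (fun j => gmem σ j 0) _ B3 (fun q hq => (Finset.mem_filter.1 hq).2)
    have d1 : D1.card ≤ p := Finset.card_image_le.trans (by simp)
    have d2 : D2.card ≤ p := Finset.card_image_le.trans (by simp)
    have d3 : D3.card ≤ p := Finset.card_image_le.trans (by simp)
    have hlt : (B1 ∪ B2 ∪ B3 ∪ D1 ∪ D2 ∪ D3).card < (Finset.univ : Finset (Fin p × Fin p)).card := by
      have e1 := Finset.card_union_le B1 B2
      have e2 := Finset.card_union_le (B1 ∪ B2) B3
      have e3 := Finset.card_union_le (B1 ∪ B2 ∪ B3) D1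
      have e4 := Finset.card_union_le (B1 ∪ B2 ∪ B3 ∪ D1) D2
      have e5 := Finset.card_union_le (B1 ∪ B2 ∪ B3 ∪ D1 ∪ D2) D3
      have e6 : (Finset.univ : Finset (Fin p × Fin p)).card = p ^ 2 := by simp [pow_two]
      rw [e6]
      have : 5 * p ≤ p ^ 2 := by nlinarith
      omega
    obtain ⟨⟨E, F⟩, -, hEF⟩ := Finset.exists_mem_notMem_of_card_lt_card hlt
    simp only [Finset.mem_union, not_or] at hEF
    obtain ⟨⟨⟨⟨⟨n1, n2⟩, n3⟩, n4⟩, n5⟩, n6⟩ := hEF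
    have m1 : tri 0 (g σ x 0) (g σ E 1) (g σ F 2) ∈ H := by
      by_contra h; exact n1 (Finset.mem_filter.2 ⟨Finset.mem_univ _, h⟩)
    have m2 : tri 2 (g σ x 2) (g σ E 0) (g σ F 1) ∈ H := by
      by_contra h; exact n2 (Finset.mem_filter.2 ⟨Finset.mem_univ _, h⟩)
    have m3 : tri 1 (g σ x 1) (g σ E 2) (g σ F 0) ∈ H := by
      by_contra h; exact n3 (Finset.mem_filter.2 ⟨Finset.mem_univ _, h⟩)
    have hEx : E ≠ x := by
      rintro rfl; exact n4 (Finset.mem_image.2 ⟨F, Finset.mem_univ _, rfl⟩)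
    have hFx : F ≠ x := by
      rintro rfl; exact n5 (Finset.mem_image.2 ⟨E, Finset.mem_univ _, rfl⟩)
    have hEF : E ≠ F := by
      rintro rfl; exact n6 (Finset.mem_image.2 ⟨E, Finset.mem_univ _, rfl⟩)
    -- cyc : x → E → F → x
    set cyc : Equiv.Perm (Fin p) := Equiv.swap x E * Equiv.swap E F with hcyc
    have c1 : cyc x = E := by
      simp only [hcyc, Equiv.Perm.mul_apply]
      rw [Equiv.swap_apply_of_ne_of_ne hEx.symm hFx.symm, Equiv.swap_apply_left]
    have c2 : cyc E = F := by
      simp only [hcyc, Equiv.Perm.mul_apply]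
      rw [Equiv.swap_apply_left, Equiv.swap_apply_of_ne_of_ne hFx hEF.symm]
    have c3 : cyc F = x := by
      simp only [hcyc, Equiv.Perm.mul_apply]
      rw [Equiv.swap_apply_right, Equiv.swap_apply_right]
    have c4 : ∀ j, j ≠ x → j ≠ E → j ≠ F → cyc j = j := by
      intro j h1 h2 h3
      simp only [hcyc, Equiv.Perm.mul_apply]
      rw [Equiv.swap_apply_of_ne_of_ne h2 h3, Equiv.swap_apply_of_ne_of_ne h1 h2]
    have i1 : cyc⁻¹ E = x := by rw [Equiv.Perm.inv_eq_iff_eq, c1]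
    have i2 : cyc⁻¹ F = E := by rw [Equiv.Perm.inv_eq_iff_eq, c2]
    have i3 : cyc⁻¹ x = F := by rw [Equiv.Perm.inv_eq_iff_eq, c3]
    have i4 : ∀ j, j ≠ x → j ≠ E → j ≠ F → cyc⁻¹ j = j := by
      intro j h1 h2 h3
      rw [Equiv.Perm.inv_eq_iff_eq, c4 j h1 h2 h3]
    set σ' : Fin 3 → Equiv.Perm (Fin p) := ![σ 0, σ 1 * cyc, σ 2 * cyc⁻¹] with hσ'
    have g0 : ∀ j, g σ' j 0 = g σ j 0 := by intro j; simp [hg, hσ']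
    have g1 : ∀ j, g σ' j 1 = g σ (cyc j) 1 := by intro j; simp [hg, hσ']
    have g2 : ∀ j, g σ' j 2 = g σ (cyc⁻¹ j) 2 := by intro j; simp [hg, hσ']
    have geq : ∀ j, g σ' j = tri 0 (g σ j 0) (g σ (cyc j) 1) (g σ (cyc⁻¹ j) 2) := by
      intro j
      rw [← g0, ← g1, ← g2]
      exact (tri_eta 0 (g σ' j)).symm
    have rx : g σ' x ∈ H := by rw [geq, c1, i3]; exact m1
    have rE : g σ' E ∈ H := by
      rw [geq, c2, i1]; convert m2 using 1
      funext i; fin_cases i <;> simp [tri]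
    have rF : g σ' F ∈ H := by
      rw [geq, c3, i2]; convert m3 using 1
      funext i; fin_cases i <;> simp [tri]
    have hlt2 : (Finset.univ.filter (fun j => g σ j ∈ H)).card <
        (Finset.univ.filter (fun j => g σ' j ∈ H)).card := by
      apply Finset.card_lt_card
      rw [Finset.ssubset_iff_of_subset]
      · refine ⟨x, Finset.mem_filter.2 ⟨Finset.mem_univ _, rx⟩, ?_⟩
        intro h; exact hx (Finset.mem_filter.1 h).2
      · intro j hj
        refine Finset.mem_filter.2 ⟨Finset.mem_univ _, ?_⟩
        have hj' := (Finset.mem_filter.1 hj).2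
        by_cases h1 : j = x
        · rw [h1]; exact rx
        by_cases h2 : j = E
        · rw [h2]; exact rE
        by_cases h3 : j = F
        · rw [h3]; exact rF
        rw [geq, c4 j h1 h2 h3, i4 j h1 h2 h3]
        rwa [show tri 0 (g σ j 0) (g σ j 1) (g σ j 2) = g σ j from tri_eta 0 (g σ j)]
    exact absurd (hσ σ' (Finset.mem_univ _)) (not_le.2 hlt2)
  have ginj' : Function.Injective (g σ) := fun a b h => ginj σ 0 (congrFun h 0)
  refine ⟨Finset.univ.image (g σ), ?_, ?_, ?_, ?_⟩
  · intro e he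
    obtain ⟨j, -, rfl⟩ := Finset.mem_image.1 he
    exact hall j
  · intro e he f hf hef i
    obtain ⟨j, -, rfl⟩ := Finset.mem_image.1 he
    obtain ⟨j', -, rfl⟩ := Finset.mem_image.1 hf
    intro h
    exact hef (by rw [ginj σ i h])
  · rw [Finset.card_image_of_injective _ ginj']; simp
  · intro e he i
    obtain ⟨j, -, rfl⟩ := Finset.mem_image.1 he
    exact gmem _ _ _

end PM


namespace PM

lemma inter_line {α β γ : Type*} (R : α → β → γ → Prop)
    (hI : ∀ x y z x' y' z', R x y z → R x' y' z' → x = x' ∨ y = y' ∨ z = z')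
    (b : β) (q : α → γ) (hsel : ∀ x, R x b (q x))
    (a1 a2 a3 : α) (h12 : a1 ≠ a2) (h13 : a1 ≠ a3) (h23 : a2 ≠ a3)
    (hβ : ∃ y : β, y ≠ b) (hγ : ∀ z : γ, ∃ z', z' ≠ z)
    (hy : ∀ y, ∃ v t v' t', R v y t ∧ R v' y t' ∧ (v ≠ v' ∨ t ≠ t'))
    (hz : ∀ z, ∃ v y, R v y z) : False := by
  have key : ∀ v y t, y ≠ b → R v y t → ∀ x, x ≠ v → q x = t := by
    intro v y t hyb hR x hx
    rcases hI _ _ _ _ _ _ hR (hsel x) with h | h | h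
    · exact absurd h.symm hx
    · exact absurd h hyb
    · exact h.symm
  obtain ⟨y, hyb⟩ := hβ
  obtain ⟨v, t, v', t', h1, h2, hne⟩ := hy y
  have htt : t = t' := by
    have : ∃ x, x ≠ v ∧ x ≠ v' := by
      by_contra hcon
      push Not at hcon
      have e1 := hcon a1; have e2 := hcon a2; have e3 := hcon a3
      by_cases f1 : a1 = v
      · have g2 := e2 (fun h => h12 (f1.trans h.symm))
        have g3 := e3 (fun h => h13 (f1.trans h.symm))
        exact h23 (g2.trans g3.symm)
      · have g1 := e1 f1
        by_cases f2 : a2 = v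
        · have g3 := e3 (fun h => h23 (f2.trans h.symm))
          exact h13 (g1.trans g3.symm)
        · exact h12 (g1.trans (e2 f2).symm)
    obtain ⟨x, hx, hx'⟩ := this
    rw [← key v y t hyb h1 x hx, ← key v' y t' hyb h2 x hx']
  subst htt
  have hvv : v ≠ v' := by
    rcases hne with h | h
    · exact h
    · exact absurd rfl h
  obtain ⟨s, hs⟩ := hγ t
  obtain ⟨u, w, hR⟩ := hz s
  by_cases hw : w = b
  · subst hw
    have e1 : v = u := by
      rcases hI _ _ _ _ _ _ h1 hR with h | h | h
      · exact h
      · exact absurd h hyb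
      · exact absurd h.symm hs
    have e2 : v' = u := by
      rcases hI _ _ _ _ _ _ h2 hR with h | h | h
      · exact h
      · exact absurd h hyb
      · exact absurd h.symm hs
    exact hvv (e1.trans e2.symm)
  · -- an edge with third coordinate s and second coordinate ≠ b
    have k1 := key u w s hw hR
    have : ∃ x, x ≠ u := by
      by_cases h : a1 = u
      · exact ⟨a2, fun h' => h12 (h.trans h'.symm)⟩
      · exact ⟨a1, h⟩
    have hall : ∀ x, q x = t := by
      intro x
      by_cases h : x = v
      · exact key v' y t hyb h2 x (fun h' => hvv (h.symm.trans h'))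
      · exact key v y t hyb h1 x h
    obtain ⟨x, hx⟩ := this
    exact hs ((k1 x hx).symm.trans (hall x))

lemma inter_false {α β γ : Type*} (R : α → β → γ → Prop)
    (hI : ∀ x y z x' y' z', R x y z → R x' y' z' → x = x' ∨ y = y' ∨ z = z')
    (a1 a2 a3 : α) (h12 : a1 ≠ a2) (h13 : a1 ≠ a3) (h23 : a2 ≠ a3)
    (hβ : ∀ y : β, ∃ y', y' ≠ y) (hγ : ∀ z : γ, ∃ z', z' ≠ z)
    (hx : ∀ x, ∃ y z, R x y z)
    (hy : ∀ y, ∃ v t v' t', R v y t ∧ R v' y t' ∧ (v ≠ v' ∨ t ≠ t'))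
    (hz : ∀ z, ∃ v t v' t', R v t z ∧ R v' t' z ∧ (v ≠ v' ∨ t ≠ t')) : False := by
  choose p q hpq using hx
  by_cases hp : ∀ x, p x = p a1
  · refine inter_line R hI (p a1) q (fun x => by rw [← hp x]; exact hpq x) a1 a2 a3 h12 h13 h23
      (hβ _) hγ hy (fun z => ?_)
    obtain ⟨v, t, -, -, h, -⟩ := hz z
    exact ⟨v, t, h⟩
  · push Not at hp
    obtain ⟨x, hx⟩ := hp
    have hxa : x ≠ a1 := fun h => hx (by rw [h])
    have col : ∀ w w', w ≠ w' → p w = p w' ∨ q w = q w' := by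
      intro w w' h
      rcases hI _ _ _ _ _ _ (hpq w) (hpq w') with h' | h' | h'
      · exact absurd h' h
      · exact Or.inl h'
      · exact Or.inr h'
    have hq : ∀ w, q w = q a1 := by
      intro w
      have e0 : q x = q a1 := by
        rcases col x a1 hxa with h | h
        · exact absurd h hx
        · exact h
      by_cases h1 : w = a1
      · rw [h1]
      by_cases h2 : w = x
      · rw [h2, e0]
      rcases col w a1 h1 with h | h
      · rcases col w x h2 with h' | h'
        · exact absurd (h'.symm.trans h) hx
        · rw [h', e0]
      · exact h
    refine inter_line (fun x z y => R x y z) ?_ (q a1) p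
      (fun x => by rw [← hq x]; exact hpq x) a1 a2 a3 h12 h13 h23
      (hγ _) hβ hz (fun y => ?_)
    · intro x z y x' z' y' h h'
      rcases hI _ _ _ _ _ _ h h' with e | e | e
      · exact Or.inl e
      · exact Or.inr (Or.inr e)
      · exact Or.inr (Or.inl e)
    · obtain ⟨v, t, -, -, h, -⟩ := hy y
      exact ⟨v, t, h⟩

open Classical in
lemma two_disjoint {n : ℕ} (F : Finset (Fin 3 → Fin n)) (Z : Fin 3 → Finset (Fin n))
    (hF : ∀ e ∈ F, ∀ i, e i ∈ Z i) (hZ : ∀ c, 3 ≤ (Z c).card)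
    (hdeg : ∀ c, ∀ x ∈ Z c, 2 ≤ (F.filter (fun e => e c = x)).card) :
    ∃ e ∈ F, ∃ f ∈ F, ∀ i, e i ≠ f i := by
  by_contra hcon
  push Not at hcon
  have two : ∀ c, ∀ x ∈ Z c, ∃ e f, e ∈ F ∧ f ∈ F ∧ e c = x ∧ f c = x ∧ e ≠ f := by
    intro c x hx
    obtain ⟨e, he, f, hf, hne⟩ := Finset.one_lt_card.1 (hdeg c x hx)
    rw [Finset.mem_filter] at he hf
    exact ⟨e, f, he.1, hf.1, he.2, hf.2, hne⟩
  have nontriv : ∀ c, ∀ z : Z c, ∃ z' : Z c, z' ≠ z := by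
    intro c z
    have : Nontrivial (Z c) := by
      rw [← Fintype.one_lt_card_iff_nontrivial]
      simp only [Fintype.card_coe]
      have := hZ c
      omega
    exact exists_ne z
  have h3 : ∃ a1 a2 a3 : Z 0, a1 ≠ a2 ∧ a1 ≠ a3 ∧ a2 ≠ a3 := by
    obtain ⟨a, b, c, ha, hb, hc, h1, h2, h3⟩ := Finset.two_lt_card_iff.1 (hZ 0)
    refine ⟨⟨a, ha⟩, ⟨b, hb⟩, ⟨c, hc⟩, ?_, ?_, ?_⟩ <;> simpa
  obtain ⟨a1, a2, a3, h12, h13, h23⟩ := h3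
  refine inter_false (fun (x : Z 0) (y : Z 1) (z : Z 2) => tri 0 x.1 y.1 z.1 ∈ F) ?_ a1 a2 a3 h12 h13 h23
    (nontriv 1) (nontriv 2) ?_ ?_ ?_
  · intro x y z x' y' z' h h'
    obtain ⟨i, hi⟩ := hcon _ h _ h'
    fin_cases i
    · left; exact Subtype.ext (by simpa [tri] using hi)
    · right; left; exact Subtype.ext (by simpa [tri] using hi)
    · right; right; exact Subtype.ext (by simpa [tri] using hi)
  · intro x
    obtain ⟨e, -, he, -, hx, -⟩ := two 0 x.1 x.2
    refine ⟨⟨e 1, hF e he 1⟩, ⟨e 2, hF e he 2⟩, ?_⟩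
    simp only
    rw [← hx]
    exact (tri_eta 0 e).symm ▸ he
  · intro y
    obtain ⟨e, f, he, hf, hx, hx', hne⟩ := two 1 y.1 y.2
    refine ⟨⟨e 0, hF e he 0⟩, ⟨e 2, hF e he 2⟩, ⟨f 0, hF f hf 0⟩, ⟨f 2, hF f hf 2⟩, ?_, ?_, ?_⟩
    · simp only; rw [← hx]; exact (tri_eta 0 e).symm ▸ he
    · simp only; rw [← hx']; exact (tri_eta 0 f).symm ▸ hf
    · by_contra h
      push Not at h
      simp only [Subtype.mk.injEq] at h
      apply hne
      funext i
      fin_cases i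
      · exact h.1
      · exact hx.trans hx'.symm
      · exact h.2
  · intro y
    obtain ⟨e, f, he, hf, hx, hx', hne⟩ := two 2 y.1 y.2
    refine ⟨⟨e 0, hF e he 0⟩, ⟨e 1, hF e he 1⟩, ⟨f 0, hF f hf 0⟩, ⟨f 1, hF f hf 1⟩, ?_, ?_, ?_⟩
    · simp only; rw [← hx]; exact (tri_eta 0 e).symm ▸ he
    · simp only; rw [← hx']; exact (tri_eta 0 f).symm ▸ hf
    · by_contra h
      push Not at h
      simp only [Subtype.mk.injEq] at h
      apply hne
      funext i
      fin_cases i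
      · exact h.1
      · exact h.2
      · exact hx.trans hx'.symm

lemma thr_lower {n : ℕ} (hn : 2 ≤ n) (g : ℕ) (h : threshold9 n < 9 * g) :
    (n % 3 = 0 ∧ (5 * (n : ℤ) ^ 2 - 6 * n + 9 ≤ 9 * g)) ∨
    (n % 3 = 1 ∧ (5 * (n : ℤ) ^ 2 - 4 * n - 1 + 9 ≤ 9 * g)) ∨
    (n % 3 = 2 ∧ (5 * (n : ℤ) ^ 2 - 8 * n + 5 + 9 ≤ 9 * g)) := by
  unfold threshold9 at h
  have hsq : 2 * n ≤ n ^ 2 := by nlinarith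
  have hmod : n % 3 = 0 ∨ n % 3 = 1 ∨ n % 3 = 2 := by omega
  obtain ⟨k, hk⟩ : ∃ k, k = n / 3 := ⟨_, rfl⟩
  rcases hmod with hm | hm | hm
  · left; refine ⟨hm, ?_⟩
    rw [if_pos hm] at h
    have hn3 : n = 3 * k := by omega
    subst hn3
    have h1 : (5 * (((3 * k) ^ 2 : ℕ) : ℤ) - 6 * (3 * k : ℕ)) < 9 * g := by omega
    push_cast at h1 ⊢
    ring_nf at h1 ⊢
    omega
  · right; left; refine ⟨hm, ?_⟩
    rw [if_neg (by omega), if_pos hm] at h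
    have hn3 : n = 3 * k + 1 := by omega
    subst hn3
    have h1 : (5 * (((3 * k + 1) ^ 2 : ℕ) : ℤ) - 4 * (3 * k + 1 : ℕ) - 1) < 9 * g := by omega
    push_cast at h1 ⊢
    ring_nf at h1 ⊢
    omega
  · right; right; refine ⟨hm, ?_⟩
    rw [if_neg (by omega), if_neg (by omega)] at h
    have hn3 : n = 3 * k + 2 := by omega
    subst hn3
    have h1 : (5 * (((3 * k + 2) ^ 2 : ℕ) : ℤ) - 8 * (3 * k + 2 : ℕ) + 5) < 9 * g := by omega
    push_cast at h1 ⊢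
    ring_nf at h1 ⊢
    omega

lemma arith_main {n : ℕ} (hn : 100 ≤ n) (g : ℕ) (h : threshold9 n < 9 * g) (d z a b : ℤ)
    (ha : 0 ≤ a) (hb : 0 ≤ b) (hd : 1 ≤ d) (hsum : z + (z + a) + (z + b) = 2 * n + d)
    (hab : 4 * (a + b) ≤ n) :
    (d = 1 → 1 ≤ g + (z + a) * (z + b) - (n : ℤ) ^ 2) ∧
    (2 ≤ d → d * n ≤ 20 * (g + (z + a) * (z + b) - (n : ℤ) ^ 2) ∨
      (d = 2 ∧ a = 0 ∧ b = 0 ∧ 2 ≤ g + (z + a) * (z + b) - (n : ℤ) ^ 2)) := by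
  have key : 9 * ((z + a) * (z + b)) = (2 * n + d) ^ 2 + (a + b) * (2 * n + d - 2 * (a + b)) + 9 * (a * b) := by
    rw [← hsum]; ring
  have hab0 : 0 ≤ a * b := mul_nonneg ha hb
  have hnZ : (100 : ℤ) ≤ n := by exact_mod_cast hn
  obtain ⟨A, hA⟩ : ∃ A, A = a + b := ⟨_, rfl⟩
  rw [← hA] at key hab
  have hA0 : 0 ≤ A := by omega
  obtain ⟨D, hD⟩ : ∃ D, D = g + (z + a) * (z + b) - (n : ℤ) ^ 2 := ⟨_, rfl⟩
  rw [← hD]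
  have hAn : 0 ≤ A * (2 * n + d - 2 * A) := mul_nonneg hA0 (by omega)
  rcases thr_lower (by omega) g h with ⟨hm, hg⟩ | ⟨hm, hg⟩ | ⟨hm, hg⟩
  · have h9 : 9 - 6 * n + 4 * n * d + d ^ 2 + A * (2 * n + d - 2 * A) ≤ 9 * D := by
      rw [hD]; nlinarith
    constructor
    · rintro rfl
      have hA1 : 1 ≤ A := by omega
      have : 0 ≤ (A - 1) * (2 * n - 1 - 2 * A) := mul_nonneg (by omega) (by omega)
      nlinarith
    · intro h2; left; nlinarith
  · have h9 : 8 - 4 * n + 4 * n * d + d ^ 2 + A * (2 * n + d - 2 * A) ≤ 9 * D := by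
      rw [hD]; nlinarith
    constructor
    · rintro rfl
      nlinarith
    · intro h2; left; nlinarith
  · have h9 : 14 - 8 * n + 4 * n * d + d ^ 2 + A * (2 * n + d - 2 * A) ≤ 9 * D := by
      rw [hD]; nlinarith
    constructor
    · rintro rfl
      have hA1 : 2 ≤ A := by omega
      have : 0 ≤ (A - 2) * (2 * n - 3 - 2 * A) := mul_nonneg (by omega) (by omega)
      nlinarith
    · intro h2
      rcases eq_or_lt_of_le h2 with h2' | h2'
      · by_cases hA' : A = 0
        · right
          refine ⟨h2'.symm, by omega, by omega, ?_⟩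
          rw [hA', ← h2'] at h9
          ring_nf at h9
          omega
        · left
          have hA3 : 3 ≤ A := by omega
          have : 0 ≤ (A - 3) * (2 * n + d - 6 - 2 * A) := mul_nonneg (by omega) (by omega)
          subst h2'
          nlinarith
      · left; nlinarith

end PM


namespace PM

lemma tri_rot1 {n : ℕ} (c : Fin 3) (x y z : Fin n) : tri (c + 1) y z x = tri c x y z := by
  funext i; fin_cases c <;> fin_cases i <;> simp [tri]

lemma tri_rot2 {n : ℕ} (c : Fin 3) (x y z : Fin n) : tri (c + 2) z x y = tri c x y z := by
  funext i; fin_cases c <;> fin_cases i <;> simp [tri]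

open Classical in
lemma block {n p : ℕ} (H : Finset (Fin 3 → Fin n)) (hp : 5 ≤ p) (c : Fin 3)
    (A B C : Finset (Fin n)) (hA : A.card = p) (hB : B.card = p) (hC : C.card = p)
    (h0 : ∀ x ∈ A, 10 * ((B ×ˢ C).filter (fun q => tri c x q.1 q.2 ∉ H)).card ≤ p ^ 2)
    (h1 : ∀ x ∈ B, 10 * ((C ×ˢ A).filter (fun q => tri (c + 1) x q.1 q.2 ∉ H)).card ≤ p ^ 2)
    (h2 : ∀ x ∈ C, 10 * ((A ×ˢ B).filter (fun q => tri (c + 2) x q.1 q.2 ∉ H)).card ≤ p ^ 2) :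
    ∃ N ⊆ H, IsM N ∧ N.card = p ∧ ∀ e ∈ N, e c ∈ A ∧ e (c + 1) ∈ B ∧ e (c + 2) ∈ C := by
  set X : Fin 3 → Finset (Fin n) := fun i => if i = c then A else if i = c + 1 then B else C with hXdef
  have x0 : X c = A := by simp [hXdef]
  have x1 : X (c + 1) = B := by fin_cases c <;> simp [hXdef]
  have x2 : X (c + 2) = C := by fin_cases c <;> simp [hXdef]
  have k1 : c + 1 + 1 = c + 2 := by fin_cases c <;> rfl
  have k2 : c + 1 + 2 = c := by fin_cases c <;> rfl
  have k3 : c + 2 + 1 = c := by fin_cases c <;> rfl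
  have k4 : c + 2 + 2 = c + 1 := by fin_cases c <;> rfl
  obtain ⟨N, hN, hM, hc, hv⟩ := dense_block H hp X
    (forall_fin3 c (by rw [x0, hA]) (by rw [x1, hB]) (by rw [x2, hC]))
    (forall_fin3 (P := fun c => ∀ x ∈ X c,
      10 * ((X (c + 1) ×ˢ X (c + 2)).filter (fun q => tri c x q.1 q.2 ∉ H)).card ≤ p ^ 2) c
      (by rw [x0, x1, x2]; exact h0) (by rw [k1, k2, x0, x1, x2]; exact h1)
      (by rw [k3, k4, x0, x1, x2]; exact h2))
  refine ⟨N, hN, hM, hc, fun e he => ⟨?_, ?_, ?_⟩⟩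
  · rw [← x0]; exact hv e he c
  · rw [← x1]; exact hv e he (c + 1)
  · rw [← x2]; exact hv e he (c + 2)

open Classical in
/-- ZZ-degree. -/
noncomputable def zz {n : ℕ} (H : Finset (Fin 3 → Fin n)) (Z : Fin 3 → Finset (Fin n)) (c : Fin 3)
    (x : Fin n) : ℕ :=
  ((Z (c + 1) ×ˢ Z (c + 2)).filter (fun q => tri c x q.1 q.2 ∈ H)).card

open Classical in
/-- number of missing ZZ-pairs -/
noncomputable def zm {n : ℕ} (H : Finset (Fin 3 → Fin n)) (Z : Fin 3 → Finset (Fin n)) (c : Fin 3)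
    (x : Fin n) : ℕ :=
  ((Z (c + 1) ×ˢ Z (c + 2)).filter (fun q => tri c x q.1 q.2 ∉ H)).card

lemma zz_add_zm {n : ℕ} (H : Finset (Fin 3 → Fin n)) (Z : Fin 3 → Finset (Fin n)) (c : Fin 3)
    (x : Fin n) : zz H Z c x + zm H Z c x = (Z (c + 1)).card * (Z (c + 2)).card := by
  unfold zz zm
  rw [Finset.card_filter_add_card_filter_not, Finset.card_product]

lemma deg_le_zz {n : ℕ} (H : Finset (Fin 3 → Fin n)) (Z : Fin 3 → Finset (Fin n)) (c : Fin 3)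
    (x : Fin n) : deg3 H c x + (Z (c + 1)).card * (Z (c + 2)).card ≤ zz H Z c x + n ^ 2 := by
  classical
  rw [deg3_eq, ← zz_add_zm H Z c x]
  have : (link H c x).card + zm H Z c x ≤ n ^ 2 := by
    unfold zm
    rw [← Finset.card_union_of_disjoint]
    · refine (Finset.card_le_univ _).trans ?_
      simp [pow_two]
    · rw [Finset.disjoint_left]
      intro q hq hq'
      exact (Finset.mem_filter.1 hq').2 (mem_link.1 hq)
  omega

open Classical in
/-- number of missing pairs touching W -/
noncomputable def wm {n : ℕ} (H : Finset (Fin 3 → Fin n)) (Z : Fin 3 → Finset (Fin n)) (c : Fin 3)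
    (x : Fin n) : ℕ :=
  (Finset.univ.filter (fun q : Fin n × Fin n =>
    (q.1 ∉ Z (c + 1) ∨ q.2 ∉ Z (c + 2)) ∧ tri c x q.1 q.2 ∉ H)).card

lemma wm_le {n : ℕ} (H : Finset (Fin 3 → Fin n)) (Z : Fin 3 → Finset (Fin n)) (c : Fin 3)
    (x : Fin n) : wm H Z c x + deg3 H c x + (Z (c + 1)).card * (Z (c + 2)).card
      ≤ zz H Z c x + n ^ 2 := by
  classical
  rw [deg3_eq, ← zz_add_zm H Z c x]
  have : wm H Z c x + ((link H c x).card + zm H Z c x) ≤ n ^ 2 := by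
    unfold zm wm
    rw [← Finset.card_union_of_disjoint, ← Finset.card_union_of_disjoint]
    · refine (Finset.card_le_univ _).trans ?_
      simp [pow_two]
    · rw [Finset.disjoint_left]
      intro q hq hq'
      have h1 := (Finset.mem_filter.1 hq).2
      rcases Finset.mem_union.1 hq' with h | h
      · exact h1.2 (mem_link.1 h)
      · have h2 := Finset.mem_product.1 (Finset.mem_filter.1 h).1
        rcases h1.1 with h3 | h3
        · exact h3 h2.1
        · exact h3 h2.2
    · rw [Finset.disjoint_left]
      intro q hq hq'
      exact (Finset.mem_filter.1 hq').2 (mem_link.1 hq)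
  omega

open Classical in
/-- A cleaned-up near-extremal partition. -/
structure Clean {n : ℕ} (H : Finset (Fin 3 → Fin n)) (Z : Fin 3 → Finset (Fin n)) : Prop where
  size1 : ∀ c, (2 / 3 - 1 / 100000 : ℝ) * n ≤ (Z c).card
  size2 : ∀ c, ((Z c).card : ℝ) ≤ (2 / 3 + 1 / 100000) * n
  zlow : ∀ c, ∀ x ∈ Z c, (zz H Z c x : ℝ) ≤ 2 / 1000 * n ^ 2
  whigh : ∀ c, ∀ x, x ∉ Z c → (1 / 1000 : ℝ) * n ^ 2 ≤ zz H Z c x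
  bad : ∀ c, ((Finset.univ.filter (fun x => x ∉ Z c ∧ (1 / 200 : ℝ) * n ^ 2 < zm H Z c x)).card : ℝ)
    ≤ 1 / 100000 * n

/-- vertices of class c used by N -/
def used {n : ℕ} (N : Finset (Fin 3 → Fin n)) (c : Fin 3) : Finset (Fin n) := N.image (fun e => e c)

lemma card_used_le {n : ℕ} (N : Finset (Fin 3 → Fin n)) (c : Fin 3) : (used N c).card ≤ N.card :=
  Finset.card_image_le

lemma card_used {n : ℕ} {N : Finset (Fin 3 → Fin n)} (h : IsM N) (c : Fin 3) :
    (used N c).card = N.card := by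
  apply Finset.card_image_of_injOn
  intro e he f hf hef
  by_contra hne
  exact h e he f hf hne c hef

open Classical in
lemma card_wused {n : ℕ} {N : Finset (Fin 3 → Fin n)} (h : IsM N) (c : Fin 3) (Z : Finset (Fin n)) :
    (N.filter (fun e => e c ∉ Z)).card = ((used N c) \ Z).card := by
  have : (used N c) \ Z = (N.filter (fun e => e c ∉ Z)).image (fun e => e c) := by
    ext x
    simp only [used, Finset.mem_sdiff, Finset.mem_image, Finset.mem_filter]
    constructor
    · rintro ⟨⟨e, he, rfl⟩, hx⟩; exact ⟨e, ⟨he, hx⟩, rfl⟩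
    · rintro ⟨e, ⟨he, hx⟩, rfl⟩; exact ⟨⟨e, he, rfl⟩, hx⟩
  rw [this, Finset.card_image_of_injOn]
  intro e he f hf hef
  by_contra hne
  exact h e (Finset.mem_filter.1 he).1 f (Finset.mem_filter.1 hf).1 hne c hef

lemma mem_used {n : ℕ} {N : Finset (Fin 3 → Fin n)} {e : Fin 3 → Fin n} (he : e ∈ N) (c : Fin 3) :
    e c ∈ used N c := Finset.mem_image_of_mem _ he

end PM


namespace PM

lemma wm_bound {n : ℕ} (hn : 100000 ≤ n) {H : Finset (Fin 3 → Fin n)} {Z : Fin 3 → Finset (Fin n)}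
    (hC : Clean H Z) (hdeg : ∀ c x, (5 / 9 : ℝ) * n ^ 2 - n ≤ deg3 H c x) (c : Fin 3) (x : Fin n)
    (hx : x ∈ Z c) : (wm H Z c x : ℝ) ≤ 3 / 1000 * n ^ 2 := by
  have h1 := wm_le H Z c x
  have h2 : (wm H Z c x : ℝ) + deg3 H c x + (Z (c + 1)).card * (Z (c + 2)).card
      ≤ zz H Z c x + n ^ 2 := by exact_mod_cast h1
  have h3 := hdeg c x
  have h4 := hC.zlow c x hx
  have h5 := hC.size1 (c + 1)
  have h6 := hC.size1 (c + 2)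
  have hn' : (100000 : ℝ) ≤ n := by exact_mod_cast hn
  have h7 : ((2 / 3 - 1 / 100000 : ℝ) * n) * ((2 / 3 - 1 / 100000 : ℝ) * n) ≤
      (Z (c + 1)).card * (Z (c + 2)).card := mul_le_mul h5 h6 (by positivity) (by positivity)
  nlinarith

open Classical in
lemma finish {n : ℕ} (hn : 100000 ≤ n) (H : Finset (Fin 3 → Fin n)) (Z : Fin 3 → Finset (Fin n))
    (hC : Clean H Z) (hdeg : ∀ c x, (5 / 9 : ℝ) * n ^ 2 - n ≤ deg3 H c x)
    (N : Finset (Fin 3 → Fin n)) (hNH : N ⊆ H) (hM : IsM N) (hcard : (N.card : ℝ) ≤ 1 / 10000 * n)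
    (hex : (∑ c, (N.filter (fun e => e c ∉ Z c)).card) + n = (∑ c, (Z c)ᶜ.card) + N.card)
    (hbad : ∀ c, ∀ x, x ∉ Z c → (1 / 200 : ℝ) * n ^ 2 < zm H Z c x → x ∈ used N c) :
    ∃ M ⊆ H, IsM M ∧ M.card = n := by
  have hn' : (100000 : ℝ) ≤ n := by exact_mod_cast hn
  set W' : Fin 3 → Finset (Fin n) := fun c => (Z c ∪ used N c)ᶜ with hW'
  set Z' : Fin 3 → Finset (Fin n) := fun c => Z c \ used N c with hZ'
  set p : Fin 3 → ℕ := fun c => (W' c).card with hpdef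
  have cz : ∀ c, (W' c).card + (Z' c).card + N.card = n := by
    intro c
    have h1 := Finset.card_compl_add_card (Z c ∪ used N c)
    have h2 := Finset.card_sdiff_add_card (Z c) (used N c)
    rw [card_used hM] at h2
    rw [Fintype.card_fin] at h1
    simp only [hW', hZ']
    omega
  have cw : ∀ c, (W' c).card + (N.filter (fun e => e c ∉ Z c)).card = (Z c)ᶜ.card := by
    intro c
    rw [card_wused hM, ← Finset.card_union_of_disjoint]
    · congr 1
      ext x
      simp only [hW', Finset.mem_union, Finset.mem_compl, Finset.mem_sdiff]
      tauto
    · rw [Finset.disjoint_left]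
      intro x hx hx'
      simp only [hW', Finset.mem_compl, Finset.mem_union, Finset.mem_sdiff] at hx hx'
      tauto
  have hsum : p 0 + p 1 + p 2 + N.card = n := by
    rw [Fin.sum_univ_three, Fin.sum_univ_three] at hex
    have a0 := cw 0; have a1 := cw 1; have a2 := cw 2
    simp only [hpdef]
    omega
  have hsumc : ∀ c, (Z' c).card = p (c + 1) + p (c + 2) := by
    intro c
    have h1 := cz c
    have h2 : p c + p (c + 1) + p (c + 2) = p 0 + p 1 + p 2 := by
      fin_cases c
      · rfl
      · show p 1 + p 2 + p 0 = _; ring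
      · show p 2 + p 0 + p 1 = _; ring
    have h3 : p c = (W' c).card := rfl
    omega
  have hp : ∀ c, (33 / 100 : ℝ) * n ≤ p c := by
    intro c
    have h1 := cz c
    have h2 : (Z' c).card ≤ (Z c).card := Finset.card_le_card Finset.sdiff_subset
    have h3 := hC.size2 c
    have h4 : (n : ℝ) ≤ p c + (Z c).card + N.card := by
      have : n ≤ p c + (Z c).card + N.card := by
        have h3 : p c = (W' c).card := rfl
        omega
      exact_mod_cast this
    linarith
  have hp2 : ∀ c, (10 : ℝ) * (1 / 200 * n ^ 2) ≤ p c ^ 2 := by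
    intro c
    have := hp c
    nlinarith
  have hp5 : ∀ c, 5 ≤ p c := by
    intro c
    have := hp c
    have : (5 : ℝ) ≤ p c := by linarith
    exact_mod_cast this
  have hY : ∀ c, ∃ Y ⊆ Z' c, Y.card = p (c + 1) := fun c =>
    Finset.exists_subset_card_eq (by rw [hsumc]; omega)
  choose Y hYs hYc using hY
  have hYd : ∀ c, (Z' c \ Y c).card = p (c + 2) := by
    intro c
    have := Finset.card_sdiff_add_card_eq_card (hYs c)
    rw [hYc, hsumc] at this
    omega
  have toNat : ∀ (a : ℕ) (c : Fin 3), (a : ℝ) ≤ 1 / 200 * n ^ 2 → 10 * a ≤ p c ^ 2 := by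
    intro a c h
    have h1 := hp2 c
    have : (10 * a : ℝ) ≤ p c ^ 2 := by linarith
    exact_mod_cast this
  have hZsub : ∀ c, Z' c ⊆ Z c := fun c => Finset.sdiff_subset
  have k1 : ∀ c : Fin 3, c + 1 + 1 = c + 2 := by decide
  have k2 : ∀ c : Fin 3, c + 1 + 2 = c := by decide
  have k3 : ∀ c : Fin 3, c + 2 + 1 = c := by decide
  have k4 : ∀ c : Fin 3, c + 2 + 2 = c + 1 := by decide
  have hwnz : ∀ c, ∀ x ∈ W' c, x ∉ Z c ∧ x ∉ used N c := by
    intro c x hx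
    simp only [hW', Finset.mem_compl, Finset.mem_union] at hx
    tauto
  have hblock : ∀ c, ∃ B ⊆ H, IsM B ∧ B.card = p c ∧
      ∀ e ∈ B, e c ∈ W' c ∧ e (c + 1) ∈ Z' (c + 1) \ Y (c + 1) ∧ e (c + 2) ∈ Y (c + 2) := by
    intro c
    refine block H (hp5 c) c (W' c) _ _ rfl (by rw [hYd, k2]) (by rw [hYc, k3]) ?_ ?_ ?_
    · intro x hx
      apply toNat
      obtain ⟨hx1, hx2⟩ := hwnz c x hx
      have h1 : ((zm H Z c x : ℕ) : ℝ) ≤ 1 / 200 * n ^ 2 := by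
        by_contra h
        push Not at h
        exact hx2 (hbad c x hx1 h)
      refine le_trans ?_ h1
      norm_cast
      unfold zm
      apply Finset.card_le_card
      apply Finset.filter_subset_filter
      exact Finset.product_subset_product (Finset.sdiff_subset.trans (hZsub _)) ((hYs _).trans (hZsub _))
    · intro x hx
      apply toNat
      have hxZ : x ∈ Z (c + 1) := hZsub _ (Finset.sdiff_subset hx)
      have h1 := wm_bound hn hC hdeg (c + 1) x hxZ
      have h2 : ((wm H Z (c + 1) x : ℕ) : ℝ) ≤ 1 / 200 * n ^ 2 := by nlinarith
      refine le_trans ?_ h2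
      norm_cast
      unfold wm
      apply Finset.card_le_card
      intro q hq
      rw [Finset.mem_filter, Finset.mem_product] at hq
      rw [Finset.mem_filter, k2]
      exact ⟨Finset.mem_univ _, Or.inr (hwnz c _ hq.1.2).1, hq.2⟩
    · intro x hx
      apply toNat
      have hxZ : x ∈ Z (c + 2) := hZsub _ (hYs _ hx)
      have h1 := wm_bound hn hC hdeg (c + 2) x hxZ
      have h2 : ((wm H Z (c + 2) x : ℕ) : ℝ) ≤ 1 / 200 * n ^ 2 := by nlinarith
      refine le_trans ?_ h2
      norm_cast
      unfold wm
      apply Finset.card_le_card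
      intro q hq
      rw [Finset.mem_filter, Finset.mem_product] at hq
      rw [Finset.mem_filter, k3]
      exact ⟨Finset.mem_univ _, Or.inl (hwnz c _ hq.1.1).1, hq.2⟩
  choose B hBH hBM hBc hBv using hblock
  have hBu : ∀ c, ∀ e ∈ B c, ∀ i, e i ∉ used N i := by
    intro c e he
    obtain ⟨h0, h1, h2⟩ := hBv c e he
    refine forall_fin3 c ?_ ?_ ?_
    · exact (hwnz c _ h0).2
    · exact (Finset.mem_sdiff.1 (Finset.sdiff_subset h1)).2
    · exact (Finset.mem_sdiff.1 (hYs _ h2)).2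
  have hBB : ∀ c, ∀ e ∈ B c, ∀ f ∈ B (c + 1), ∀ i, e i ≠ f i := by
    intro c e he f hf
    obtain ⟨h0, h1, h2⟩ := hBv c e he
    obtain ⟨g0, g1, g2⟩ := hBv (c + 1) f hf
    rw [k1] at g1
    rw [k2] at g2
    refine forall_fin3 c ?_ ?_ ?_
    · intro h; rw [h] at h0
      exact (hwnz c _ h0).1 (hZsub _ (hYs _ g2))
    · intro h; rw [h] at h1
      exact (hwnz _ _ g0).1 (hZsub _ (Finset.sdiff_subset h1))
    · intro h; rw [h] at h2
      exact (Finset.mem_sdiff.1 g1).2 h2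
  have hNB : ∀ c, ∀ e ∈ N, ∀ f ∈ B c, ∀ i, e i ≠ f i := by
    intro c e he f hf i h
    exact hBu c f hf i (h ▸ mem_used he i)
  have d01 : ∀ e ∈ B 0, ∀ f ∈ B 1, ∀ i, e i ≠ f i := hBB 0
  have d12 : ∀ e ∈ B 1, ∀ f ∈ B 2, ∀ i, e i ≠ f i := hBB 1
  have d02 : ∀ e ∈ B 0, ∀ f ∈ B 2, ∀ i, e i ≠ f i :=
    fun e he f hf i h => hBB 2 f hf e he i h.symm
  have dA : ∀ e ∈ N ∪ B 0, ∀ f ∈ B 1, ∀ i, e i ≠ f i := by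
    intro e he
    rcases Finset.mem_union.1 he with h | h
    · exact hNB 1 e h
    · exact d01 e h
  have dB : ∀ e ∈ (N ∪ B 0) ∪ B 1, ∀ f ∈ B 2, ∀ i, e i ≠ f i := by
    intro e he
    rcases Finset.mem_union.1 he with h | h
    · rcases Finset.mem_union.1 h with h | h
      · exact hNB 2 e h
      · exact d02 e h
    · exact d12 e h
  refine ⟨((N ∪ B 0) ∪ B 1) ∪ B 2, ?_, ?_, ?_⟩
  · exact Finset.union_subset (Finset.union_subset (Finset.union_subset hNH (hBH 0)) (hBH 1)) (hBH 2)
  · exact ((hM.union (hBM 0) (hNB 0)).union (hBM 1) dA).union (hBM 2) dB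
  · rw [card_union_of_disj dB, card_union_of_disj dA, card_union_of_disj (hNB 0), hBc, hBc, hBc]
    omega

end PM


namespace PM

open Classical in
lemma greedy {n : ℕ} {ι : Type*} (F : ι → Finset (Fin 3 → Fin n)) (N0 : Finset (Fin 3 → Fin n))
    (hN0 : IsM N0) (L : ℕ) (I : Finset ι) :
    (∀ i ∈ I, ∀ N : Finset (Fin 3 → Fin n), IsM N → N.card < L →
      (∀ e ∈ N, e ∈ N0 ∨ ∃ j ∈ I, j ≠ i ∧ e ∈ F j) → ∃ e ∈ F i, ∀ f ∈ N, ∀ k, e k ≠ f k) →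
    N0.card + I.card ≤ L →
    ∃ N1 : Finset (Fin 3 → Fin n), IsM N1 ∧ (∀ e ∈ N0, ∀ f ∈ N1, ∀ k, e k ≠ f k) ∧
      N1.card = I.card ∧ (∀ e ∈ N1, ∃ j ∈ I, e ∈ F j) ∧ ∀ i ∈ I, ∃ e ∈ N1, e ∈ F i := by
  induction I using Finset.induction_on with
  | empty =>
    intro _ _
    exact ⟨∅, fun e he => absurd he (Finset.notMem_empty _), fun e _ f hf => absurd hf (Finset.notMem_empty _), rfl,
      fun e he => absurd he (Finset.notMem_empty _), fun e he => absurd he (Finset.notMem_empty _)⟩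
  | insert i I hi ih =>
    intro hyp hL
    rw [Finset.card_insert_of_notMem hi] at hL
    obtain ⟨N1, hM1, hd, hc, hF, hF'⟩ := ih (fun j hj N hN hNL hNF =>
      hyp j (Finset.mem_insert_of_mem hj) N hN hNL (fun e he => by
        rcases hNF e he with h | ⟨k, hk, hkj, hek⟩
        · exact Or.inl h
        · exact Or.inr ⟨k, Finset.mem_insert_of_mem hk, hkj, hek⟩)) (by omega)
    obtain ⟨e, heF, hed⟩ := hyp i (Finset.mem_insert_self _ _) (N0 ∪ N1) (hN0.union hM1 hd)
      (by rw [card_union_of_disj hd]; omega) (fun e he => by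
        rcases Finset.mem_union.1 he with h | h
        · exact Or.inl h
        · obtain ⟨j, hj, hej⟩ := hF e h
          exact Or.inr ⟨j, Finset.mem_insert_of_mem hj, fun h' => hi (h' ▸ hj), hej⟩)
    have hd1 : ∀ f ∈ N1, ∀ k, e k ≠ f k := fun f hf => hed f (Finset.mem_union_right _ hf)
    refine ⟨insert e N1, hM1.insert hd1, ?_, ?_, ?_, ?_⟩
    · intro f hf g hg k
      rcases Finset.mem_insert.1 hg with rfl | hg
      · exact (hed f (Finset.mem_union_left _ hf) k).symm
      · exact hd f hf g hg k
    · rw [Finset.card_insert_of_notMem hi, Finset.card_insert_of_notMem (notMem_of_disj hd1), hc]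
    · intro f hf
      rcases Finset.mem_insert.1 hf with rfl | hf
      · exact ⟨i, Finset.mem_insert_self _ _, heF⟩
      · obtain ⟨j, hj, h⟩ := hF f hf
        exact ⟨j, Finset.mem_insert_of_mem hj, h⟩
    · intro j hj
      rcases Finset.mem_insert.1 hj with rfl | hj
      · exact ⟨e, Finset.mem_insert_self _ _, heF⟩
      · obtain ⟨f, hf, h⟩ := hF' j hj
        exact ⟨f, Finset.mem_insert_of_mem hf, h⟩

lemma avoid_pair {n : ℕ} (S : Finset (Fin n × Fin n)) (A B : Finset (Fin n))
    (h : (A.card + B.card) * n < S.card) : ∃ q ∈ S, q.1 ∉ A ∧ q.2 ∉ B := by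
  have h1 : ((A ×ˢ Finset.univ) ∪ (Finset.univ ×ˢ B)).card < S.card := by
    refine lt_of_le_of_lt (Finset.card_union_le _ _) ?_
    rw [Finset.card_product, Finset.card_product]
    simp only [Finset.card_univ, Fintype.card_fin]
    linarith
  obtain ⟨q, hq, hq'⟩ := Finset.exists_mem_notMem_of_card_lt_card h1
  refine ⟨q, hq, ?_, ?_⟩
  · intro h; exact hq' (Finset.mem_union_left _ (Finset.mem_product.2 ⟨h, Finset.mem_univ _⟩))
  · intro h; exact hq' (Finset.mem_union_right _ (Finset.mem_product.2 ⟨Finset.mem_univ _, h⟩))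

lemma disj_of_notMem_used {n : ℕ} {N : Finset (Fin 3 → Fin n)} {e : Fin 3 → Fin n}
    (h : ∀ k, e k ∉ used N k) : ∀ f ∈ N, ∀ k, e k ≠ f k :=
  fun _ hf k he => h k (he ▸ mem_used hf k)

open Classical in
lemma deg_zzz {n : ℕ} (H : Finset (Fin 3 → Fin n)) (Z : Fin 3 → Finset (Fin n)) (c : Fin 3) (x : Fin n)
    (hx : x ∈ Z c) : deg3 (H.filter (fun e => ∀ i, e i ∈ Z i)) c x = zz H Z c x := by
  rw [deg3_eq]
  unfold zz
  congr 1
  ext q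
  rw [mem_link, Finset.mem_filter, Finset.mem_filter, Finset.mem_product]
  constructor
  · rintro ⟨h1, h2⟩
    have a1 := h2 (c + 1)
    have a2 := h2 (c + 2)
    rw [tri_1] at a1
    rw [tri_2] at a2
    exact ⟨⟨a1, a2⟩, h1⟩
  · rintro ⟨⟨h1, h2⟩, h3⟩
    refine ⟨h3, forall_fin3 c ?_ ?_ ?_⟩
    · rwa [tri_0]
    · rwa [tri_1]
    · rwa [tri_2]

open Classical in
lemma zzz_matching {n : ℕ} (hn : 100000 ≤ n) (H : Finset (Fin 3 → Fin n)) (Z : Fin 3 → Finset (Fin n))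
    (hC : Clean H Z) (hthr : ∀ (c : Fin 3) (x : Fin n), threshold9 n < 9 * deg3 H c x)
    (d : ℕ) (hd : 1 ≤ d) (hsum : (Z 0).card + (Z 1).card + (Z 2).card = 2 * n + d) :
    ∃ N ⊆ H, IsM N ∧ N.card = d ∧ ∀ e ∈ N, ∀ i, e i ∈ Z i := by
  have hn' : (100000 : ℝ) ≤ n := by exact_mod_cast hn
  set F := H.filter (fun e => ∀ i, e i ∈ Z i) with hF
  have hsumc : ∀ c, (Z c).card + (Z (c + 1)).card + (Z (c + 2)).card = 2 * n + d := by
    intro c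
    rw [← hsum]
    fin_cases c
    · rfl
    · show (Z 1).card + (Z 2).card + (Z 0).card = _; ring
    · show (Z 2).card + (Z 0).card + (Z 1).card = _; ring
  have hFZ : ∀ e ∈ F, ∀ i, e i ∈ Z i := fun e he => (Finset.mem_filter.1 he).2
  have hFH : F ⊆ H := Finset.filter_subset _ _
  -- minimal class
  obtain ⟨c, -, hmin⟩ := Finset.exists_min_image (Finset.univ : Finset (Fin 3)) (fun c => (Z c).card)
    ⟨0, Finset.mem_univ _⟩
  have hmin1 := hmin (c + 1) (Finset.mem_univ _)
  have hmin2 := hmin (c + 2) (Finset.mem_univ _)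
  have hdiff : 4 * (((Z (c + 1)).card - (Z c).card : ℤ) + ((Z (c + 2)).card - (Z c).card)) ≤ n := by
    have a0 := hC.size1 c
    have a1 := hC.size2 (c + 1)
    have a2 := hC.size2 (c + 2)
    have : (4 : ℝ) * (((Z (c + 1)).card - (Z c).card) + ((Z (c + 2)).card - (Z c).card)) ≤ n := by linarith
    exact_mod_cast this
  have hD : ∀ c, ∀ x ∈ Z c, (deg3 H c x : ℤ) + (Z (c + 1)).card * (Z (c + 2)).card - (n : ℤ) ^ 2
      ≤ deg3 F c x := by
    intro c x hx
    rw [hF, deg_zzz H Z c x hx]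
    have := deg_le_zz H Z c x
    have h2 : (deg3 H c x : ℤ) + (Z (c + 1)).card * (Z (c + 2)).card ≤ zz H Z c x + (n : ℤ) ^ 2 := by
      exact_mod_cast this
    linarith
  have har : ∀ x, _ := fun x => arith_main (n := n) (by omega) (deg3 H c x) (hthr c x) d (Z c).card
    ((Z (c + 1)).card - (Z c).card) ((Z (c + 2)).card - (Z c).card)
    (by omega) (by omega) (by omega)
    (by have := hsumc c; ring_nf; zify at this; linarith) hdiff
  simp only [add_sub_cancel] at har
  have hZc : ∀ c, 3 ≤ (Z c).card := by
    intro c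
    have := hC.size1 c
    have h2 : (3 : ℝ) ≤ (Z c).card := by nlinarith
    exact_mod_cast h2
  obtain ⟨x0, hx0⟩ : (Z c).Nonempty := Finset.card_pos.1 (by have := hZc c; omega)
  rcases Nat.eq_or_lt_of_le hd with hd1 | hd2
  · -- d = 1
    have h1 := (har x0).1 (by omega)
    have h2 := hD c x0 hx0
    have h3 : 0 < deg3 F c x0 := by omega
    obtain ⟨e, he⟩ := Finset.card_pos.1 h3
    have heF := (Finset.mem_filter.1 he).1
    refine ⟨{e}, Finset.singleton_subset_iff.2 (hFH heF), ?_, by simp [hd1], ?_⟩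
    · intro a ha b hb hab
      rw [Finset.mem_singleton] at ha hb
      exact absurd (ha.trans hb.symm) hab
    · intro a ha; rw [Finset.mem_singleton] at ha; rw [ha]; exact hFZ e heF
  · by_cases hbig : ∀ x ∈ Z c, (d : ℤ) * n ≤ 20 * deg3 F c x
    · obtain ⟨N, hN, hmax⟩ := Finset.exists_max_image (F.powerset.filter IsM) (fun N => N.card)
        ⟨∅, Finset.mem_filter.2 ⟨Finset.empty_mem_powerset _, fun e he => absurd he (Finset.notMem_empty _)⟩⟩
      rw [Finset.mem_filter, Finset.mem_powerset] at hN
      by_cases hNd : d ≤ N.card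
      · obtain ⟨N', hN', hc'⟩ := Finset.exists_subset_card_eq hNd
        exact ⟨N', (hN'.trans hN.1).trans hFH, hN.2.mono hN', hc', fun e he => hFZ e (hN.1 (hN' he))⟩
      · exfalso
        push Not at hNd
        have hcover : F ⊆ Finset.univ.biUnion (fun i : Fin 3 => N.biUnion (fun e => F.filter (fun f => f i = e i))) := by
          intro f hf
          by_contra hcon
          have hdis : ∀ e ∈ N, ∀ i, f i ≠ e i := by
            intro e he i h
            apply hcon
            rw [Finset.mem_biUnion]
            exact ⟨i, Finset.mem_univ _, Finset.mem_biUnion.2 ⟨e, he, Finset.mem_filter.2 ⟨hf, h⟩⟩⟩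
          have := hmax (insert f N) (Finset.mem_filter.2 ⟨Finset.mem_powerset.2
            (Finset.insert_subset hf hN.1), hN.2.insert hdis⟩)
          rw [Finset.card_insert_of_notMem (notMem_of_disj hdis)] at this
          omega
        have hub : (F.card : ℝ) ≤ 3 * (N.card * (2 / 1000 * (n : ℝ) ^ 2)) := by
          have h1 := (Finset.card_le_card hcover).trans Finset.card_biUnion_le
          have h2 : (F.card : ℝ) ≤ ∑ i : Fin 3, ((N.biUnion (fun e => F.filter (fun f => f i = e i))).card : ℝ) := by
            exact_mod_cast h1
          refine h2.trans ?_
          have h3 : ∀ i : Fin 3, ((N.biUnion (fun e => F.filter (fun f => f i = e i))).card : ℝ) ≤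
              N.card * (2 / 1000 * (n : ℝ) ^ 2) := by
            intro i
            have h4 : ((N.biUnion (fun e => F.filter (fun f => f i = e i))).card : ℝ) ≤
              ∑ e ∈ N, (((F.filter (fun f => f i = e i)).card : ℕ) : ℝ) := by
              exact_mod_cast (Finset.card_biUnion_le (s := N) (t := fun e => F.filter (fun f => f i = e i)))
            refine h4.trans ?_
            rw [← nsmul_eq_mul]
            apply Finset.sum_le_card_nsmul
            intro e he
            have hei := hFZ e (hN.1 he) i
            have h5 := hC.zlow i (e i) hei
            rw [← deg_zzz H Z i (e i) hei] at h5
            exact h5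
          calc _ ≤ ∑ i : Fin 3, (N.card * (2 / 1000 * (n : ℝ) ^ 2) : ℝ) := Finset.sum_le_sum (fun i _ => h3 i)
            _ = _ := by simp
        have hlb : ((Z c).card : ℝ) * (d * n / 20) ≤ F.card := by
          have h1 : F.card = ∑ x ∈ Z c, deg3 F c x :=
            Finset.card_eq_sum_card_fiberwise (fun e he => hFZ e he c)
          rw [h1, ← nsmul_eq_mul]
          push_cast
          apply Finset.card_nsmul_le_sum
          intro x hx
          have h2 := hbig x hx
          have h3 : (d : ℝ) * n ≤ 20 * deg3 F c x := by exact_mod_cast h2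
          linarith
        have hz := hC.size1 c
        have hdpos : (2 : ℝ) ≤ d := by exact_mod_cast hd2
        have hNd' : (N.card : ℝ) ≤ d := by exact_mod_cast hNd.le
        have e1 : (0.6 * (n : ℝ)) * (d * n / 20) ≤ ((Z c).card : ℝ) * (d * n / 20) := by
          apply mul_le_mul_of_nonneg_right _ (by positivity)
          linarith
        have e2 : 3 * (N.card * (2 / 1000 * (n : ℝ) ^ 2)) ≤ 3 * (d * (2 / 1000 * (n : ℝ) ^ 2)) := by gcongr
        have e3 : 0 < (d : ℝ) * n ^ 2 := by positivity
        nlinarith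
    · push Not at hbig
      obtain ⟨x1, hx1, hx1'⟩ := hbig
      have h1 := (har x1).2 (by exact_mod_cast hd2)
      have h2 := hD c x1 hx1
      rcases h1 with h1 | ⟨hd', ha, hb, -⟩
      · exfalso; linarith
      · have hd3 : d = 2 := by exact_mod_cast hd'
        have eqs : ∀ c', (Z c').card = (Z c).card := by
          refine forall_fin3 c rfl ?_ ?_
          · omega
          · omega
        have hdeg2 : ∀ c, ∀ x ∈ Z c, 2 ≤ (F.filter (fun e => e c = x)).card := by
          intro c' x hx
          have := (arith_main (n := n) (by omega) (deg3 H c' x) (hthr c' x) d (Z c').card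
            0 0 le_rfl le_rfl (by omega)
            (by have := hsumc c'; have q1 := eqs c'; have q2 := eqs (c' + 1); have q3 := eqs (c' + 2); omega) (by omega)).2 (by omega)
          have h5 := hD c' x hx
          rw [eqs (c' + 1), eqs (c' + 2), ← eqs c'] at h5
          simp only [add_zero] at this
          have h6 : (2 : ℤ) ≤ deg3 F c' x := by
            rcases this with h | h
            · have : (20 : ℤ) * 2 ≤ d * n := by rw [hd']; omega
              omega
            · exact h.2.2.2.trans h5
          exact_mod_cast h6
        obtain ⟨e, he, f, hf, hef⟩ := two_disjoint F Z hFZ hZc hdeg2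
        have hne : e ≠ f := fun h => hef 0 (by rw [h])
        refine ⟨{e, f}, ?_, ?_, ?_, ?_⟩
        · intro g hg
          rw [Finset.mem_insert, Finset.mem_singleton] at hg
          rcases hg with rfl | rfl
          · exact hFH he
          · exact hFH hf
        · intro a ha b hb hab i
          rw [Finset.mem_insert, Finset.mem_singleton] at ha hb
          rcases ha with rfl | rfl <;> rcases hb with rfl | rfl
          · exact absurd rfl hab
          · exact hef i
          · exact (hef i).symm
          · exact absurd rfl hab
        · rw [Finset.card_pair hne, hd3]
        · intro g hg
          rw [Finset.mem_insert, Finset.mem_singleton] at hg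
          rcases hg with rfl | rfl
          · exact hFZ _ he
          · exact hFZ _ hf

end PM


namespace PM

lemma deg_lower {n : ℕ} (hn : 2 ≤ n) (H : Finset (Fin 3 → Fin n))
    (hthr : ∀ (c : Fin 3) (x : Fin n), threshold9 n < 9 * deg3 H c x) (c : Fin 3) (x : Fin n) :
    (5 / 9 : ℝ) * n ^ 2 - n ≤ deg3 H c x := by
  have hn' : (0 : ℝ) ≤ n := by positivity
  rcases thr_lower hn _ (hthr c x) with ⟨-, h⟩ | ⟨-, h⟩ | ⟨-, h⟩
  · have : (5 * (n : ℝ) ^ 2 - 6 * n + 9 ≤ 9 * deg3 H c x) := by exact_mod_cast h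
    linarith
  · have : (5 * (n : ℝ) ^ 2 - 4 * n - 1 + 9 ≤ 9 * deg3 H c x) := by exact_mod_cast h
    linarith
  · have : (5 * (n : ℝ) ^ 2 - 8 * n + 5 + 9 ≤ 9 * deg3 H c x) := by exact_mod_cast h
    linarith

open Classical in
/-- total number of incidences with the complement of Z -/
lemma wsum_eq {n : ℕ} (N : Finset (Fin 3 → Fin n)) (Z : Fin 3 → Finset (Fin n)) :
    (∑ c, (N.filter (fun e => e c ∉ Z c)).card) =
      ∑ e ∈ N, ∑ c : Fin 3, (if e c ∉ Z c then 1 else 0) := by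
  rw [Finset.sum_comm]
  apply Finset.sum_congr rfl
  intro c _
  rw [Finset.card_filter]

open Classical in
lemma clean_pm {n : ℕ} (hn : 100000 ≤ n) (H : Finset (Fin 3 → Fin n)) (Z : Fin 3 → Finset (Fin n))
    (hC : Clean H Z) (hthr : ∀ (c : Fin 3) (x : Fin n), threshold9 n < 9 * deg3 H c x) :
    ∃ M ⊆ H, IsM M ∧ M.card = n := by
  have hn' : (100000 : ℝ) ≤ n := by exact_mod_cast hn
  have hdeg := deg_lower (by omega) H hthr
  -- stage 0
  have st0 : ∃ N0 ⊆ H, ∃ s : ℕ, IsM N0 ∧ (∀ e ∈ N0, ∀ i, e i ∈ Z i) ∧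
      (Z 0).card + (Z 1).card + (Z 2).card + s = 2 * n + N0.card ∧
      ((N0.card : ℝ) + s ≤ 3 / 100000 * n) := by
    have a0 := hC.size1 0; have a1 := hC.size1 1; have a2 := hC.size1 2
    have b0 := hC.size2 0; have b1 := hC.size2 1; have b2 := hC.size2 2
    by_cases h : 2 * n < (Z 0).card + (Z 1).card + (Z 2).card
    · obtain ⟨d, hd⟩ : ∃ d, (Z 0).card + (Z 1).card + (Z 2).card = 2 * n + d := ⟨_, (Nat.add_sub_of_le h.le).symm⟩
      obtain ⟨N, hN, hM, hc, hz⟩ := zzz_matching hn H Z hC hthr d (by omega) hd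
      refine ⟨N, hN, 0, hM, hz, by omega, ?_⟩
      rw [hc]
      have hd' : ((Z 0).card : ℝ) + (Z 1).card + (Z 2).card = 2 * n + d := by exact_mod_cast hd
      push_cast
      linarith
    · obtain ⟨s, hs⟩ : ∃ s, (Z 0).card + (Z 1).card + (Z 2).card + s = 2 * n :=
        ⟨_, Nat.add_sub_of_le (not_lt.1 h)⟩
      refine ⟨∅, by simp, s, fun e he => absurd he (Finset.notMem_empty _),
        fun e he => absurd he (Finset.notMem_empty _), by simp [hs], ?_⟩
      have hs' : ((Z 0).card : ℝ) + (Z 1).card + (Z 2).card + s = 2 * n := by exact_mod_cast hs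
      simp only [Finset.card_empty, Nat.cast_zero]
      linarith
  obtain ⟨N0, hN0H, s, hM0, hN0Z, hs, hsmall⟩ := st0
  -- stage 1 : bad vertices
  set I : Finset (Fin 3 × Fin n) := Finset.univ.filter
    (fun v => v.2 ∉ Z v.1 ∧ (1 / 200 : ℝ) * n ^ 2 < zm H Z v.1 v.2) with hI
  have hIcard : (I.card : ℝ) ≤ 3 / 100000 * n := by
    have h1 : I.card = ∑ c : Fin 3, (Finset.univ.filter
        (fun x => x ∉ Z c ∧ (1 / 200 : ℝ) * n ^ 2 < zm H Z c x)).card := by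
      rw [hI, Finset.card_filter, ← Finset.univ_product_univ, Finset.sum_product]
      apply Finset.sum_congr rfl
      intro c _
      rw [Finset.card_filter]
    rw [h1, Fin.sum_univ_three]
    push_cast
    have h0 := hC.bad 0; have h1 := hC.bad 1; have h2 := hC.bad 2
    linarith
  set F : Fin 3 × Fin n → Finset (Fin 3 → Fin n) := fun v =>
    H.filter (fun e => e v.1 = v.2 ∧ e (v.1 + 1) ∈ Z (v.1 + 1) ∧ e (v.1 + 2) ∈ Z (v.1 + 2)) with hF
  have hFw : ∀ v ∈ I, ∀ e ∈ F v, ∀ i, e i ∉ Z i → i = v.1 := by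
    intro v _ e he
    obtain ⟨h1, h2, h3, h4⟩ := Finset.mem_filter.1 he
    refine forall_fin3 v.1 (fun _ => rfl) (fun h => absurd h3 h) (fun h => absurd h4 h)
  obtain ⟨N1, hM1, hd1, hc1, hF1, hF1'⟩ := greedy F N0 hM0 (N0.card + I.card) I (by
    intro v hv N hMN hNc hNF
    obtain ⟨hv1, hv2⟩ := (Finset.mem_filter.1 hv).2
    have hwh := hC.whigh v.1 v.2 hv1
    obtain ⟨q, hq, hqA, hqB⟩ := avoid_pair ((Z (v.1 + 1) ×ˢ Z (v.1 + 2)).filter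
      (fun q => tri v.1 v.2 q.1 q.2 ∈ H)) (used N (v.1 + 1)) (used N (v.1 + 2)) (by
        have h1 := card_used_le N (v.1 + 1)
        have h2 := card_used_le N (v.1 + 2)
        have h3 : ((used N (v.1 + 1)).card : ℝ) + (used N (v.1 + 2)).card ≤ 2 * (6 / 100000 * n) := by
          have : ((used N (v.1 + 1)).card : ℝ) + (used N (v.1 + 2)).card ≤ 2 * (N0.card + I.card) := by
            have : (used N (v.1 + 1)).card + (used N (v.1 + 2)).card ≤ 2 * (N0.card + I.card) := by omega
            exact_mod_cast this
          have hs0 : (0 : ℝ) ≤ s := by positivity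
          linarith
        have h4 : (((used N (v.1 + 1)).card : ℝ) + (used N (v.1 + 2)).card) * n < zz H Z v.1 v.2 := by
          nlinarith
        unfold zz at h4
        exact_mod_cast h4)
    rw [Finset.mem_filter, Finset.mem_product] at hq
    refine ⟨tri v.1 v.2 q.1 q.2, ?_, ?_⟩
    · rw [hF, Finset.mem_filter, tri_0, tri_1, tri_2]
      exact ⟨hq.2, rfl, hq.1.1, hq.1.2⟩
    · apply disj_of_notMem_used
      refine forall_fin3 v.1 ?_ ?_ ?_
      · rw [tri_0]
        intro hu
        obtain ⟨e, he, hev⟩ := Finset.mem_image.1 hu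
        rcases hNF e he with h | ⟨w, hw, hwv, hew⟩
        · exact hv1 (hev ▸ hN0Z e h v.1)
        · have h5 := hFw w hw e hew v.1 (by rw [hev]; exact hv1)
          have h6 := (Finset.mem_filter.1 hew).2.1
          apply hwv
          refine Prod.ext h5.symm ?_
          rw [← h6, ← hev, h5]
      · rw [tri_1]; exact hqA
      · rw [tri_2]; exact hqB) le_rfl
  -- stage 2 : WWZ edges
  set G := H.filter (fun e => e 0 ∉ Z 0 ∧ e 1 ∉ Z 1 ∧ e 2 ∈ Z 2) with hG
  have hM01 : IsM (N0 ∪ N1) := hM0.union hM1 hd1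
  have hc01 : (N0 ∪ N1).card = N0.card + I.card := by rw [card_union_of_disj hd1, hc1]
  obtain ⟨N2, hM2, hd2, hc2, hF2, -⟩ := greedy (fun _ : Fin s => G) (N0 ∪ N1) hM01
    ((N0 ∪ N1).card + s) Finset.univ (by
    intro i _ N hMN hNc _
    rw [hc01] at hNc
    have hNc' : (N.card : ℝ) ≤ 9 / 100000 * n := by
      have : (N.card : ℝ) ≤ N0.card + I.card + s := by exact_mod_cast hNc.le
      linarith
    -- a vertex z
    obtain ⟨z, hz, hzu⟩ := Finset.exists_mem_notMem_of_card_lt_card (s := used N 2) (t := Z 2) (by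
      have h1 := card_used_le N 2
      have h2 := hC.size1 2
      have h3 : (N.card : ℝ) < (Z 2).card := by linarith
      have h4 : N.card < (Z 2).card := by exact_mod_cast h3
      omega)
    obtain ⟨q, hq, hqA, hqB⟩ := avoid_pair (((Z 0)ᶜ ×ˢ (Z 1)ᶜ).filter
      (fun q => tri 2 z q.1 q.2 ∈ H)) (used N 0) (used N 1) (by
        have h1 := card_used_le N 0
        have h2 := card_used_le N 1
        have h1' : ((used N 0).card : ℝ) ≤ N.card := by exact_mod_cast h1
        have h2' : ((used N 1).card : ℝ) ≤ N.card := by exact_mod_cast h2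
        have hw := wm_bound hn hC hdeg 2 z hz
        have h3 := Finset.card_filter_add_card_filter_not (s := (Z 0)ᶜ ×ˢ (Z 1)ᶜ) (fun q => tri 2 z q.1 q.2 ∈ H)
        have h4 : (((Z 0)ᶜ ×ˢ (Z 1)ᶜ).filter (fun q => ¬ (tri 2 z q.1 q.2 ∈ H))).card ≤ wm H Z 2 z := by
          unfold wm
          apply Finset.card_le_card
          intro q hq
          rw [Finset.mem_filter, Finset.mem_product, Finset.mem_compl, Finset.mem_compl] at hq
          rw [Finset.mem_filter]
          exact ⟨Finset.mem_univ _, Or.inl hq.1.1, hq.2⟩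
        rw [Finset.card_product] at h3
        have cz : ∀ c, ((Z c)ᶜ.card : ℝ) = n - (Z c).card := by
          intro c
          have := Finset.card_compl_add_card (Z c)
          rw [Fintype.card_fin] at this
          have : ((Z c)ᶜ.card : ℝ) + (Z c).card = n := by exact_mod_cast this
          linarith
        have b0 := hC.size2 0; have b1 := hC.size2 1
        have c0 : (0.3 : ℝ) * n ≤ (Z 0)ᶜ.card := by rw [cz]; linarith
        have c1 : (0.3 : ℝ) * n ≤ (Z 1)ᶜ.card := by rw [cz]; linarith
        have c2 : ((0.3 : ℝ) * n) * (0.3 * n) ≤ (Z 0)ᶜ.card * (Z 1)ᶜ.card :=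
          mul_le_mul c0 c1 (by positivity) (by positivity)
        have h3' : (((Z 0)ᶜ.card : ℕ) : ℝ) * (((Z 1)ᶜ.card : ℕ) : ℝ) ≤
          ((((Z 0)ᶜ ×ˢ (Z 1)ᶜ).filter (fun q => tri 2 z q.1 q.2 ∈ H)).card : ℝ) + wm H Z 2 z := by
          have : (Z 0)ᶜ.card * (Z 1)ᶜ.card ≤ (((Z 0)ᶜ ×ˢ (Z 1)ᶜ).filter (fun q => tri 2 z q.1 q.2 ∈ H)).card + wm H Z 2 z := by
            omega
          exact_mod_cast this
        have h6 : (((used N 0).card : ℝ) + (used N 1).card) * n ≤ (2 * (9 / 100000 * n)) * n := by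
          apply mul_le_mul_of_nonneg_right _ (by positivity)
          linarith
        have h7 : (((used N 0).card : ℝ) + (used N 1).card) * n <
          ((((Z 0)ᶜ ×ˢ (Z 1)ᶜ).filter (fun q => tri 2 z q.1 q.2 ∈ H)).card : ℝ) := by
          nlinarith
        exact_mod_cast h7)
    rw [Finset.mem_filter, Finset.mem_product, Finset.mem_compl, Finset.mem_compl] at hq
    have t0 : tri 2 z q.1 q.2 0 = q.1 := tri_1 2 _ _ _
    have t1 : tri 2 z q.1 q.2 1 = q.2 := tri_2 2 _ _ _
    have t2 : tri 2 z q.1 q.2 2 = z := tri_0 2 _ _ _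
    refine ⟨tri 2 z q.1 q.2, ?_, ?_⟩
    · show _ ∈ G
      rw [hG, Finset.mem_filter, t0, t1, t2]
      exact ⟨hq.2, hq.1.1, hq.1.2, hz⟩
    · apply disj_of_notMem_used
      intro k
      fin_cases k
      · show tri 2 z q.1 q.2 0 ∉ _; rw [t0]; exact hqA
      · show tri 2 z q.1 q.2 1 ∉ _; rw [t1]; exact hqB
      · show tri 2 z q.1 q.2 2 ∉ _; rw [t2]; exact hzu) (by simp)
  simp only [Finset.card_univ, Fintype.card_fin] at hc2
  have hcN : ((N0 ∪ N1) ∪ N2).card = N0.card + I.card + s := by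
    rw [card_union_of_disj hd2, hc01, hc2]
  apply finish hn H Z hC hdeg ((N0 ∪ N1) ∪ N2)
  · refine Finset.union_subset (Finset.union_subset hN0H ?_) ?_
    · intro e he
      obtain ⟨j, -, h⟩ := hF1 e he
      exact (Finset.mem_filter.1 h).1
    · intro e he
      obtain ⟨j, -, h⟩ := hF2 e he
      exact (Finset.mem_filter.1 h).1
  · exact hM01.union hM2 hd2
  · rw [hcN]; push_cast; linarith
  · have D1 : Disjoint N0 N1 := by
      rw [Finset.disjoint_left]; intro e he he'; exact hd1 e he e he' 0 rfl
    have D2 : Disjoint (N0 ∪ N1) N2 := by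
      rw [Finset.disjoint_left]; intro e he he'; exact hd2 e he e he' 0 rfl
    rw [hcN, wsum_eq, Finset.sum_union D2, Finset.sum_union D1]
    have s0 : ∑ e ∈ N0, ∑ c : Fin 3, (if e c ∉ Z c then 1 else 0) = 0 := by
      apply Finset.sum_eq_zero
      intro e he
      apply Finset.sum_eq_zero
      intro c _
      rw [if_neg (not_not.2 (hN0Z e he c))]
    have s1 : ∑ e ∈ N1, ∑ c : Fin 3, (if e c ∉ Z c then 1 else 0) = I.card := by
      rw [← hc1, Finset.card_eq_sum_ones]
      apply Finset.sum_congr rfl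
      intro e he
      obtain ⟨v, hv, hev⟩ := hF1 e he
      have hv1 := (Finset.mem_filter.1 hv).2.1
      rw [Finset.sum_eq_single v.1]
      · rw [(Finset.mem_filter.1 hev).2.1, if_pos hv1]
      · intro i _ hi
        rw [if_neg]
        intro h
        exact hi (hFw v hv e hev i h)
      · intro h; exact absurd (Finset.mem_univ _) h
    have s2 : ∑ e ∈ N2, ∑ c : Fin 3, (if e c ∉ Z c then 1 else 0) = s * 2 := by
      rw [← hc2]
      apply Finset.sum_const_nat
      intro e he
      obtain ⟨v, hv, hev⟩ := hF2 e he
      obtain ⟨-, g0, g1, g2⟩ := Finset.mem_filter.1 hev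
      rw [Fin.sum_univ_three, if_pos g0, if_pos g1, if_neg (not_not.2 g2)]
    rw [s0, s1, s2, Fin.sum_univ_three]
    have q0 := Finset.card_compl_add_card (Z 0)
    have q1 := Finset.card_compl_add_card (Z 1)
    have q2 := Finset.card_compl_add_card (Z 2)
    rw [Fintype.card_fin] at q0 q1 q2
    omega
  · intro c x hx hb
    have hxI : (c, x) ∈ I := Finset.mem_filter.2 ⟨Finset.mem_univ _, hx, hb⟩
    obtain ⟨e, he, heF⟩ := hF1' _ hxI
    have h1 := (Finset.mem_filter.1 heF).2.1
    simp only at h1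
    rw [← h1]
    exact mem_used (Finset.mem_union_left _ (Finset.mem_union_right _ he)) c

end PM


namespace PM

lemma prod_change {n : ℕ} (A B A' B' : Finset (Fin n)) (P : Fin n × Fin n → Prop) [DecidablePred P] :
    ((A ×ˢ B).filter P).card ≤ ((A' ×ˢ B').filter P).card + ((A \ A').card + (B \ B').card) * n := by
  have hsub : (A ×ˢ B).filter P ⊆ (A' ×ˢ B').filter P ∪
      (((A \ A') ×ˢ Finset.univ) ∪ (Finset.univ ×ˢ (B \ B'))) := by
    intro q hq
    simp only [Finset.mem_filter, Finset.mem_product, Finset.mem_union, Finset.mem_sdiff,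
      Finset.mem_univ, true_and, and_true] at hq ⊢
    tauto
  refine (Finset.card_le_card hsub).trans ((Finset.card_union_le _ _).trans ?_)
  refine Nat.add_le_add_left ((Finset.card_union_le _ _).trans ?_) _
  rw [Finset.card_product, Finset.card_product]
  simp only [Finset.card_univ, Fintype.card_fin]
  linarith

open Classical in
lemma sum_zz {n : ℕ} (H : Finset (Fin 3 → Fin n)) (Z : Fin 3 → Finset (Fin n)) (c : Fin 3) :
    ∑ x ∈ Z c, zz H Z c x = (H.filter (fun e => ∀ i, e i ∈ Z i)).card := by
  have h0 : Set.MapsTo (fun e : Fin 3 → Fin n => e c) (H.filter (fun e => ∀ i, e i ∈ Z i)) (Z c) := by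
    intro e he
    have he' : e ∈ H.filter (fun e => ∀ i, e i ∈ Z i) := he
    exact (Finset.mem_filter.1 he').2 c
  rw [Finset.card_eq_sum_card_fiberwise h0]
  apply Finset.sum_congr rfl
  intro x hx
  rw [← deg_zzz H Z c x hx]
  rfl

open Classical in
lemma sum_zm {n : ℕ} (H : Finset (Fin 3 → Fin n)) (Z : Fin 3 → Finset (Fin n)) (c : Fin 3) :
    ∑ x ∈ (Z c)ᶜ, zm H Z c x ≤ ∑ y ∈ Z (c + 1), wm H Z (c + 1) y := by
  unfold zm
  simp_rw [Finset.card_filter, Finset.sum_product]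
  rw [Finset.sum_comm]
  apply Finset.sum_le_sum
  intro y hy
  have h1 : ∑ x ∈ (Z c)ᶜ, ∑ z ∈ Z (c + 2), (if tri c x y z ∉ H then 1 else 0) =
      (((Z c)ᶜ ×ˢ Z (c + 2)).filter (fun q => tri c q.1 y q.2 ∉ H)).card := by
    rw [Finset.card_filter, Finset.sum_product]
  refine h1.le.trans ?_
  unfold wm
  apply Finset.card_le_card_of_injOn (fun q => (q.2, q.1))
  · intro q hq
    have hq := Finset.mem_filter.1 hq
    rw [Finset.mem_product, Finset.mem_compl] at hq
    refine Finset.mem_coe.2 (Finset.mem_filter.2 ⟨Finset.mem_univ _, ?_, ?_⟩)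
    · right
      have k2 : c + 1 + 2 = c := by fin_cases c <;> rfl
      rw [k2]; exact hq.1.1
    · simp only
      rw [tri_rot1]; exact hq.2
  · rintro ⟨a, b⟩ _ ⟨a', b'⟩ _ h
    simp only [Prod.mk.injEq] at h
    rw [h.1, h.2]

lemma markov {n : ℕ} (S : Finset (Fin n)) (f : Fin n → ℕ) (a b : ℝ) (ha : 0 < a)
    (hsum : ((∑ x ∈ S, f x : ℕ) : ℝ) ≤ b) (T : Finset (Fin n)) (hT : T ⊆ S)
    (h : ∀ x ∈ T, a ≤ f x) : (T.card : ℝ) ≤ b / a := by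
  rw [le_div_iff₀ ha]
  refine le_trans ?_ hsum
  rw [← nsmul_eq_mul]
  push_cast
  refine le_trans (Finset.card_nsmul_le_sum T (fun x => (f x : ℝ)) a h) ?_
  exact Finset.sum_le_sum_of_subset_of_nonneg hT (fun _ _ _ => by positivity)

open Classical in
lemma clean_exists {n : ℕ} (hn : 10 ^ 10 ≤ n) (H : Finset (Fin 3 → Fin n)) (Z : Fin 3 → Finset (Fin n))
    (hs1 : ∀ c, (2 / 3 - 1 / 10 ^ 9 : ℝ) * n ≤ (Z c).card)
    (hs2 : ∀ c, ((Z c).card : ℝ) ≤ (2 / 3 + 1 / 10 ^ 9) * n)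
    (hz : ((H.filter (fun e => ∀ i, e i ∈ Z i)).card : ℝ) ≤ 1 / 10 ^ 9 * n ^ 3)
    (hdeg : ∀ c x, (5 / 9 : ℝ) * n ^ 2 - n ≤ deg3 H c x) :
    ∃ Z', Clean H Z' := by
  have hn' : (10 ^ 10 : ℝ) ≤ n := by exact_mod_cast hn
  have hn0 : (0 : ℝ) < n := by linarith
  have hn2 : (0 : ℝ) < (n : ℝ) ^ 2 := by positivity
  have hprod : ∀ c, (4 / 9 - 2 / 10 ^ 9 : ℝ) * n ^ 2 ≤ (Z (c + 1)).card * (Z (c + 2)).card := by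
    intro c
    have h1 := hs1 (c + 1)
    have h2 := hs1 (c + 2)
    have h7 : ((2 / 3 - 1 / 10 ^ 9 : ℝ) * n) * ((2 / 3 - 1 / 10 ^ 9 : ℝ) * n) ≤
      (Z (c + 1)).card * (Z (c + 2)).card := mul_le_mul h1 h2 (by positivity) (by positivity)
    nlinarith
  have hzm : ∀ c, ((∑ x ∈ (Z c)ᶜ, zm H Z c x : ℕ) : ℝ) ≤ 4 / 10 ^ 9 * n ^ 3 := by
    intro c
    have h1 := sum_zm H Z c
    have h2 : ((∑ x ∈ (Z c)ᶜ, zm H Z c x : ℕ) : ℝ) ≤ ((∑ y ∈ Z (c + 1), wm H Z (c + 1) y : ℕ) : ℝ) := by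
      exact_mod_cast h1
    refine h2.trans ?_
    push_cast
    have h3 : ∀ y ∈ Z (c + 1), (wm H Z (c + 1) y : ℝ) ≤ zz H Z (c + 1) y + 3 / 10 ^ 9 * n ^ 2 := by
      intro y _
      have h4 := wm_le H Z (c + 1) y
      have h5 : (wm H Z (c + 1) y : ℝ) + deg3 H (c + 1) y + (Z (c + 1 + 1)).card * (Z (c + 1 + 2)).card
          ≤ zz H Z (c + 1) y + n ^ 2 := by exact_mod_cast h4
      have h6 := hprod (c + 1)
      have h7 := hdeg (c + 1) y
      nlinarith
    refine (Finset.sum_le_sum h3).trans ?_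
    rw [Finset.sum_add_distrib, Finset.sum_const, nsmul_eq_mul]
    have h8 : ∑ y ∈ Z (c + 1), (zz H Z (c + 1) y : ℝ) ≤ 1 / 10 ^ 9 * n ^ 3 := by
      refine le_trans (le_of_eq ?_) hz
      rw [← sum_zz H Z (c + 1)]
      push_cast; rfl
    have h9 : ((Z (c + 1)).card : ℝ) ≤ n := by
      have := Finset.card_le_univ (Z (c + 1))
      rw [Fintype.card_fin] at this
      exact_mod_cast this
    have h10 : ((Z (c + 1)).card : ℝ) * (3 / 10 ^ 9 * n ^ 2) ≤ n * (3 / 10 ^ 9 * n ^ 2) := by gcongr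
    nlinarith
  set Z' : Fin 3 → Finset (Fin n) := fun c => Finset.univ.filter
    (fun x => (zz H Z c x : ℝ) < 3 / 2000 * n ^ 2) with hZ'
  have memZ' : ∀ c x, x ∈ Z' c ↔ (zz H Z c x : ℝ) < 3 / 2000 * n ^ 2 := by
    intro c x; simp [hZ']
  have d1 : ∀ c, ((Z c \ Z' c).card : ℝ) ≤ 1 / 10 ^ 6 * n := by
    intro c
    have h1 := markov (Z c) (zz H Z c) (3 / 2000 * n ^ 2) (1 / 10 ^ 9 * n ^ 3) (by positivity)
      (by rw [sum_zz]; exact hz) (Z c \ Z' c) Finset.sdiff_subset (by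
        intro x hx
        have := (Finset.mem_sdiff.1 hx).2
        rw [memZ'] at this
        exact not_lt.1 this)
    refine h1.trans ?_
    rw [div_le_iff₀ (by positivity)]
    nlinarith
  have d2 : ∀ c, ((Z' c \ Z c).card : ℝ) ≤ 1 / 10 ^ 6 * n := by
    intro c
    have h1 := markov ((Z c)ᶜ) (zm H Z c) (1 / 10 * n ^ 2) (4 / 10 ^ 9 * n ^ 3) (by positivity)
      (hzm c) (Z' c \ Z c) (by
        intro x hx; exact Finset.mem_compl.2 (Finset.mem_sdiff.1 hx).2) (by
        intro x hx
        have := (Finset.mem_sdiff.1 hx).1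
        rw [memZ'] at this
        have h2 := zz_add_zm H Z c x
        have h3 : (zz H Z c x : ℝ) + zm H Z c x = (Z (c + 1)).card * (Z (c + 2)).card := by exact_mod_cast h2
        have h4 := hprod c
        nlinarith)
    refine h1.trans ?_
    rw [div_le_iff₀ (by positivity)]
    nlinarith
  have chg1 : ∀ c x, (zz H Z' c x : ℝ) ≤ zz H Z c x + 2 / 10 ^ 6 * n ^ 2 := by
    intro c x
    have h1 := prod_change (Z' (c + 1)) (Z' (c + 2)) (Z (c + 1)) (Z (c + 2)) (fun q => tri c x q.1 q.2 ∈ H)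
    have h2 : (zz H Z' c x : ℝ) ≤ zz H Z c x + ((Z' (c + 1) \ Z (c + 1)).card + (Z' (c + 2) \ Z (c + 2)).card) * n := by
      unfold zz; exact_mod_cast h1
    have a1 := d2 (c + 1); have a2 := d2 (c + 2)
    nlinarith
  have chg2 : ∀ c x, (zz H Z c x : ℝ) ≤ zz H Z' c x + 2 / 10 ^ 6 * n ^ 2 := by
    intro c x
    have h1 := prod_change (Z (c + 1)) (Z (c + 2)) (Z' (c + 1)) (Z' (c + 2)) (fun q => tri c x q.1 q.2 ∈ H)
    have h2 : (zz H Z c x : ℝ) ≤ zz H Z' c x + ((Z (c + 1) \ Z' (c + 1)).card + (Z (c + 2) \ Z' (c + 2)).card) * n := by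
      unfold zz; exact_mod_cast h1
    have a1 := d1 (c + 1); have a2 := d1 (c + 2)
    nlinarith
  have chg3 : ∀ c x, (zm H Z' c x : ℝ) ≤ zm H Z c x + 2 / 10 ^ 6 * n ^ 2 := by
    intro c x
    have h1 := prod_change (Z' (c + 1)) (Z' (c + 2)) (Z (c + 1)) (Z (c + 2)) (fun q => tri c x q.1 q.2 ∉ H)
    have h2 : (zm H Z' c x : ℝ) ≤ zm H Z c x + ((Z' (c + 1) \ Z (c + 1)).card + (Z' (c + 2) \ Z (c + 2)).card) * n := by
      unfold zm; exact_mod_cast h1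
    have a1 := d2 (c + 1); have a2 := d2 (c + 2)
    nlinarith
  have cards : ∀ c, ((Z' c).card : ℝ) ≤ (Z c).card + (Z' c \ Z c).card ∧
      ((Z c).card : ℝ) ≤ (Z' c).card + (Z c \ Z' c).card := by
    intro c
    have h1 := Finset.card_le_card_sdiff_add_card (s := Z' c) (t := Z c)
    have h2 := Finset.card_le_card_sdiff_add_card (s := Z c) (t := Z' c)
    constructor
    · rw [add_comm]; exact_mod_cast h1
    · rw [add_comm]; exact_mod_cast h2
  refine ⟨Z', ?_, ?_, ?_, ?_, ?_⟩
  · intro c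
    have h1 := (cards c).2
    have h2 := d1 c
    have h3 := hs1 c
    linarith
  · intro c
    have h1 := (cards c).1
    have h2 := d2 c
    have h3 := hs2 c
    linarith
  · intro c x hx
    rw [memZ'] at hx
    have := chg1 c x
    linarith
  · intro c x hx
    rw [memZ'] at hx
    have := chg2 c x
    linarith
  · intro c
    have hsub : (Finset.univ.filter (fun x => x ∉ Z' c ∧ (1 / 200 : ℝ) * n ^ 2 < zm H Z' c x)) ⊆
        (Z c \ Z' c) ∪ ((Z c)ᶜ).filter (fun x => (1 / 400 : ℝ) * n ^ 2 ≤ zm H Z c x) := by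
      intro x hx
      obtain ⟨h1, h2⟩ := (Finset.mem_filter.1 hx).2
      rw [Finset.mem_union]
      by_cases hxZ : x ∈ Z c
      · left; exact Finset.mem_sdiff.2 ⟨hxZ, h1⟩
      · right
        refine Finset.mem_filter.2 ⟨Finset.mem_compl.2 hxZ, ?_⟩
        have := chg3 c x
        linarith
    have h1 := (Finset.card_le_card hsub).trans (Finset.card_union_le _ _)
    have h2 : ((Finset.univ.filter (fun x => x ∉ Z' c ∧ (1 / 200 : ℝ) * n ^ 2 < zm H Z' c x)).card : ℝ) ≤
      (Z c \ Z' c).card + (((Z c)ᶜ).filter (fun x => (1 / 400 : ℝ) * n ^ 2 ≤ zm H Z c x)).card := by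
      exact_mod_cast h1
    have h3 := markov ((Z c)ᶜ) (zm H Z c) (1 / 400 * n ^ 2) (4 / 10 ^ 9 * n ^ 3) (by positivity)
      (hzm c) (((Z c)ᶜ).filter (fun x => (1 / 400 : ℝ) * n ^ 2 ≤ zm H Z c x)) (Finset.filter_subset _ _)
      (fun x hx => (Finset.mem_filter.1 hx).2)
    have h4 : (4 / 10 ^ 9 * (n : ℝ) ^ 3) / (1 / 400 * n ^ 2) ≤ 2 / 10 ^ 6 * n := by
      rw [div_le_iff₀ (by positivity)]
      nlinarith [pow_pos hn0 3]
    have h5 := d1 c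
    linarith

/-- Extremal case. -/
theorem extremal_pm {n : ℕ} (hn : 10 ^ 10 ≤ n) (H : Finset (Fin 3 → Fin n)) (Z : Fin 3 → Finset (Fin n))
    (hs1 : ∀ c, (2 / 3 - 1 / 10 ^ 9 : ℝ) * n ≤ (Z c).card)
    (hs2 : ∀ c, ((Z c).card : ℝ) ≤ (2 / 3 + 1 / 10 ^ 9) * n)
    (hz : ((H.filter (fun e => ∀ i, e i ∈ Z i)).card : ℝ) ≤ 1 / 10 ^ 9 * n ^ 3)
    (hthr : ∀ (c : Fin 3) (x : Fin n), threshold9 n < 9 * deg3 H c x) :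
    ∃ M ⊆ H, IsM M ∧ M.card = n := by
  classical
  obtain ⟨Z', hZ'⟩ := clean_exists hn H Z hs1 hs2 (by convert hz) (deg_lower (by omega) H hthr)
  exact clean_pm (by omega) H Z' hZ' hthr

end PM

namespace PM

/-- The join of `G` with a clique on `d` new vertices. -/
def joinK {V : Type} (G : SimpleGraph V) (d : ℕ) : SimpleGraph (V ⊕ Fin d) where
  Adj a b := a ≠ b ∧ ∀ u v, a = Sum.inl u → b = Sum.inl v → G.Adj u v
  symm := ⟨fun _ _ h => ⟨h.1.symm, fun u v hu hv => (h.2 v u hv hu).symm⟩⟩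
  loopless := ⟨fun _ h => h.1 rfl⟩

open Classical in
lemma pm_case {V : Type} [Fintype V] (G : SimpleGraph V) (d : ℕ)
    (M : (joinK G d).Subgraph) (hM : M.IsPerfectMatching) :
    ∃ (S : Finset V) (σ : V → V), (∀ v ∈ S, G.Adj v (σ v)) ∧ Set.InjOn σ S ∧
      (∀ v ∈ S, σ v ∉ S) ∧ Fintype.card V ≤ 2 * S.card + d := by
  rw [SimpleGraph.Subgraph.isPerfectMatching_iff] at hM
  choose p hp hu using hM
  have hpp : ∀ a, p (p a) = a := fun a => (hu (p a) a (hp a).symm).symm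
  let σ : V → V := fun v => Sum.elim id (fun _ => v) (p (Sum.inl v))
  let P : Finset V := Finset.univ.filter (fun v => p (Sum.inl v) = Sum.inl (σ v))
  have hPc : Pᶜ.card ≤ d := by
    have hex : ∀ v ∈ Pᶜ, ∃ i : Fin d, p (Sum.inl v) = Sum.inr i := by
      intro v hv
      rw [Finset.mem_compl] at hv
      rcases h : p (Sum.inl v) with w | i
      · exfalso; apply hv; simp [P, σ, h]
      · exact ⟨i, rfl⟩
    have := Finset.card_le_card_of_injOn (s := Pᶜ)
      (t := (Finset.univ : Finset (Fin d)).image (Sum.inr : Fin d → V ⊕ Fin d))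
      (fun v => p (Sum.inl v))
      (fun v hv => by
        obtain ⟨i, hi⟩ := hex v (Finset.mem_coe.1 hv)
        exact Finset.mem_coe.2 (Finset.mem_image.2 ⟨i, Finset.mem_univ _, hi.symm⟩)) (by
        intro a ha b hb hab
        have h3 := congrArg p hab
        simp only [hpp] at h3
        exact Sum.inl.inj h3)
    have h2 := Finset.card_image_le (s := (Finset.univ : Finset (Fin d)))
      (f := (Sum.inr : Fin d → V ⊕ Fin d))
    rw [Finset.card_univ, Fintype.card_fin] at h2
    omega
  have hσP : ∀ v ∈ P, σ v ∈ P ∧ σ (σ v) = v ∧ G.Adj v (σ v) := by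
    intro v hv
    have h1 := (Finset.mem_filter.1 hv).2
    have h2 : p (Sum.inl (σ v)) = Sum.inl v := by rw [← h1, hpp]
    have h3 : σ (σ v) = v := by
      show Sum.elim id _ (p (Sum.inl (σ v))) = v
      rw [h2]; rfl
    refine ⟨Finset.mem_filter.2 ⟨Finset.mem_univ _, by rw [h2, h3]⟩, h3, ?_⟩
    have := (hp (Sum.inl v)).adj_sub
    rw [h1] at this
    exact this.2 _ _ rfl rfl
  let e := Fintype.equivFin V
  let S := P.filter (fun v => e v < e (σ v))
  have hS : ∀ v ∈ S, v ∈ P ∧ e v < e (σ v) := fun v hv => Finset.mem_filter.1 hv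
  refine ⟨S, σ, fun v hv => (hσP v (hS v hv).1).2.2, ?_, ?_, ?_⟩
  · intro a ha b hb hab
    have h1 := (hσP a (hS a ha).1).2.1
    have h2 := (hσP b (hS b hb).1).2.1
    rw [← h1, ← h2, hab]
  · intro v hv hv'
    have h1 := (hσP v (hS v hv).1).2.1
    have h2 := (hS _ hv').2
    rw [h1] at h2
    exact lt_asymm h2 (hS v hv).2
  · have hsub : P ⊆ S ∪ S.image σ := by
      intro v hv
      obtain ⟨h1, h2, h3⟩ := hσP v hv
      rcases lt_trichotomy (e v) (e (σ v)) with h | h | h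
      · exact Finset.mem_union_left _ (Finset.mem_filter.2 ⟨hv, h⟩)
      · exact absurd (e.injective h) h3.ne
      · refine Finset.mem_union_right _ (Finset.mem_image.2 ⟨σ v, Finset.mem_filter.2 ⟨h1, ?_⟩, h2⟩)
        rw [h2]; exact h
    have h4 := Finset.card_le_card hsub
    have h5 := Finset.card_union_le S (S.image σ)
    have h6 := Finset.card_image_le (s := S) (f := σ)
    have h7 := Finset.card_add_card_compl P
    omega

open Classical in
theorem tutte_berge {V : Type} [Fintype V] (G : SimpleGraph V) (d : ℕ)
    (hpar : Even (Fintype.card V + d))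
    (hno : ∀ (S : Finset V) (σ : V → V), (∀ v ∈ S, G.Adj v (σ v)) → Set.InjOn σ S →
      (∀ v ∈ S, σ v ∉ S) → 2 * S.card + d < Fintype.card V) :
    ∃ (U : Finset V) (ι : Type) (comp : V → ι),
      (∀ u v, u ∉ U → v ∉ U → G.Adj u v → comp u = comp v) ∧
      d + U.card < (Uᶜ.image comp).card := by
  by_cases hM : ∃ M : (joinK G d).Subgraph, M.IsPerfectMatching
  · obtain ⟨M, hM⟩ := hM
    obtain ⟨S, σ, h1, h2, h3, h4⟩ := pm_case G d M hM
    exact absurd (hno S σ h1 h2 h3) (by omega)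
  rw [SimpleGraph.tutte] at hM
  push Not at hM
  obtain ⟨U', hU'⟩ := hM
  unfold SimpleGraph.IsTutteViolator at hU'
  set D := ((⊤ : (joinK G d).Subgraph).deleteVerts U') with hD
  have hmem : ∀ a, a ∈ D.verts ↔ a ∉ U' := by
    intro a; simp [hD]
  have hadj : ∀ (a b : V ⊕ Fin d) (ha : a ∈ D.verts) (hb : b ∈ D.verts), (joinK G d).Adj a b →
      D.coe.connectedComponentMk ⟨a, ha⟩ = D.coe.connectedComponentMk ⟨b, hb⟩ := by
    intro a b ha hb hab
    apply SimpleGraph.ConnectedComponent.connectedComponentMk_eq_of_adj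
    show D.Adj a b
    rw [hD, SimpleGraph.Subgraph.deleteVerts_adj]
    exact ⟨trivial, (hmem a).1 ha, trivial, (hmem b).1 hb, hab⟩
  by_cases hd : ∀ i : Fin d, Sum.inr i ∈ U'
  · let comp : V → Option D.coe.ConnectedComponent := fun v =>
      if h : Sum.inl v ∈ D.verts then some (D.coe.connectedComponentMk ⟨Sum.inl v, h⟩) else none
    let U : Finset V := Finset.univ.filter (fun v => Sum.inl v ∈ U')
    have hU : ∀ v, v ∉ U ↔ Sum.inl v ∈ D.verts := by
      intro v; rw [hmem]; simp [U]
    refine ⟨U, _, comp, ?_, ?_⟩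
    · intro u v hu hv huv
      have hu' := (hU u).1 hu
      have hv' := (hU v).1 hv
      simp only [comp, hu', hv', dite_true]
      rw [hadj _ _ hu' hv']
      refine ⟨fun h => huv.ne (Sum.inl.inj h), ?_⟩
      intro a b ha hb
      rw [← Sum.inl.inj ha, ← Sum.inl.inj hb]; exact huv
    · have h1 : d + U.card ≤ U'.ncard := by
        have : ((U.disjSum (Finset.univ : Finset (Fin d))) : Set (V ⊕ Fin d)) ⊆ U' := by
          intro a ha
          rcases a with v | i
          · have := Finset.inl_mem_disjSum.1 (Finset.mem_coe.1 ha)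
            exact (Finset.mem_filter.1 this).2
          · exact hd i
        have h2 := Set.ncard_le_ncard this (Set.toFinite _)
        rw [Set.ncard_coe_finset, Finset.card_disjSum, Finset.card_univ, Fintype.card_fin] at h2
        omega
      have h2 : D.coe.oddComponents.ncard ≤ (Uᶜ.image comp).card := by
        have h3 : (some '' D.coe.oddComponents) ⊆ ((Uᶜ.image comp : Finset _) : Set _) := by
          rintro _ ⟨C, -, rfl⟩
          induction C using SimpleGraph.ConnectedComponent.ind with
          | _ a =>
          obtain ⟨a, ha⟩ := a
          rcases a with v | i
          · refine Finset.mem_coe.2 (Finset.mem_image.2 ⟨v, ?_, ?_⟩)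
            · rw [Finset.mem_compl]; exact (hU v).2 ha
            · simp only [comp, ha, dite_true]
          · exact absurd (hd i) ((hmem _).1 ha)
        have h4 := Set.ncard_le_ncard h3 (Set.toFinite _)
        rw [Set.ncard_image_of_injective _ (Option.some_injective _), Set.ncard_coe_finset] at h4
        exact h4
      refine lt_of_le_of_lt h1 (lt_of_lt_of_le hU' (le_trans h2 (le_of_eq ?_)))
      congr!
  · exfalso
    push Not at hd
    obtain ⟨i, hi⟩ := hd
    have hiv := (hmem _).2 hi
    have hall : ∀ C : D.coe.ConnectedComponent, C = D.coe.connectedComponentMk ⟨Sum.inr i, hiv⟩ := by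
      intro C
      induction C using SimpleGraph.ConnectedComponent.ind with
      | _ a =>
      obtain ⟨a, ha⟩ := a
      by_cases hai : a = Sum.inr i
      · subst hai; rfl
      · exact hadj _ _ _ _ ⟨hai, fun u v _ h => by cases h⟩
    have h1 : D.coe.oddComponents.ncard ≤ 1 := by
      have h2 : D.coe.oddComponents ⊆ {D.coe.connectedComponentMk ⟨Sum.inr i, hiv⟩} :=
        fun C _ => hall C
      have := Set.ncard_le_ncard h2 (Set.toFinite _)
      rwa [Set.ncard_singleton] at this
    have h0 : U'.ncard = 0 := by omega
    have h1' : D.coe.oddComponents.ncard = 1 := by omega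
    have hUe : U' = ∅ := (Set.ncard_eq_zero (Set.toFinite _)).1 h0
    have hodd := (D.coe.odd_ncard_oddComponents).1 (by rw [h1']; exact odd_one)
    have hDu : D.verts = Set.univ := by
      ext a; simp [hmem, hUe]
    rw [hDu, Nat.card_congr (Equiv.Set.univ _), Nat.card_eq_fintype_card, Fintype.card_sum,
      Fintype.card_fin] at hodd
    exact (Nat.not_even_iff_odd.2 hodd) hpar

end PM

namespace PM

lemma ineq_sorted (ε s1 s2 s3 t1 t2 t3 : ℝ) (hε : 0 < ε) (hε1 : ε ≤ 1 / 10000)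
    (ht1 : 0 ≤ t1) (ht2 : 0 ≤ t2) (ht3 : 0 ≤ t3)
    (hs1 : t1 ≤ 1 - s1) (hs2 : t2 ≤ 1 - s2) (hs3 : t3 ≤ 1 - s3)
    (h12 : s2 ≤ s1) (h23 : s3 ≤ s2) (hsum : 2 - ε ≤ s1 + s2 + s3)
    (f12 : s1 * s2 + s1 * t2 + s2 * t1 - 3 * t1 * t2 ≤ 4 / 9 + ε)
    (f13 : s1 * s3 + s1 * t3 + s3 * t1 - 3 * t1 * t3 ≤ 4 / 9 + ε) :
    (s1 ≤ 2 / 3 + 10 * ε ∧ s2 ≤ 2 / 3 + 10 * ε ∧ s3 ≤ 2 / 3 + 10 * ε) ∧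
    (t1 ≤ 50 * ε ∧ t2 ≤ 50 * ε ∧ t3 ≤ 50 * ε) ∧
    (2 / 3 - 21 * ε ≤ s1 ∧ 2 / 3 - 21 * ε ≤ s2 ∧ 2 / 3 - 21 * ε ≤ s3) := by
  have hs2l : (2 - ε - s1) / 2 ≤ s2 := by linarith
  have hs1u : s1 ≤ 1 := by linarith
  have hs1l : 2 / 3 - ε / 3 ≤ s1 := by linarith
  have hs2p : 0 ≤ s2 := by linarith
  have hp : s1 * ((2 - ε - s1) / 2) ≤ s1 * s2 :=
    mul_le_mul_of_nonneg_left hs2l (by linarith)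
  have hse : s1 * ε ≤ 1 * ε := mul_le_mul_of_nonneg_right hs1u hε.le
  have hse0 : 0 ≤ s1 * ε := mul_nonneg (by linarith) hε.le
  have hs1q : s1 < 3 / 4 := by
    by_contra hcon
    push Not at hcon
    have h1 : t1 * t2 ≤ (1 - s1) * t2 := mul_le_mul_of_nonneg_right hs1 ht2
    have h2 : 0 ≤ (4 * s1 - 3) * t2 := mul_nonneg (by linarith) ht2
    have h3 : 0 ≤ s2 * t1 := mul_nonneg hs2p ht1
    linarith [mul_nonneg (sub_nonneg.2 hcon) (sub_nonneg.2 hs1u)]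
  have hs2m : 0.62 ≤ s2 := by linarith
  have h1 : t1 * t2 ≤ t1 * (1 - s2) := mul_le_mul_of_nonneg_left hs2 ht1
  have h2 : t1 * t2 ≤ (1 - s1) * t2 := mul_le_mul_of_nonneg_right hs1 ht2
  have h3 : 0.62 * t1 ≤ s2 * t1 := mul_le_mul_of_nonneg_right hs2m ht1
  have h4 : 0.62 * t2 ≤ s1 * t2 := mul_le_mul_of_nonneg_right (by linarith) ht2
  have h5 : s1 * s2 + 0.05 * (t1 + t2) ≤ 4 / 9 + ε := by linarith
  have h6 : (s1 - 2 / 3) * (4 / 3 - s1) / 2 + 0.05 * (t1 + t2) ≤ 1.5 * ε := by linarith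
  have hu : s1 ≤ 2 / 3 + 6 * ε := by
    by_contra hcon
    push Not at hcon
    have : 0 ≤ (s1 - 2 / 3) * (3 / 4 - s1) := mul_nonneg (by linarith) (by linarith)
    linarith
  have h7 : -(ε / 3) ≤ (s1 - 2 / 3) * (4 / 3 - s1) / 2 := by
    have : 0 ≤ (s1 - 2 / 3 + ε / 3) * (4 / 3 - s1) := mul_nonneg (by linarith) (by linarith)
    linarith
  have h8 : t1 ≤ 40 * ε := by linarith
  have h9 : t2 ≤ 40 * ε := by linarith
  have hs2' : 2 / 3 - 4 * ε ≤ s2 := by linarith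
  have hs3' : 2 / 3 - 13 * ε ≤ s3 := by linarith
  have h10 : t1 * t3 ≤ 40 * ε * t3 := mul_le_mul_of_nonneg_right h8 ht3
  have h11 : 40 * ε * t3 ≤ 0.01 * t3 := mul_le_mul_of_nonneg_right (by linarith) ht3
  have h12 : 0.6 * t3 ≤ s1 * t3 := mul_le_mul_of_nonneg_right (by linarith) ht3
  have h13 : (2 / 3 - ε / 3) * (2 / 3 - 13 * ε) ≤ s1 * s3 :=
    mul_le_mul hs1l hs3' (by linarith) (by linarith)
  have h14 : 0 ≤ s3 * t1 := mul_nonneg (by linarith) ht1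
  have h15 : t3 ≤ 40 * ε := by linarith [mul_nonneg hε.le hε.le]
  refine ⟨⟨?_, ?_, ?_⟩, ⟨?_, ?_, ?_⟩, ?_, ?_, ?_⟩ <;> linarith

lemma ineq_main (ε : ℝ) (s t : Fin 3 → ℝ) (hε : 0 < ε) (hε1 : ε ≤ 1 / 10000)
    (ht : ∀ i, 0 ≤ t i) (hs : ∀ i, t i ≤ 1 - s i)
    (hsum : 2 - ε ≤ s 0 + s 1 + s 2)
    (f : ∀ i j, i ≠ j → s i * s j + s i * t j + s j * t i - 3 * t i * t j ≤ 4 / 9 + ε) :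
    ∀ i, s i ≤ 2 / 3 + 10 * ε ∧ t i ≤ 50 * ε ∧ 2 / 3 - 21 * ε ≤ s i := by
  have key : ∀ a b c : Fin 3, a ≠ b → a ≠ c → b ≠ c → s b ≤ s a → s c ≤ s b →
      ∀ i, s i ≤ 2 / 3 + 10 * ε ∧ t i ≤ 50 * ε ∧ 2 / 3 - 21 * ε ≤ s i := by
    intro a b c hab hac hbc h1 h2
    have hsum' : 2 - ε ≤ s a + s b + s c := by
      fin_cases a <;> fin_cases b <;> fin_cases c <;> simp_all <;> linarith
    obtain ⟨⟨p1, p2, p3⟩, ⟨q1, q2, q3⟩, r1, r2, r3⟩ :=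
      ineq_sorted ε (s a) (s b) (s c) (t a) (t b) (t c) hε hε1 (ht _) (ht _) (ht _)
        (hs _) (hs _) (hs _) h1 h2 hsum' (f a b hab) (f a c hac)
    intro i
    have : i = a ∨ i = b ∨ i = c := by
      clear * - hab hac hbc
      revert a b c i; decide
    rcases this with rfl | rfl | rfl
    · exact ⟨p1, q1, r1⟩
    · exact ⟨p2, q2, r2⟩
    · exact ⟨p3, q3, r3⟩
  rcases le_total (s 0) (s 1) with h01 | h01 <;> rcases le_total (s 1) (s 2) with h12 | h12 <;>
    rcases le_total (s 0) (s 2) with h02 | h02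
  · exact key 2 1 0 (by decide) (by decide) (by decide) h12 h01
  · exact key 2 1 0 (by decide) (by decide) (by decide) h12 h01
  · exact key 1 2 0 (by decide) (by decide) (by decide) h12 h02
  · exact key 1 0 2 (by decide) (by decide) (by decide) h01 h02
  · exact key 2 0 1 (by decide) (by decide) (by decide) h02 h01
  · exact key 0 2 1 (by decide) (by decide) (by decide) h02 h12
  · exact key 0 1 2 (by decide) (by decide) (by decide) h01 h12
  · exact key 0 1 2 (by decide) (by decide) (by decide) h01 h12

end PM

namespace PM

open Classical in
lemma comp_count {V ι : Type} [Fintype V] (W : Finset V) (comp : V → ι) (b : ℕ) :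
    (W.image comp).card * b ≤
      (W.filter (fun v => (W.filter (fun w => comp w = comp v)).card < b)).card * b +
      (W.filter (fun v => ¬ (W.filter (fun w => comp w = comp v)).card < b)).card := by
  set Z := W.filter (fun v => (W.filter (fun w => comp w = comp v)).card < b) with hZ
  set F := W.filter (fun v => ¬ (W.filter (fun w => comp w = comp v)).card < b) with hF
  have h1 : W.image comp = Z.image comp ∪ F.image comp := by
    rw [← Finset.image_union, hZ, hF, Finset.filter_union_filter_not_eq]
  have h2 : (F.image comp).card * b ≤ F.card := by
    rw [Finset.card_eq_sum_card_image comp F]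
    have := Finset.card_nsmul_le_sum (F.image comp)
      (fun i => (F.filter (fun v => comp v = i)).card) b (by
        intro i hi
        obtain ⟨v, hv, rfl⟩ := Finset.mem_image.1 hi
        have hv2 := (Finset.mem_filter.1 hv).2
        push Not at hv2
        refine hv2.trans (Finset.card_le_card ?_)
        intro w hw
        obtain ⟨hw1, hw2⟩ := Finset.mem_filter.1 hw
        refine Finset.mem_filter.2 ⟨Finset.mem_filter.2 ⟨hw1, ?_⟩, hw2⟩
        rw [hw2]; exact (Finset.mem_filter.1 hv).2)
    simpa [smul_eq_mul] using this
  have h3 : (Z.image comp).card * b ≤ Z.card * b := Nat.mul_le_mul_right _ Finset.card_image_le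
  have h4 := Finset.card_union_le (Z.image comp) (F.image comp)
  rw [h1]
  calc _ ≤ ((Z.image comp).card + (F.image comp).card) * b := Nat.mul_le_mul_right _ h4
    _ ≤ _ := by rw [add_mul]; exact add_le_add h3 h2

/-- Section of a set of pairs. -/
def sec {k : ℕ} (X : Finset (Fin 3 × Fin k)) (c : Fin 3) : Finset (Fin k) :=
  Finset.univ.filter (fun x => (c, x) ∈ X)

lemma mem_sec {k : ℕ} {X : Finset (Fin 3 × Fin k)} {c : Fin 3} {x : Fin k} :
    x ∈ sec X c ↔ (c, x) ∈ X := by simp [sec]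

lemma card_sec {k : ℕ} (X : Finset (Fin 3 × Fin k)) :
    X.card = (sec X 0).card + (sec X 1).card + (sec X 2).card := by
  classical
  rw [Finset.card_eq_sum_card_fiberwise (f := Prod.fst) (t := (Finset.univ : Finset (Fin 3)))
    (fun _ _ => Finset.mem_coe.2 (Finset.mem_univ _)), Fin.sum_univ_three]
  have : ∀ c : Fin 3, (X.filter (fun p => p.1 = c)).card = (sec X c).card := by
    intro c
    symm
    refine Finset.card_bij (fun x _ => (c, x)) ?_ ?_ ?_
    · intro x hx; exact Finset.mem_filter.2 ⟨mem_sec.1 hx, rfl⟩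
    · intro x _ y _ h; exact (Prod.mk.inj h).2
    · rintro ⟨c', x⟩ h
      obtain ⟨h1, h2⟩ := Finset.mem_filter.1 h
      simp only at h2
      subst h2
      exact ⟨x, mem_sec.2 h1, rfl⟩
  rw [this, this, this]

open Classical in
lemma secpairs_le {k b : ℕ} (P : Finset (Fin k × Fin k))
    (h : ∀ x, (Finset.univ.filter (fun y => (x, y) ∈ P)).card ≤ b) : P.card ≤ k * b := by
  rw [Finset.card_eq_sum_card_fiberwise (f := Prod.fst) (t := (Finset.univ : Finset (Fin k)))
    (fun _ _ => Finset.mem_coe.2 (Finset.mem_univ _))]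
  refine (Finset.sum_le_card_nsmul _ _ b ?_).trans (by simp)
  intro x _
  refine le_trans (Finset.card_le_card_of_injOn Prod.snd ?_ ?_) (h x)
  · rintro ⟨x', y⟩ hp
    obtain ⟨h1, h2⟩ := Finset.mem_filter.1 (Finset.mem_coe.1 hp)
    simp only at h2; subst h2
    exact Finset.mem_coe.2 (Finset.mem_filter.2 ⟨Finset.mem_univ _, h1⟩)
  · rintro ⟨x1, y1⟩ h1 ⟨x2, y2⟩ h2 h3
    have e1 := (Finset.mem_filter.1 (Finset.mem_coe.1 h1)).2
    have e2 := (Finset.mem_filter.1 (Finset.mem_coe.1 h2)).2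
    simp only at e1 e2 h3
    rw [e1, e2, h3]

open Classical in
lemma secpairs_le' {k b : ℕ} (P : Finset (Fin k × Fin k))
    (h : ∀ y, (Finset.univ.filter (fun x => (x, y) ∈ P)).card ≤ b) : P.card ≤ k * b := by
  have h1 : (P.image Prod.swap).card = P.card :=
    Finset.card_image_of_injective _ Prod.swap_injective
  rw [← h1]
  refine secpairs_le _ (fun y => le_trans (le_of_eq ?_) (h y))
  congr 1
  ext x
  simp only [Finset.mem_filter, Finset.mem_univ, true_and, Finset.mem_image]
  constructor
  · rintro ⟨⟨a, b⟩, h1, h2⟩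
    simp only [Prod.swap_prod_mk, Prod.mk.injEq] at h2
    obtain ⟨rfl, rfl⟩ := h2; exact h1
  · intro h1; exact ⟨(x, y), h1, rfl⟩

open Classical in
/-- Combinatorial part of the structure lemma. -/
lemma structure_comb (k b : ℕ) (hk : 2 ≤ k) (R : Fin 3 → Fin k → Fin k → Prop)
    (hno : ∀ (I : Finset (Fin 3 × Fin k)) (a a' : Fin 3 × Fin k → Fin 3 × Fin k),
      (∀ i ∈ I, (a' i).1 = (a i).1 + 1 ∧ R (a i).1 (a i).2 (a' i).2) → Set.InjOn a I →
      Set.InjOn a' I → (∀ i ∈ I, ∀ j ∈ I, a i ≠ a' j) → I.card ≤ k) :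
    ∃ (W Z F : Fin 3 → Finset (Fin k)),
      (∀ c, (W c).card = (Z c).card + (F c).card) ∧
      (4 * k * b ≤ b + 2 * b * ((Z 0).card + (Z 1).card + (Z 2).card) +
        (b + 1) * ((F 0).card + (F 1).card + (F 2).card)) ∧
      ∀ c, (Finset.univ.filter (fun p : Fin k × Fin k => p.1 ∈ W c ∧ p.2 ∈ W (c + 1) ∧
        R c p.1 p.2)).card ≤ 2 * (k * b) + (F c).card * (F (c + 1)).card := by
  let G : SimpleGraph (Fin 3 × Fin k) :=
    { Adj := fun u v => (v.1 = u.1 + 1 ∧ R u.1 u.2 v.2) ∨ (u.1 = v.1 + 1 ∧ R v.1 v.2 u.2)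
      symm := ⟨fun _ _ h => h.symm⟩
      loopless := ⟨fun u h => by
        have : u.1 ≠ u.1 + 1 := by generalize u.1 = c; revert c; decide
        rcases h with h | h <;> exact this h.1⟩ }
  obtain ⟨U, ι, comp, hcomp, hcard⟩ := tutte_berge G (k - 2)
    (by
      rw [Fintype.card_prod, Fintype.card_fin, Fintype.card_fin]
      exact ⟨2 * k - 1, by omega⟩)
    (by
      intro S σ hadj hinj hdis
      rw [Fintype.card_prod, Fintype.card_fin, Fintype.card_fin]
      have : S.card ≤ k := by
        let Q : Fin 3 × Fin k → Prop := fun v => (σ v).1 = v.1 + 1 ∧ R v.1 v.2 (σ v).2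
        let a : Fin 3 × Fin k → Fin 3 × Fin k := fun v => if Q v then v else σ v
        let a' : Fin 3 × Fin k → Fin 3 × Fin k := fun v => if Q v then σ v else v
        refine hno S a a' ?_ ?_ ?_ ?_
        · intro v hv
          by_cases hq : Q v
          · simp only [a, a', if_pos hq]; exact hq
          · simp only [a, a', if_neg hq]
            exact (hadj v hv).resolve_left hq
        · intro v hv w hw h
          simp only [a] at h
          split_ifs at h
          · exact h
          · exact absurd (h ▸ hv) (hdis w hw)
          · exact absurd (h ▸ hw) (hdis v hv)
          · exact hinj hv hw h
        · intro v hv w hw h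
          simp only [a'] at h
          split_ifs at h
          · exact hinj hv hw h
          · exact absurd (h ▸ hw) (hdis v hv)
          · exact absurd (h ▸ hv) (hdis w hw)
          · exact h
        · intro v hv w hw h
          simp only [a, a'] at h
          split_ifs at h
          · exact absurd (h ▸ hv) (hdis w hw)
          · rename_i h1 h2; exact h2 (h ▸ h1)
          · have := hinj hv hw h
            rename_i h1 h2; exact h1 (this ▸ h2)
          · exact absurd (h ▸ hw) (hdis v hv)
      omega)
  set W := Uᶜ with hW
  set Z := W.filter (fun v => (W.filter (fun w => comp w = comp v)).card < b) with hZ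
  set F := W.filter (fun v => ¬ (W.filter (fun w => comp w = comp v)).card < b) with hF
  have hWZF : ∀ c, (sec W c).card = (sec Z c).card + (sec F c).card := by
    intro c
    rw [← Finset.card_union_of_disjoint]
    · congr 1
      ext x
      simp only [Finset.mem_union, mem_sec, hZ, hF, Finset.mem_filter]
      tauto
    · rw [Finset.disjoint_left]
      intro x h1 h2
      rw [mem_sec] at h1 h2
      exact (Finset.mem_filter.1 h2).2 (Finset.mem_filter.1 h1).2
  have hmW : ∀ v, v ∈ W → v ∉ U := fun v hv => Finset.mem_compl.1 hv
  refine ⟨sec W, sec Z, sec F, hWZF, ?_, ?_⟩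
  · have h1 := comp_count W comp b
    have h2 := card_sec Z
    have h3 := card_sec F
    have h4 := card_sec W
    have h5 : U.card + W.card = 3 * k := by
      have h5 := Finset.card_add_card_compl U
      rw [Fintype.card_prod, Fintype.card_fin, Fintype.card_fin] at h5
      rw [← h5, hW]
    have hcard' : k - 2 + U.card < (W.image comp).card := by
      refine lt_of_lt_of_le hcard (le_of_eq ?_)
      rw [hW]; congr!
    rw [hWZF, hWZF, hWZF] at h4
    rw [← hZ, ← hF] at h1
    rw [← h2, ← h3]
    have h6 : W.card = Z.card + F.card := by omega
    have h7 : 4 * k ≤ (W.image comp).card + 1 + Z.card + F.card := by omega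
    have h8 := Nat.mul_le_mul_right b h7
    nlinarith
  · intro c
    set P := Finset.univ.filter (fun p : Fin k × Fin k => p.1 ∈ sec W c ∧ p.2 ∈ sec W (c + 1) ∧
        R c p.1 p.2) with hP
    have hPm : ∀ p ∈ P, (c, p.1) ∈ W ∧ (c + 1, p.2) ∈ W ∧ comp (c, p.1) = comp (c + 1, p.2) := by
      intro p hp
      obtain ⟨-, h1, h2, h3⟩ := Finset.mem_filter.1 hp
      rw [mem_sec] at h1 h2
      exact ⟨h1, h2, hcomp _ _ (hmW _ h1) (hmW _ h2) (Or.inl ⟨rfl, h3⟩)⟩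
    have hsub : P ⊆ (P.filter (fun p => p.1 ∈ sec Z c) ∪ P.filter (fun p => p.2 ∈ sec Z (c + 1))) ∪
        (sec F c) ×ˢ (sec F (c + 1)) := by
      intro p hp
      obtain ⟨h1, h2, h3⟩ := hPm p hp
      by_cases hz1 : p.1 ∈ sec Z c
      · exact Finset.mem_union_left _ (Finset.mem_union_left _ (Finset.mem_filter.2 ⟨hp, hz1⟩))
      by_cases hz2 : p.2 ∈ sec Z (c + 1)
      · exact Finset.mem_union_left _ (Finset.mem_union_right _ (Finset.mem_filter.2 ⟨hp, hz2⟩))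
      refine Finset.mem_union_right _ (Finset.mem_product.2 ⟨?_, ?_⟩)
      · rw [mem_sec, hF]
        refine Finset.mem_filter.2 ⟨h1, fun h => hz1 ?_⟩
        rw [mem_sec]; exact Finset.mem_filter.2 ⟨h1, h⟩
      · rw [mem_sec, hF]
        refine Finset.mem_filter.2 ⟨h2, fun h => hz2 ?_⟩
        rw [mem_sec]; exact Finset.mem_filter.2 ⟨h2, h⟩
    have e1 : (P.filter (fun p => p.1 ∈ sec Z c)).card ≤ k * b := by
      apply secpairs_le
      intro x
      by_cases hx : x ∈ sec Z c
      · have hlt := (Finset.mem_filter.1 (mem_sec.1 hx)).2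
        refine le_trans (Finset.card_le_card_of_injOn (fun y => (c + 1, y)) ?_ ?_) hlt.le
        · intro y hy
          have hy2 := (Finset.mem_filter.1 (Finset.mem_coe.1 hy)).2
          obtain ⟨-, h2, h3⟩ := hPm _ (Finset.mem_filter.1 hy2).1
          exact Finset.mem_coe.2 (Finset.mem_filter.2 ⟨h2, h3.symm⟩)
        · intro y _ y' _ h; exact (Prod.mk.inj h).2
      · rw [Finset.filter_false_of_mem]
        · simp
        · intro y _ h; exact hx (Finset.mem_filter.1 h).2
    have e2 : (P.filter (fun p => p.2 ∈ sec Z (c + 1))).card ≤ k * b := by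
      apply secpairs_le'
      intro x
      by_cases hx : x ∈ sec Z (c + 1)
      · have hlt := (Finset.mem_filter.1 (mem_sec.1 hx)).2
        refine le_trans (Finset.card_le_card_of_injOn (fun y => (c, y)) ?_ ?_) hlt.le
        · intro y hy
          have hy2 := (Finset.mem_filter.1 (Finset.mem_coe.1 hy)).2
          obtain ⟨h2, -, h3⟩ := hPm _ (Finset.mem_filter.1 hy2).1
          exact Finset.mem_coe.2 (Finset.mem_filter.2 ⟨h2, h3⟩)
        · intro y _ y' _ h; exact (Prod.mk.inj h).2
      · rw [Finset.filter_false_of_mem]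
        · simp
        · intro y _ h; exact hx (Finset.mem_filter.1 h).2
    have h1 := Finset.card_le_card hsub
    have h2 := Finset.card_union_le (P.filter (fun p => p.1 ∈ sec Z c) ∪
      P.filter (fun p => p.2 ∈ sec Z (c + 1))) ((sec F c) ×ˢ (sec F (c + 1)))
    have h3 := Finset.card_union_le (P.filter (fun p => p.1 ∈ sec Z c))
      (P.filter (fun p => p.2 ∈ sec Z (c + 1)))
    rw [Finset.card_product] at h2
    omega

end PM

namespace PM

open Classical in
theorem structure_lemma (k : ℕ) (ε : ℝ) (hε : 0 < ε) (hε1 : ε ≤ 1 / 10000) (hk : 100 / ε ^ 2 ≤ k)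
    (R : Fin 3 → Fin k → Fin k → Prop)
    (hden : ∀ c, (5 / 9 - ε / 2) * (k : ℝ) ^ 2 ≤
      (((Finset.univ.filter (fun p : Fin k × Fin k => R c p.1 p.2)).card : ℕ) : ℝ))
    (hno : ∀ (I : Finset (Fin 3 × Fin k)) (a a' : Fin 3 × Fin k → Fin 3 × Fin k),
      (∀ i ∈ I, (a' i).1 = (a i).1 + 1 ∧ R (a i).1 (a i).2 (a' i).2) → Set.InjOn a I →
      Set.InjOn a' I → (∀ i ∈ I, ∀ j ∈ I, a i ≠ a' j) → I.card ≤ k) :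
    ∃ W : Fin 3 → Finset (Fin k),
      (∀ c, (2 / 3 - 100 * ε) * k ≤ (((W c).card : ℕ) : ℝ) ∧
        (((W c).card : ℕ) : ℝ) ≤ (2 / 3 + 200 * ε) * k) ∧
      (∀ c, (((Finset.univ.filter (fun p : Fin k × Fin k => p.1 ∈ W c ∧ p.2 ∈ W (c + 1) ∧
        R c p.1 p.2)).card : ℕ) : ℝ) ≤ 2 * ε * (k : ℝ) ^ 2) ∧
      (∀ c, (((Finset.univ.filter (fun p : Fin k × Fin k => p.1 ∉ W c ∧ p.2 ∈ W (c + 1) ∧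
        ¬ R c p.1 p.2)).card : ℕ) : ℝ) ≤ 100 * ε * (k : ℝ) ^ 2) := by
  have hk1 : 100 ≤ k * ε ^ 2 := by
    rwa [div_le_iff₀ (by positivity)] at hk
  have hkpos : (0 : ℝ) < k := by
    by_contra h; push Not at h
    nlinarith [sq_nonneg ε]
  have hkε : 10 ^ 6 ≤ k * ε := by nlinarith [mul_pos hkpos hε]
  have hk2 : 2 ≤ k := by
    have : (2 : ℝ) ≤ k := by nlinarith
    exact_mod_cast this
  set b : ℕ := ⌈4 / ε⌉₊ with hb
  have hb1 : 4 ≤ (b : ℝ) * ε := by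
    have := Nat.le_ceil (4 / ε)
    rwa [div_le_iff₀ hε] at this
  have hb2 : (b : ℝ) * ε ≤ 5 := by
    have := (Nat.ceil_lt_add_one (a := 4 / ε) (by positivity)).le
    rw [← hb] at this
    have h2 := mul_le_mul_of_nonneg_right this hε.le
    rw [add_mul, div_mul_cancel₀ _ hε.ne'] at h2
    linarith
  have hkb : (k : ℝ) * b ≤ ε * (k : ℝ) ^ 2 / 20 := by
    have h1 : (b : ℝ) * (20 * ε) ≤ ((k : ℝ) * ε) * ε := by nlinarith
    have h2 : 20 * (b : ℝ) ≤ k * ε := by nlinarith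
    nlinarith
  have hbk : (b : ℝ) ≤ k := by nlinarith
  obtain ⟨W, Z, F, h1, h2, h3⟩ := structure_comb k b hk2 R hno
  have hWk : ∀ c, (((W c).card : ℕ) : ℝ) ≤ k := fun c => by
    have := Finset.card_le_univ (W c)
    rw [Fintype.card_fin] at this
    exact_mod_cast this
  have h1r : ∀ c, (((W c).card : ℕ) : ℝ) = (((Z c).card : ℕ) : ℝ) + (((F c).card : ℕ) : ℝ) :=
    fun c => by exact_mod_cast h1 c
  have h2r : 4 * (k : ℝ) * b ≤ b + 2 * b * ((Z 0).card + (Z 1).card + (Z 2).card) +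
        (b + 1) * ((F 0).card + (F 1).card + (F 2).card) := by exact_mod_cast h2
  have hT : ∀ c, (((Finset.univ.filter (fun p : Fin k × Fin k => ¬ R c p.1 p.2)).card : ℕ) : ℝ) ≤
      (4 / 9 + ε / 2) * (k : ℝ) ^ 2 := by
    intro c
    have := Finset.card_filter_add_card_filter_not (s := (Finset.univ : Finset (Fin k × Fin k)))
      (fun p => R c p.1 p.2)
    rw [Finset.card_univ, Fintype.card_prod, Fintype.card_fin] at this
    have h : (((Finset.univ.filter (fun p : Fin k × Fin k => R c p.1 p.2)).card : ℕ) : ℝ) +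
      (((Finset.univ.filter (fun p : Fin k × Fin k => ¬ R c p.1 p.2)).card : ℕ) : ℝ) = k * k := by
      exact_mod_cast this
    have := hden c
    nlinarith
  -- edges inside W
  have hE : ∀ c, (((Finset.univ.filter (fun p : Fin k × Fin k => p.1 ∈ W c ∧ p.2 ∈ W (c + 1) ∧
        R c p.1 p.2)).card : ℕ) : ℝ) ≤ ε * (k : ℝ) ^ 2 / 10 +
        (((F c).card : ℕ) : ℝ) * (((F (c + 1)).card : ℕ) : ℝ) := by
    intro c
    have : (((Finset.univ.filter (fun p : Fin k × Fin k => p.1 ∈ W c ∧ p.2 ∈ W (c + 1) ∧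
        R c p.1 p.2)).card : ℕ) : ℝ) ≤ 2 * (k * b) + (F c).card * (F (c + 1)).card := by
      exact_mod_cast h3 c
    linarith
  have hN : ∀ c, (((W c).card : ℕ) : ℝ) * (((W (c + 1)).card : ℕ) : ℝ) +
      (((Finset.univ.filter (fun p : Fin k × Fin k => p.1 ∉ W c ∧ p.2 ∈ W (c + 1) ∧
        ¬ R c p.1 p.2)).card : ℕ) : ℝ) ≤ (4 / 9 + ε / 2) * (k : ℝ) ^ 2 +
      (((Finset.univ.filter (fun p : Fin k × Fin k => p.1 ∈ W c ∧ p.2 ∈ W (c + 1) ∧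
        R c p.1 p.2)).card : ℕ) : ℝ) := by
    intro c
    refine le_trans ?_ (add_le_add_left (hT c) _)
    rw [← Nat.cast_mul, ← Finset.card_product, ← Nat.cast_add, ← Nat.cast_add]
    refine Nat.cast_le.2 ?_
    rw [← Finset.card_union_of_disjoint, ← Finset.card_union_of_disjoint]
    · apply Finset.card_le_card
      intro p hp
      simp only [Finset.mem_union, Finset.mem_product, Finset.mem_filter, Finset.mem_univ,
        true_and] at hp ⊢
      tauto
    · rw [Finset.disjoint_left]
      intro p hp hp2
      exact (Finset.mem_filter.1 hp).2 (Finset.mem_filter.1 hp2).2.2.2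
    · rw [Finset.disjoint_left]
      intro p hp hp2
      exact (Finset.mem_filter.1 hp2).2.1 (Finset.mem_product.1 hp).1
  let s : Fin 3 → ℝ := fun c => ((((Z c).card : ℕ) : ℝ) + (((F c).card : ℕ) : ℝ) / 2) / k
  let t : Fin 3 → ℝ := fun c => ((((F c).card : ℕ) : ℝ) / 2) / k
  have hsw : ∀ c, (s c + t c) * k = (((W c).card : ℕ) : ℝ) := by
    intro c; rw [h1r]; simp only [s, t]; field_simp; ring
  have htf : ∀ c, 2 * t c * k = (((F c).card : ℕ) : ℝ) := by
    intro c; simp only [t]; field_simp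
  have hk2p : (0 : ℝ) < (k : ℝ) ^ 2 := by positivity
  have hf1 : ∀ c, s c * s (c + 1) + s c * t (c + 1) + s (c + 1) * t c - 3 * t c * t (c + 1) ≤
      4 / 9 + ε := by
    intro c
    have a1 := hN c
    have a2 := hE c
    have a3 : (0 : ℝ) ≤ (((Finset.univ.filter (fun p : Fin k × Fin k => p.1 ∉ W c ∧
      p.2 ∈ W (c + 1) ∧ ¬ R c p.1 p.2)).card : ℕ) : ℝ) := Nat.cast_nonneg _
    rw [← htf, ← htf] at a2
    rw [← hsw c, ← hsw (c + 1)] at a1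
    have a4 : (s c * s (c + 1) + s c * t (c + 1) + s (c + 1) * t c - 3 * t c * t (c + 1)) *
      (k : ℝ) ^ 2 ≤ (4 / 9 + ε) * (k : ℝ) ^ 2 := by
      have : 0 ≤ ε * (k : ℝ) ^ 2 := by positivity
      linarith
    exact le_of_mul_le_mul_right a4 hk2p
  have hmain := ineq_main ε s t hε hε1
    (fun c => by simp only [t]; positivity)
    (fun c => by
      have := hWk c
      rw [← hsw] at this
      have h4 : (s c + t c) * k ≤ 1 * k := by linarith
      have := le_of_mul_le_mul_right h4 hkpos
      linarith)
    (by
      have hF3 : (((F 0).card : ℕ) : ℝ) + (F 1).card + (F 2).card ≤ 3 * k := by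
        have a0 := hWk 0
        have a1 := hWk 1
        have a2 := hWk 2
        rw [h1r] at a0 a1 a2
        have b0 : (0 : ℝ) ≤ (((Z 0).card : ℕ) : ℝ) := Nat.cast_nonneg _
        have b1 : (0 : ℝ) ≤ (((Z 1).card : ℕ) : ℝ) := Nat.cast_nonneg _
        have b2 : (0 : ℝ) ≤ (((Z 2).card : ℕ) : ℝ) := Nat.cast_nonneg _
        linarith
      have hb0 : (0 : ℝ) < b := by
        by_contra h; push Not at h; nlinarith
      have h5 : s 0 + s 1 + s 2 = (((Z 0).card : ℝ) + (Z 1).card + (Z 2).card +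
        ((F 0).card + (F 1).card + (F 2).card) / 2) / k := by
        simp only [s]; field_simp; ring
      rw [h5, le_div_iff₀ hkpos]
      have h6 : 4 * (k : ℝ) ≤ b * ε * k := mul_le_mul_of_nonneg_right hb1 hkpos.le
      have h7 : (2 * b) * ((2 - ε) * k) ≤ (2 * b) * (((Z 0).card : ℝ) + (Z 1).card + (Z 2).card +
        ((F 0).card + (F 1).card + (F 2).card) / 2) := by linarith
      exact le_of_mul_le_mul_left h7 (by positivity))
    (by
      intro i j hij
      have : j = i + 1 ∨ i = j + 1 := by
        clear * - hij
        revert i j; decide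
      rcases this with rfl | rfl
      · exact hf1 i
      · have := hf1 j
        linarith)
  have hWb : ∀ c, (2 / 3 - 21 * ε) * k ≤ (((W c).card : ℕ) : ℝ) ∧
        (((W c).card : ℕ) : ℝ) ≤ (2 / 3 + 60 * ε) * k := by
    intro c
    obtain ⟨m1, m2, m3⟩ := hmain c
    have m0 : 0 ≤ t c := by simp only [t]; positivity
    rw [← hsw c]
    exact ⟨mul_le_mul_of_nonneg_right (by linarith) hkpos.le,
      mul_le_mul_of_nonneg_right (by linarith) hkpos.le⟩
  have hEb : ∀ c, (((Finset.univ.filter (fun p : Fin k × Fin k => p.1 ∈ W c ∧ p.2 ∈ W (c + 1) ∧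
        R c p.1 p.2)).card : ℕ) : ℝ) ≤ 2 * ε * (k : ℝ) ^ 2 := by
    intro c
    have a2 := hE c
    rw [← htf, ← htf] at a2
    obtain ⟨-, m1, -⟩ := hmain c
    obtain ⟨-, m2, -⟩ := hmain (c + 1)
    have m0 : 0 ≤ t (c + 1) := by simp only [t]; positivity
    have : t c * t (c + 1) ≤ 50 * ε * (50 * ε) := mul_le_mul m1 m2 m0 (by positivity)
    have h7 : 50 * ε * (50 * ε) ≤ 0.25 * ε := by nlinarith
    have h8 : (t c * t (c + 1)) * (k : ℝ) ^ 2 ≤ (0.25 * ε) * (k : ℝ) ^ 2 :=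
      mul_le_mul_of_nonneg_right (by linarith) hk2p.le
    have h9 : 0 ≤ ε * (k : ℝ) ^ 2 := by positivity
    linarith
  refine ⟨W, ?_, hEb, ?_⟩
  · intro c
    obtain ⟨a, b⟩ := hWb c
    have : 0 ≤ ε * k := by positivity
    constructor <;> linarith
  · intro c
    have a1 := hN c
    have a2 := hEb c
    have a3 : (2 / 3 - 21 * ε) * k * ((2 / 3 - 21 * ε) * k) ≤
        (((W c).card : ℕ) : ℝ) * (((W (c + 1)).card : ℕ) : ℝ) :=
      mul_le_mul (hWb c).1 (hWb (c + 1)).1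
        (mul_nonneg (by linarith) hkpos.le) (Nat.cast_nonneg _)
    have h9 : 0 ≤ ε * (k : ℝ) ^ 2 := by positivity
    have h10 : 0 ≤ ε ^ 2 * (k : ℝ) ^ 2 := by positivity
    linarith

end PM

namespace PM

/-- A family of `m` disjoint triples `e` together with leftover sets `L`, such that no local
improvement is possible. -/
structure Setup {n m : ℕ} (H : Finset (Fin 3 → Fin n)) (e : Fin m → Fin 3 → Fin n)
    (L : Fin 3 → Finset (Fin n)) : Prop where
  inj : ∀ c E F, e E c = e F c → E = F
  hL : ∀ c E, e E c ∉ L c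
  ni : ∀ (S : Finset (Fin m)) (P : Finset (Fin 3 → Fin n)), P ⊆ H → IsM P →
    (∀ p ∈ P, ∀ c, p c ∈ L c ∨ ∃ E ∈ S, p c = e E c) → P.card ≤ S.card

variable {n m : ℕ} {H : Finset (Fin 3 → Fin n)} {e : Fin m → Fin 3 → Fin n}
  {L : Fin 3 → Finset (Fin n)}

/-- Edges through two given vertices and a leftover vertex. -/
def Fp (H : Finset (Fin 3 → Fin n)) (e : Fin m → Fin 3 → Fin n)
    (L : Fin 3 → Finset (Fin n)) (c : Fin 3) (E F : Fin m) : Finset (Fin 3 → Fin n) :=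
  H.filter (fun g => g c = e E c ∧ g (c + 1) = e F (c + 1) ∧ g (c + 2) ∈ L (c + 2))

/-- The number of leftover vertices completing a pair. -/
def cnt (H : Finset (Fin 3 → Fin n)) (e : Fin m → Fin 3 → Fin n)
    (L : Fin 3 → Finset (Fin n)) (c : Fin 3) (E F : Fin m) : ℕ :=
  ((L (c + 2)).filter (fun x => tri (c + 2) x (e E c) (e F (c + 1)) ∈ H)).card

/-- Good pairs. -/
def Gd (H : Finset (Fin 3 → Fin n)) (e : Fin m → Fin 3 → Fin n)
    (L : Fin 3 → Finset (Fin n)) (θ : ℝ) (c : Fin 3) (E F : Fin m) : Prop :=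
  θ ≤ (cnt H e L c E F : ℝ)

lemma c3 (c : Fin 3) : c + 2 + 1 = c := by revert c; decide
lemma c4 (c : Fin 3) : c + 2 + 2 = c + 1 := by revert c; decide

lemma Fp_hit (hs : Setup H e L) {c : Fin 3} {E F : Fin m} {g : Fin 3 → Fin n}
    (hg : g ∈ Fp H e L c E F) {c' : Fin 3} {E' : Fin m} (h : g c' = e E' c') :
    (c' = c ∧ E' = E) ∨ (c' = c + 1 ∧ E' = F) := by
  obtain ⟨-, h1, h2, h3⟩ := Finset.mem_filter.1 hg
  have key : ∀ c c' : Fin 3, c' = c ∨ c' = c + 1 ∨ c' = c + 2 := by decide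
  rcases key c c' with rfl | rfl | rfl
  · left; exact ⟨rfl, hs.inj c' _ _ (h.symm.trans h1)⟩
  · right; exact ⟨rfl, hs.inj (c + 1) _ _ (h.symm.trans h2)⟩
  · rw [h] at h3; exact absurd h3 (hs.hL _ _)

lemma pair_pick {θ : ℝ} {c : Fin 3} {E F : Fin m} (hG : Gd H e L θ c E F)
    (N : Finset (Fin 3 → Fin n)) (hN : (N.card : ℝ) < θ)
    (h1 : e E c ∉ used N c) (h2 : e F (c + 1) ∉ used N (c + 1)) :
    ∃ g ∈ Fp H e L c E F, ∀ f ∈ N, ∀ k, g k ≠ f k := by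
  have hlt : (used N (c + 2)).card <
      ((L (c + 2)).filter (fun x => tri (c + 2) x (e E c) (e F (c + 1)) ∈ H)).card := by
    have a1 : ((used N (c + 2)).card : ℝ) ≤ N.card := Nat.cast_le.2 (card_used_le _ _)
    have : ((used N (c + 2)).card : ℝ) < (cnt H e L c E F : ℝ) := by
      unfold Gd at hG; linarith
    exact_mod_cast this
  obtain ⟨x, hx, hx'⟩ := Finset.exists_mem_notMem_of_card_lt_card hlt
  obtain ⟨hx1, hx2⟩ := Finset.mem_filter.1 hx
  have t0 := tri_0 (c + 2) x (e E c) (e F (c + 1))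
  have t1 := tri_1 (c + 2) x (e E c) (e F (c + 1))
  have t2 := tri_2 (c + 2) x (e E c) (e F (c + 1))
  rw [c3] at t1
  rw [c4] at t2
  refine ⟨tri (c + 2) x (e E c) (e F (c + 1)), Finset.mem_filter.2 ⟨hx2, t1, t2, by rwa [t0]⟩, ?_⟩
  apply disj_of_notMem_used
  refine forall_fin3 c ?_ ?_ ?_
  · rw [t1]; exact h1
  · rw [t2]; exact h2
  · rw [t0]; exact hx'

lemma notMem_used_of {N : Finset (Fin 3 → Fin n)} {c : Fin 3} {x : Fin n}
    (h : ∀ f ∈ N, f c ≠ x) : x ∉ used N c := by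
  intro hx
  obtain ⟨f, hf, hfx⟩ := Finset.mem_image.1 hx
  exact h f hf hfx

open Classical in
lemma no_match (hs : Setup H e L) {k : ℕ} (ι : Fin k → Fin m) (hι : Function.Injective ι)
    {θ : ℝ} (hθ : (k : ℝ) + 1 ≤ θ)
    (I : Finset (Fin 3 × Fin k)) (a a' : Fin 3 × Fin k → Fin 3 × Fin k)
    (hR : ∀ i ∈ I, (a' i).1 = (a i).1 + 1 ∧ Gd H e L θ (a i).1 (ι (a i).2) (ι (a' i).2))
    (ha : Set.InjOn a I) (ha' : Set.InjOn a' I) (hd : ∀ i ∈ I, ∀ j ∈ I, a i ≠ a' j) :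
    I.card ≤ k := by
  by_contra hcon
  push Not at hcon
  obtain ⟨I', hI', hc⟩ := Finset.exists_subset_card_eq (show k + 1 ≤ I.card from hcon)
  obtain ⟨N1, hM, -, hcard, hF, -⟩ := greedy
    (fun i => Fp H e L (a i).1 (ι (a i).2) (ι (a' i).2)) (∅ : Finset (Fin 3 → Fin n))
    (fun _ h => absurd h (Finset.notMem_empty _)) (k + 1) I' (by
      intro i hi N hN hNc hNF
      have hi' := hI' hi
      have hlt : (N.card : ℝ) < θ := by
        have : (N.card : ℝ) < (k : ℝ) + 1 := by exact_mod_cast hNc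
        linarith
      refine pair_pick (hR i hi').2 N hlt ?_ ?_
      · apply notMem_used_of
        intro f hf hfe
        rcases hNF f hf with h | ⟨j, hj, hji, hfj⟩
        · exact absurd h (Finset.notMem_empty _)
        rcases Fp_hit hs hfj hfe with ⟨h1, h2⟩ | ⟨h1, h2⟩
        · exact hji (ha (hI' hj) hi' (Prod.ext h1.symm (hι h2.symm)))
        · rw [← (hR j (hI' hj)).1] at h1
          exact hd i hi' j (hI' hj) (Prod.ext h1 (hι h2))
      · apply notMem_used_of
        intro f hf hfe
        rcases hNF f hf with h | ⟨j, hj, hji, hfj⟩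
        · exact absurd h (Finset.notMem_empty _)
        rcases Fp_hit hs hfj hfe with ⟨h1, h2⟩ | ⟨h1, h2⟩
        · rw [← (hR i hi').1] at h1
          exact hd j (hI' hj) i hi' (Prod.ext h1.symm (hι h2.symm))
        · rw [← (hR j (hI' hj)).1, ← (hR i hi').1] at h1
          exact hji (ha' (hI' hj) hi' (Prod.ext h1.symm (hι h2.symm))))
    (by simp [hc])
  have := hs.ni (Finset.univ.image ι) N1 ?_ hM ?_
  · rw [Finset.card_image_of_injective _ hι, Finset.card_univ, Fintype.card_fin] at this
    omega
  · intro g hg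
    obtain ⟨j, -, h⟩ := hF g hg
    exact (Finset.mem_filter.1 h).1
  · intro g hg
    obtain ⟨j, -, h⟩ := hF g hg
    obtain ⟨-, h1, h2, h3⟩ := Finset.mem_filter.1 h
    refine forall_fin3 (a j).1 (Or.inr ⟨_, Finset.mem_image_of_mem _ (Finset.mem_univ _), h1⟩)
      (Or.inr ⟨_, Finset.mem_image_of_mem _ (Finset.mem_univ _), h2⟩) (Or.inl h3)

end PM

namespace PM

variable {n m k : ℕ} {H : Finset (Fin 3 → Fin n)} {e : Fin m → Fin 3 → Fin n}
  {L : Fin 3 → Finset (Fin n)}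

open Classical in
/-- Neighbours of `(c,E)` in the reservoir `W`. -/
noncomputable def nb (H : Finset (Fin 3 → Fin n)) (e : Fin m → Fin 3 → Fin n)
    (L : Fin 3 → Finset (Fin n)) (θ : ℝ) (ι : Fin k → Fin m) (W : Fin 3 → Finset (Fin k))
    (c : Fin 3) (E : Fin m) : Finset (Fin k) :=
  (W (c + 1)).filter (fun y => Gd H e L θ c E (ι y))

/-- Edges from `(c,E)` into the reservoir. -/
noncomputable def fam (H : Finset (Fin 3 → Fin n)) (e : Fin m → Fin 3 → Fin n)
    (L : Fin 3 → Finset (Fin n)) (θ : ℝ) (ι : Fin k → Fin m) (W : Fin 3 → Finset (Fin k))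
    (c : Fin 3) (E : Fin m) : Finset (Fin 3 → Fin n) :=
  (nb H e L θ ι W c E).biUnion (fun y => Fp H e L c E (ι y))

open Classical in
lemma fam_hit (hs : Setup H e L) {θ : ℝ} {ι : Fin k → Fin m} {W : Fin 3 → Finset (Fin k)}
    {c : Fin 3} {E : Fin m} {g : Fin 3 → Fin n} (hg : g ∈ fam H e L θ ι W c E)
    {c' : Fin 3} {E' : Fin m} (h : g c' = e E' c') :
    (c' = c ∧ E' = E) ∨ (c' = c + 1 ∧ ∃ y ∈ W (c + 1), E' = ι y) := by
  obtain ⟨y, hy, hg⟩ := Finset.mem_biUnion.1 hg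
  rcases Fp_hit hs hg h with h | ⟨h1, h2⟩
  · exact Or.inl h
  · exact Or.inr ⟨h1, y, (Finset.mem_filter.1 hy).1, h2⟩

lemma fam_spec {θ : ℝ} {ι : Fin k → Fin m} {W : Fin 3 → Finset (Fin k)}
    {c : Fin 3} {E : Fin m} {g : Fin 3 → Fin n} (hg : g ∈ fam H e L θ ι W c E) :
    g ∈ H ∧ g c = e E c ∧ (∃ y, g (c + 1) = e (ι y) (c + 1)) ∧ g (c + 2) ∈ L (c + 2) := by
  obtain ⟨y, hy, hg⟩ := Finset.mem_biUnion.1 hg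
  obtain ⟨h0, h1, h2, h3⟩ := Finset.mem_filter.1 hg
  exact ⟨h0, h1, ⟨y, h2⟩, h3⟩

open Classical in
lemma fam_pick {θ : ℝ} {ι : Fin k → Fin m} {W : Fin 3 → Finset (Fin k)}
    {c : Fin 3} {E : Fin m} (N : Finset (Fin 3 → Fin n)) (hN : (N.card : ℝ) < θ)
    (h1 : e E c ∉ used N c)
    (h2 : ((W (c + 1)).filter (fun y => e (ι y) (c + 1) ∈ used N (c + 1))).card <
      (nb H e L θ ι W c E).card) :
    ∃ g ∈ fam H e L θ ι W c E, ∀ f ∈ N, ∀ i, g i ≠ f i := by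
  obtain ⟨y, hy, hy'⟩ := Finset.exists_mem_notMem_of_card_lt_card h2
  obtain ⟨hyW, hyG⟩ := Finset.mem_filter.1 hy
  obtain ⟨g, hg, hgd⟩ := pair_pick hyG N hN h1 (fun h => hy' (Finset.mem_filter.2 ⟨hyW, h⟩))
  exact ⟨g, Finset.mem_biUnion.2 ⟨y, hy, hg⟩, hgd⟩

lemma used_le (hs : Setup H e L) {ι : Fin k → Fin m} (hι : Function.Injective ι)
    (N : Finset (Fin 3 → Fin n)) (Y : Finset (Fin k)) (c : Fin 3)
    (h : ∀ y ∈ Y, e (ι y) c ∈ used N c) : Y.card ≤ N.card := by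
  refine le_trans (Finset.card_le_card_of_injOn (fun y => e (ι y) c) ?_ ?_) (card_used_le N c)
  · intro y hy; exact Finset.mem_coe.2 (h y (Finset.mem_coe.1 hy))
  · intro y _ y' _ h; exact hι (hs.inj c _ _ h)

open Classical in
lemma no_improve (hs : Setup H e L) {ι : Fin k → Fin m} (hι : Function.Injective ι)
    {θ : ℝ} {W : Fin 3 → Finset (Fin k)} (I2 : Finset (Fin 3 × Fin k)) (D1 D2 u : ℕ)
    (hI2 : ∀ v ∈ I2, v.2 ∉ W v.1 ∧ D2 ≤ (nb H e L θ ι W v.1 (ι v.2)).card)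
    (hu : ∀ c, (I2.filter (fun v => v.1 = c)).card ≤ u)
    (J : Finset (Fin m)) (hJ : ∀ y, ι y ∉ J)
    (Sp : Finset (Fin 3 × Fin m))
    (hSp : ∀ v ∈ Sp, v.2 ∈ J ∧ D1 ≤ (nb H e L θ ι W v.1 v.2).card)
    (N0 : Finset (Fin 3 → Fin n)) (hN0H : N0 ⊆ H) (hN0 : IsM N0)
    (hN0J : ∀ f ∈ N0, ∀ c, ∃ E ∈ J, f c = e E c ∧ (c, E) ∉ Sp)
    (hD1 : N0.card + Sp.card ≤ D1) (hD2 : N0.card + Sp.card + u < D2)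
    (hθ : ((N0.card + Sp.card + I2.card : ℕ) : ℝ) ≤ θ) :
    N0.card + Sp.card + I2.card ≤ J.card + k := by
  obtain ⟨N1, hM1, hd1, hc1, hF1, -⟩ := greedy
    (fun v : Fin 3 × Fin m => fam H e L θ ι W v.1 v.2) N0 hN0 (N0.card + Sp.card) Sp (by
      intro v hv N hN hNc hNF
      have hlt : (N.card : ℝ) < θ := by
        have : (N.card : ℝ) < ((N0.card + Sp.card + I2.card : ℕ) : ℝ) := by
          exact_mod_cast (by omega : N.card < N0.card + Sp.card + I2.card)
        linarith
      refine fam_pick N hlt ?_ ?_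
      · apply notMem_used_of
        intro f hf hfe
        rcases hNF f hf with h | ⟨w, hw, hwv, hfw⟩
        · obtain ⟨E, hE, h1, h2⟩ := hN0J f h v.1
          have := hs.inj _ _ _ (h1.symm.trans hfe)
          rw [this] at h2
          exact h2 hv
        · rcases fam_hit hs hfw hfe with ⟨h1, h2⟩ | ⟨-, y, -, h2⟩
          · exact hwv (Prod.ext h1.symm h2.symm)
          · exact hJ y (h2 ▸ (hSp v hv).1)
      · have h1 := used_le hs hι N ((W (v.1 + 1)).filter
          (fun y => e (ι y) (v.1 + 1) ∈ used N (v.1 + 1))) (v.1 + 1)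
          (fun y hy => (Finset.mem_filter.1 hy).2)
        have h2 := (hSp v hv).2
        omega) le_rfl
  have hU1 : IsM (N0 ∪ N1) := hN0.union hM1 hd1
  have hUc : (N0 ∪ N1).card = N0.card + Sp.card := by rw [card_union_of_disj hd1, hc1]
  obtain ⟨N2, hM2, hd2, hc2, hF2, -⟩ := greedy
    (fun v : Fin 3 × Fin k => fam H e L θ ι W v.1 (ι v.2)) (N0 ∪ N1) hU1
      (N0.card + Sp.card + I2.card) I2 (by
      intro v hv N hN hNc hNF
      have hlt : (N.card : ℝ) < θ := by
        have : (N.card : ℝ) < ((N0.card + Sp.card + I2.card : ℕ) : ℝ) := by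
          exact_mod_cast hNc
        linarith
      refine fam_pick N hlt ?_ ?_
      · apply notMem_used_of
        intro f hf hfe
        rcases hNF f hf with h | ⟨w, hw, hwv, hfw⟩
        · rcases Finset.mem_union.1 h with h | h
          · obtain ⟨E, hE, h1, h2⟩ := hN0J f h v.1
            have := hs.inj _ _ _ (h1.symm.trans hfe)
            exact hJ _ (this ▸ hE)
          · obtain ⟨w, hw, hfw⟩ := hF1 f h
            rcases fam_hit hs hfw hfe with ⟨h1, h2⟩ | ⟨h1, y, hy, h2⟩
            · exact hJ v.2 (h2 ▸ (hSp w hw).1)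
            · rw [← h1, ← hι h2] at hy
              exact (hI2 v hv).1 hy
        · rcases fam_hit hs hfw hfe with ⟨h1, h2⟩ | ⟨h1, y, hy, h2⟩
          · exact hwv (Prod.ext h1.symm (hι h2.symm))
          · rw [← h1, ← hι h2] at hy
            exact (hI2 v hv).1 hy
      · set c := v.1 with hc
        set Y := (W (c + 1)).filter (fun y => e (ι y) (c + 1) ∈ used N (c + 1)) with hY
        set Y1 := Y.filter (fun y => e (ι y) (c + 1) ∈ used (N0 ∪ N1) (c + 1)) with hY1
        set Y2 := Y.filter (fun y => ¬ e (ι y) (c + 1) ∈ used (N0 ∪ N1) (c + 1)) with hY2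
        have e1 : Y1.card ≤ N0.card + Sp.card := by
          rw [← hUc]
          exact used_le hs hι _ _ _ (fun y hy => (Finset.mem_filter.1 hy).2)
        have e2 : Y2.card ≤ u := by
          have hex : ∀ y ∈ Y2, ∃ w ∈ I2.filter (fun w => w.1 = c), ∃ f ∈ N,
              f c = e (ι w.2) c ∧ f (c + 1) = e (ι y) (c + 1) := by
            intro y hy
            obtain ⟨hyY, hy2⟩ := Finset.mem_filter.1 hy
            obtain ⟨hyW, hyu⟩ := Finset.mem_filter.1 hyY
            obtain ⟨f, hf, hfe⟩ := Finset.mem_image.1 hyu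
            rcases hNF f hf with h | ⟨w, hw, -, hfw⟩
            · exact absurd (hfe ▸ mem_used h (c + 1)) hy2
            · rcases fam_hit hs hfw hfe with ⟨h1, h2⟩ | ⟨h1, -⟩
              · exfalso
                have := (hI2 w hw).1
                rw [← h1, ← hι h2] at this
                exact this hyW
              · have h1' : w.1 = c := (add_right_cancel h1).symm
                refine ⟨w, Finset.mem_filter.2 ⟨hw, h1'⟩, f, hf, ?_, hfe⟩
                have := (fam_spec hfw).2.1
                rwa [h1'] at this
          rcases Finset.eq_empty_or_nonempty Y2 with h0 | ⟨y0, hy0⟩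
          · rw [h0]; simp
          haveI : Nonempty (Fin 3 → Fin n) := by
            obtain ⟨_, _, f, _⟩ := hex y0 hy0
            exact ⟨f⟩
          haveI : Nonempty (Fin 3 × Fin k) := ⟨v⟩
          choose! w hw f hf hf1 hf2 using hex
          refine le_trans (Finset.card_le_card_of_injOn w ?_ ?_) (hu c)
          · intro y hy; exact Finset.mem_coe.2 (hw y (Finset.mem_coe.1 hy))
          · intro y hy y' hy' hww
            have a1 := hf1 y hy
            have a2 := hf1 y' hy'
            have hff : f y = f y' := by
              by_contra hne
              exact hN _ (hf y hy) _ (hf y' hy') hne c (by rw [a1, a2, hww])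
            have b1 := hf2 y hy
            have b2 := hf2 y' hy'
            rw [hff, b2] at b1
            exact (hι (hs.inj _ _ _ b1)).symm
        have e3 : Y1.card + Y2.card = Y.card := Finset.card_filter_add_card_filter_not _
        have e4 := (hI2 v hv).2
        rw [← hc] at e4
        omega) (by rw [hUc])
  have hfin := hs.ni (J ∪ Finset.univ.image ι) ((N0 ∪ N1) ∪ N2) ?_ (hU1.union hM2 hd2) ?_
  · rw [card_union_of_disj hd2, hUc, hc2] at hfin
    have h1 := Finset.card_union_le J (Finset.univ.image ι)
    rw [Finset.card_image_of_injective _ hι, Finset.card_univ, Fintype.card_fin] at h1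
    omega
  · intro g hg
    rcases Finset.mem_union.1 hg with hg | hg
    · rcases Finset.mem_union.1 hg with hg | hg
      · exact hN0H hg
      · obtain ⟨v, -, h⟩ := hF1 g hg
        exact (fam_spec h).1
    · obtain ⟨v, -, h⟩ := hF2 g hg
      exact (fam_spec h).1
  · have hA : ∀ y, ι y ∈ J ∪ Finset.univ.image ι := fun y =>
      Finset.mem_union_right _ (Finset.mem_image_of_mem _ (Finset.mem_univ _))
    intro g hg
    rcases Finset.mem_union.1 hg with hg | hg
    · rcases Finset.mem_union.1 hg with hg | hg
      · intro c
        obtain ⟨E, hE, h, -⟩ := hN0J g hg c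
        exact Or.inr ⟨E, Finset.mem_union_left _ hE, h⟩
      · obtain ⟨v, hv, h⟩ := hF1 g hg
        obtain ⟨-, h1, ⟨y, h2⟩, h3⟩ := fam_spec h
        exact forall_fin3 v.1 (Or.inr ⟨_, Finset.mem_union_left _ (hSp v hv).1, h1⟩)
          (Or.inr ⟨_, hA y, h2⟩) (Or.inl h3)
    · obtain ⟨v, hv, h⟩ := hF2 g hg
      obtain ⟨-, h1, ⟨y, h2⟩, h3⟩ := fam_spec h
      exact forall_fin3 v.1 (Or.inr ⟨_, hA _, h1⟩) (Or.inr ⟨_, hA y, h2⟩) (Or.inl h3)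

end PM

namespace PM

variable {n m k : ℕ} {H : Finset (Fin 3 → Fin n)} {e : Fin m → Fin 3 → Fin n}
  {L : Fin 3 → Finset (Fin n)}

open Classical in
lemma density (hs : Setup H e L) (r : ℕ) (hr : 0 < r) (hLr : ∀ c, (L c).card = r)
    (hdeg : ∀ c x, (5 / 9 : ℝ) * (n : ℝ) ^ 2 - n ≤ (deg3 H c x : ℝ)) (τ : ℝ) (hτ : 0 ≤ τ) (c : Fin 3) :
    (5 / 9 : ℝ) * (n : ℝ) ^ 2 - n - 2 * ((n : ℝ) - m) * n - τ * (m : ℝ) ^ 2 ≤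
      (((Finset.univ.filter (fun p : Fin m × Fin m => Gd H e L (τ * r) c p.1 p.2)).card : ℕ) : ℝ) := by
  have hrp : (0 : ℝ) < r := by exact_mod_cast hr
  have hcompl : ∀ d : Fin 3, (((Finset.univ.image (fun E => e E d))ᶜ.card : ℕ) : ℝ) = n - m := by
    intro d
    have h1 := Finset.card_add_card_compl (Finset.univ.image (fun E => e E d))
    rw [Finset.card_image_of_injective _ (fun E F h => hs.inj d E F h), Finset.card_univ,
      Fintype.card_fin, Fintype.card_fin] at h1
    have : (m : ℝ) + (((Finset.univ.image (fun E => e E d))ᶜ.card : ℕ) : ℝ) = n := by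
      exact_mod_cast h1
    linarith
  -- pairs through one leftover vertex
  have hx : ∀ x ∈ L (c + 2), (5 / 9 : ℝ) * (n : ℝ) ^ 2 - n - 2 * ((n : ℝ) - m) * n ≤
      (((Finset.univ.filter (fun p : Fin m × Fin m =>
        tri (c + 2) x (e p.1 c) (e p.2 (c + 1)) ∈ H)).card : ℕ) : ℝ) := by
    intro x _
    set Q := Finset.univ.filter (fun p : Fin m × Fin m =>
        tri (c + 2) x (e p.1 c) (e p.2 (c + 1)) ∈ H) with hQ
    have hsub : link H (c + 2) x ⊆ (Q.image (fun p => (e p.1 c, e p.2 (c + 1))) ∪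
        ((Finset.univ.image (fun E => e E c))ᶜ ×ˢ Finset.univ)) ∪
        (Finset.univ ×ˢ (Finset.univ.image (fun E => e E (c + 1)))ᶜ) := by
      rintro ⟨y, z⟩ hp
      rw [mem_link] at hp
      by_cases hy : y ∈ Finset.univ.image (fun E => e E c)
      · by_cases hz : z ∈ Finset.univ.image (fun E => e E (c + 1))
        · obtain ⟨E, -, rfl⟩ := Finset.mem_image.1 hy
          obtain ⟨F, -, rfl⟩ := Finset.mem_image.1 hz
          refine Finset.mem_union_left _ (Finset.mem_union_left _ (Finset.mem_image.2
            ⟨(E, F), Finset.mem_filter.2 ⟨Finset.mem_univ _, hp⟩, rfl⟩))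
        · exact Finset.mem_union_right _ (Finset.mem_product.2
            ⟨Finset.mem_univ _, Finset.mem_compl.2 hz⟩)
      · exact Finset.mem_union_left _ (Finset.mem_union_right _ (Finset.mem_product.2
            ⟨Finset.mem_compl.2 hy, Finset.mem_univ _⟩))
    have h1 := Finset.card_le_card hsub
    have h2 := Finset.card_union_le (Q.image (fun p => (e p.1 c, e p.2 (c + 1))) ∪
        ((Finset.univ.image (fun E => e E c))ᶜ ×ˢ Finset.univ))
        (Finset.univ ×ˢ (Finset.univ.image (fun E => e E (c + 1)))ᶜ)
    have h3 := Finset.card_union_le (Q.image (fun p => (e p.1 c, e p.2 (c + 1))))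
        ((Finset.univ.image (fun E => e E c))ᶜ ×ˢ (Finset.univ : Finset (Fin n)))
    have h4 := Finset.card_image_le (s := Q) (f := fun p => (e p.1 c, e p.2 (c + 1)))
    rw [Finset.card_product, Finset.card_univ, Fintype.card_fin] at h2 h3
    rw [← deg3_eq] at h1
    have h5 : deg3 H (c + 2) x ≤ Q.card + (Finset.univ.image (fun E => e E c))ᶜ.card * n +
      n * (Finset.univ.image (fun E => e E (c + 1)))ᶜ.card := by omega
    have h6 : (deg3 H (c + 2) x : ℝ) ≤ (Q.card : ℝ) +
      (((Finset.univ.image (fun E => e E c))ᶜ.card : ℕ) : ℝ) * n +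
      n * (((Finset.univ.image (fun E => e E (c + 1)))ᶜ.card : ℕ) : ℝ) := by exact_mod_cast h5
    rw [hcompl, hcompl] at h6
    have := hdeg (c + 2) x
    linarith
  have hsum := Finset.card_nsmul_le_sum (L (c + 2)) _ _ hx
  rw [hLr, nsmul_eq_mul] at hsum
  have hswap : ∑ x ∈ L (c + 2), (((Finset.univ.filter (fun p : Fin m × Fin m =>
        tri (c + 2) x (e p.1 c) (e p.2 (c + 1)) ∈ H)).card : ℕ) : ℝ) =
      ∑ p : Fin m × Fin m, (cnt H e L c p.1 p.2 : ℝ) := by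
    rw [← Nat.cast_sum, ← Nat.cast_sum]
    congr 1
    unfold cnt
    simp only [Finset.card_filter]
    rw [Finset.sum_comm]
  rw [hswap, ← Finset.sum_filter_add_sum_filter_not Finset.univ
    (fun p : Fin m × Fin m => Gd H e L (τ * r) c p.1 p.2)] at hsum
  have hA := Finset.sum_le_card_nsmul (Finset.univ.filter
    (fun p : Fin m × Fin m => Gd H e L (τ * r) c p.1 p.2))
    (fun p => (cnt H e L c p.1 p.2 : ℝ)) (r : ℝ) (by
      intro p _
      rw [← hLr (c + 2)]
      exact Nat.cast_le.2 (Finset.card_le_card (Finset.filter_subset _ _)))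
  have hB := Finset.sum_le_card_nsmul (Finset.univ.filter
    (fun p : Fin m × Fin m => ¬ Gd H e L (τ * r) c p.1 p.2))
    (fun p => (cnt H e L c p.1 p.2 : ℝ)) (τ * r) (by
      intro p hp
      have := (Finset.mem_filter.1 hp).2
      unfold Gd at this
      push Not at this
      exact this.le)
  rw [nsmul_eq_mul] at hA hB
  have hng : (((Finset.univ.filter (fun p : Fin m × Fin m =>
      ¬ Gd H e L (τ * r) c p.1 p.2)).card : ℕ) : ℝ) ≤ (m : ℝ) ^ 2 := by
    have := Finset.card_le_univ (Finset.univ.filter (fun p : Fin m × Fin m =>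
      ¬ Gd H e L (τ * r) c p.1 p.2))
    rw [Fintype.card_prod, Fintype.card_fin, ← pow_two] at this
    exact_mod_cast this
  have hng2 := mul_le_mul_of_nonneg_right hng (mul_nonneg hτ hrp.le)
  have hfin : (r : ℝ) * ((5 / 9 : ℝ) * (n : ℝ) ^ 2 - n - 2 * ((n : ℝ) - m) * n - τ * (m : ℝ) ^ 2) ≤
      r * (((Finset.univ.filter (fun p : Fin m × Fin m => Gd H e L (τ * r) c p.1 p.2)).card : ℕ) : ℝ) := by
    linarith
  exact le_of_mul_le_mul_left hfin hrp

open Classical in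
lemma sample_A (G : Fin 3 → Fin m → Fin m → Prop) (η : ℝ) (hη : 0 < η) (hη1 : η ≤ 1) (hm : 0 < m)
    (hG : ∀ c, (5 / 9 - η) * (m : ℝ) ^ 2 ≤
      (((Finset.univ.filter (fun p : Fin m × Fin m => G c p.1 p.2)).card : ℕ) : ℝ))
    (hk : (k : ℝ) * (1 / m) ≤ η ^ 2 / 32) (hexp : (3 * m + 3 : ℝ) < Real.exp (η ^ 2 * k / 8)) :
    ∃ ι : Fin k → Fin m, Function.Injective ι ∧
      (∀ c, (5 / 9 - 2 * η) * k * m ≤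
        ∑ y : Fin k, (((Finset.univ.filter (fun E => G c E (ι y))).card : ℕ) : ℝ)) ∧
      (∀ c, (5 / 9 - 3 * η) * (k : ℝ) ^ 2 ≤
        (((Finset.univ.filter (fun p : Fin k × Fin k => G c (ι p.1) (ι p.2))).card : ℕ) : ℝ)) := by
  have hmp : (0 : ℝ) < m := by exact_mod_cast hm
  let d : Fin 3 → Fin m → ℝ := fun c F => (((Finset.univ.filter (fun E => G c E F)).card : ℕ) : ℝ)
  have hd : ∀ c F, d c F ≤ m := fun c F => by
    have := Finset.card_le_univ (Finset.univ.filter (fun E => G c E F))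
    rw [Fintype.card_fin] at this
    exact Nat.cast_le.2 this
  have hdi : ∀ c F, d c F = ∑ E, (if G c E F then (1 : ℝ) else 0) := by
    intro c F; simp only [d]; rw [Finset.sum_boole]
  let h : (Fin 3 × Fin m) ⊕ Fin 3 → Fin m → ℝ := fun t ω =>
    Sum.elim (fun p => if G p.1 ω p.2 then (1 : ℝ) else 0) (fun c => d c ω / m) t
  obtain ⟨A, hA, -, hsum⟩ := sampling (Ω := Fin m) (T := (Fin 3 × Fin m) ⊕ Fin 3)
    (fun a b => a = b) (fun _ => rfl) (fun _ _ h => h.symm) (1 / m) η k hη hη1 hk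
    (by rw [Fintype.card_fin]; exact hm)
    (by
      intro ω
      rw [Fintype.card_fin, one_div, inv_mul_cancel₀ hmp.ne']
      rw [Finset.filter_eq]; simp)
    (by
      refine lt_of_eq_of_lt ?_ hexp
      simp)
    h
    (by
      rintro (p | c) ω
      · simp only [h, Sum.elim_inl]; split_ifs <;> norm_num
      · simp only [h, Sum.elim_inr, d]; positivity)
    (by
      rintro (p | c) ω
      · simp only [h, Sum.elim_inl]; split_ifs <;> norm_num
      · simp only [h, Sum.elim_inr]; rw [div_le_one hmp]; exact hd c ω)
  let ι : Fin k → Fin m := fun y => A.orderEmbOfFin hA y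
  have hι : Function.Injective ι := (A.orderEmbOfFin hA).injective
  have himg : Finset.univ.image ι = A := by
    apply Finset.coe_injective
    simp [ι]
  have hsumι : ∀ f : Fin m → ℝ, ∑ y, f (ι y) = ∑ ω ∈ A, f ω := by
    intro f
    rw [← himg, Finset.sum_image (fun a _ b _ h => hι h)]
  have hG' : ∀ c, (5 / 9 - η) * (m : ℝ) ^ 2 ≤ ∑ F, d c F := by
    intro c
    refine (hG c).trans (le_of_eq ?_)
    simp only [hdi]
    rw [Finset.sum_comm, ← Fintype.sum_prod_type', Finset.sum_boole]
  have h2 : ∀ c, (5 / 9 - 2 * η) * k * m ≤ ∑ y, d c (ι y) := by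
    intro c
    have h1 := hsum (Sum.inr c)
    simp only [h, Sum.elim_inr] at h1
    rw [Fintype.card_fin, ← Finset.sum_div, ← Finset.sum_div, ← hsumι] at h1
    have h3 : (5 / 9 - η) ≤ (∑ F, d c F) / m / m := by
      rw [div_div, le_div_iff₀ (by positivity)]
      have := hG' c
      nlinarith
    rw [le_div_iff₀ hmp] at h1
    refine le_trans ?_ h1
    refine mul_le_mul_of_nonneg_right ?_ hmp.le
    exact mul_le_mul_of_nonneg_right (by linarith) (Nat.cast_nonneg _)
  refine ⟨ι, hι, h2, ?_⟩
  intro c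
  have h3 : ∀ y : Fin k, (d c (ι y) / m - η) * k ≤ ∑ x : Fin k, (if G c (ι x) (ι y) then (1 : ℝ) else 0) := by
    intro y
    have h1 := hsum (Sum.inl (c, ι y))
    simp only [h, Sum.elim_inl] at h1
    rw [Fintype.card_fin, ← hdi, ← hsumι] at h1
    exact h1
  have h4 := Finset.sum_le_sum (fun y (_ : y ∈ (Finset.univ : Finset (Fin k))) => h3 y)
  rw [Finset.sum_comm, ← Fintype.sum_prod_type', Finset.sum_boole] at h4
  refine le_trans ?_ h4
  rw [← Finset.sum_mul, Finset.sum_sub_distrib, ← Finset.sum_div, Finset.sum_const,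
    Finset.card_univ, Fintype.card_fin, nsmul_eq_mul]
  have h5 : (5 / 9 - 2 * η) * k ≤ (∑ y, d c (ι y)) / m := by
    rw [le_div_iff₀ hmp]; exact h2 c
  have h6 : (5 / 9 - 3 * η) * (k : ℝ) ^ 2 = ((5 / 9 - 2 * η) * k - k * η) * k := by ring
  rw [h6]
  exact mul_le_mul_of_nonneg_right (by linarith) (Nat.cast_nonneg _)

end PM

namespace PM

variable {n m k : ℕ} {H : Finset (Fin 3 → Fin n)} {e : Fin m → Fin 3 → Fin n}
  {L : Fin 3 → Finset (Fin n)}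

open Classical in
lemma card_class (P : Fin 3 → Fin k → Prop) (c : Fin 3) :
    (((Finset.univ : Finset (Fin 3 × Fin k)).filter (fun v => P v.1 v.2)).filter (fun v => v.1 = c)).card =
      (Finset.univ.filter (fun j => P c j)).card := by
  symm
  apply Finset.card_bij (fun j _ => (c, j))
  · intro j hj
    have := (Finset.mem_filter.1 hj).2
    simp [this]
  · intro j _ j' _ h
    simpa using h
  · rintro ⟨c', j⟩ hv
    obtain ⟨h1, h2⟩ := Finset.mem_filter.1 hv
    simp only at h2
    subst h2
    exact ⟨j, Finset.mem_filter.2 ⟨Finset.mem_univ _, (Finset.mem_filter.1 h1).2⟩, rfl⟩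

open Classical in
lemma good_centers {θ ε : ℝ} {ι : Fin k → Fin m} {W : Fin 3 → Finset (Fin k)}
    (hε : 0 < ε) (hε1 : ε ≤ 1 / 1000000) (hk : 0 < k)
    (hW : ∀ c, (2 / 3 - 100 * ε) * k ≤ (((W c).card : ℕ) : ℝ) ∧
        (((W c).card : ℕ) : ℝ) ≤ (2 / 3 + 200 * ε) * k)
    (hW2 : ∀ c, (((Finset.univ.filter (fun p : Fin k × Fin k => p.1 ∉ W c ∧ p.2 ∈ W (c + 1) ∧
        ¬ Gd H e L θ c (ι p.1) (ι p.2))).card : ℕ) : ℝ) ≤ 100 * ε * (k : ℝ) ^ 2) :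
    ∃ I2 : Finset (Fin 3 × Fin k),
      (∀ v ∈ I2, v.2 ∉ W v.1 ∧ ⌈(0.56 : ℝ) * k⌉₊ ≤ (nb H e L θ ι W v.1 (ι v.2)).card) ∧
      (∀ c, (I2.filter (fun v => v.1 = c)).card ≤ ⌊(0.34 : ℝ) * k⌋₊) ∧
      (k : ℝ) - 3600 * ε * k ≤ ((I2.card : ℕ) : ℝ) ∧ I2.card ≤ 3 * k := by
  have hk0 : (0 : ℝ) < k := by exact_mod_cast hk
  have hεk : ε * k ≤ 1 / 1000000 * k := mul_le_mul_of_nonneg_right hε1 hk0.le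
  set P : Fin 3 → Fin k → Prop := fun c j => j ∉ W c ∧
    ⌈(0.56 : ℝ) * k⌉₊ ≤ (nb H e L θ ι W c (ι j)).card with hP
  set I2 := (Finset.univ : Finset (Fin 3 × Fin k)).filter (fun v => P v.1 v.2) with hI2
  have hWc : ∀ c, (((W c)ᶜ.card : ℕ) : ℝ) = k - ((W c).card : ℝ) := by
    intro c
    have := Finset.card_add_card_compl (W c)
    rw [Fintype.card_fin] at this
    have h2 : (((W c).card : ℕ) : ℝ) + (((W c)ᶜ.card : ℕ) : ℝ) = k := by exact_mod_cast this
    linarith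
  have hcl : ∀ c, (I2.filter (fun v => v.1 = c)).card = (Finset.univ.filter (fun j => P c j)).card :=
    fun c => by convert card_class P c
  have hup : ∀ c, (I2.filter (fun v => v.1 = c)).card ≤ ⌊(0.34 : ℝ) * k⌋₊ := by
    intro c
    rw [hcl]
    apply Nat.le_floor
    have h1 : (Finset.univ.filter (fun j => P c j)).card ≤ (W c)ᶜ.card := by
      apply Finset.card_le_card
      intro j hj
      exact Finset.mem_compl.2 (Finset.mem_filter.1 hj).2.1
    have h2 : (((Finset.univ.filter (fun j => P c j)).card : ℕ) : ℝ) ≤ (((W c)ᶜ.card : ℕ) : ℝ) := by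
      exact_mod_cast h1
    rw [hWc] at h2
    have := (hW c).1
    linarith
  have hlow : ∀ c, (k : ℝ) - ((W c).card : ℝ) - 1000 * ε * k ≤
      (((Finset.univ.filter (fun j => P c j)).card : ℕ) : ℝ) := by
    intro c
    set Bd := (W c)ᶜ.filter (fun j => ¬ P c j) with hBd
    have hb : ((Bd.card : ℕ) : ℝ) * (k / 10) ≤ 100 * ε * (k : ℝ) ^ 2 := by
      refine le_trans ?_ (hW2 c)
      have hsub : (Bd.sigma (fun j => (W (c + 1)).filter (fun y => ¬ Gd H e L θ c (ι j) (ι y)))).card ≤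
          (Finset.univ.filter (fun p : Fin k × Fin k => p.1 ∉ W c ∧ p.2 ∈ W (c + 1) ∧
        ¬ Gd H e L θ c (ι p.1) (ι p.2))).card := by
        apply Finset.card_le_card_of_injOn (fun s => (s.1, s.2))
        · rintro ⟨j, y⟩ hs
          have hs := Finset.mem_sigma.1 (Finset.mem_coe.1 hs)
          have h1 := Finset.mem_filter.1 hs.1
          have h2 := Finset.mem_filter.1 hs.2
          exact Finset.mem_coe.2 (Finset.mem_filter.2 ⟨Finset.mem_univ _, Finset.mem_compl.1 h1.1, h2.1, h2.2⟩)
        · rintro ⟨j, y⟩ _ ⟨j', y'⟩ _ h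
          simp only [Prod.mk.injEq] at h
          obtain ⟨rfl, rfl⟩ := h
          rfl
      rw [Finset.card_sigma] at hsub
      refine le_trans ?_ (Nat.cast_le.2 hsub)
      push_cast
      rw [← nsmul_eq_mul]
      apply Finset.card_nsmul_le_sum
      intro j hj
      obtain ⟨hj1, hj2⟩ := Finset.mem_filter.1 hj
      have hj3 : ((nb H e L θ ι W c (ι j)).card : ℝ) < 0.56 * k := by
        by_contra hcon
        push Not at hcon
        exact hj2 ⟨Finset.mem_compl.1 hj1, Nat.ceil_le.2 hcon⟩
      have hsplit := Finset.card_filter_add_card_filter_not (s := W (c + 1))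
        (fun y => Gd H e L θ c (ι j) (ι y))
      have hsplit' : ((nb H e L θ ι W c (ι j)).card : ℝ) +
        ((((W (c + 1)).filter (fun y => ¬ Gd H e L θ c (ι j) (ι y))).card : ℕ) : ℝ) =
          ((W (c + 1)).card : ℝ) := by
        rw [← hsplit]; push_cast; rfl
      have := (hW (c + 1)).1
      linarith
    have hb2 : ((Bd.card : ℕ) : ℝ) ≤ 1000 * ε * k := by
      by_contra hcon
      push Not at hcon
      have := mul_lt_mul_of_pos_right hcon (show (0 : ℝ) < k / 10 by positivity)
      nlinarith
    have h3 := Finset.card_filter_add_card_filter_not (s := (W c)ᶜ) (fun j => P c j)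
    have h4 : ((W c)ᶜ.filter (fun j => P c j)).card ≤ (Finset.univ.filter (fun j => P c j)).card :=
      Finset.card_le_card (Finset.filter_subset_filter _ (Finset.subset_univ _))
    have h3' : ((((W c)ᶜ.filter (fun j => P c j)).card : ℕ) : ℝ) + ((Bd.card : ℕ) : ℝ) =
      (((W c)ᶜ.card : ℕ) : ℝ) := by exact_mod_cast h3
    have h4' : ((((W c)ᶜ.filter (fun j => P c j)).card : ℕ) : ℝ) ≤
      (((Finset.univ.filter (fun j => P c j)).card : ℕ) : ℝ) := by exact_mod_cast h4
    rw [hWc] at h3'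
    linarith
  refine ⟨I2, ?_, hup, ?_, ?_⟩
  · intro v hv
    exact (Finset.mem_filter.1 hv).2
  · have hsum : I2.card = ∑ c : Fin 3, (I2.filter (fun v => v.1 = c)).card :=
      Finset.card_eq_sum_card_fiberwise (fun v _ => Finset.mem_coe.2 (Finset.mem_univ _))
    rw [hsum]
    simp only [hcl]
    push_cast
    rw [Fin.sum_univ_three]
    have a0 := hlow 0
    have a1 := hlow 1
    have a2 := hlow 2
    have b0 := (hW 0).2
    have b1 := (hW 1).2
    have b2 := (hW 2).2
    linarith
  · refine (Finset.card_le_univ _).trans ?_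
    simp

open Classical in
/-- Consequence of `no_improve` with the concrete choices. -/
lemma improve_bound (hs : Setup H e L) {θ ε : ℝ} {ι : Fin k → Fin m} (hι : Function.Injective ι)
    {W : Fin 3 → Finset (Fin k)}
    (hε : 0 < ε) (hε1 : ε ≤ 1 / 1000000) (hk : 100 ≤ k) (hθ : 4 * (k : ℝ) ≤ θ)
    (hW : ∀ c, (2 / 3 - 100 * ε) * k ≤ (((W c).card : ℕ) : ℝ) ∧
        (((W c).card : ℕ) : ℝ) ≤ (2 / 3 + 200 * ε) * k)
    (hW2 : ∀ c, (((Finset.univ.filter (fun p : Fin k × Fin k => p.1 ∉ W c ∧ p.2 ∈ W (c + 1) ∧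
        ¬ Gd H e L θ c (ι p.1) (ι p.2))).card : ℕ) : ℝ) ≤ 100 * ε * (k : ℝ) ^ 2)
    (Y : ℝ) (hY : Y ≤ k / 10)
    (J : Finset (Fin m)) (hJ : ∀ y, ι y ∉ J) (Sp : Finset (Fin 3 × Fin m))
    (hSp : ∀ v ∈ Sp, v.2 ∈ J ∧ Y ≤ ((nb H e L θ ι W v.1 v.2).card : ℝ))
    (N0 : Finset (Fin 3 → Fin n)) (hN0H : N0 ⊆ H) (hN0 : IsM N0)
    (hN0J : ∀ f ∈ N0, ∀ c, ∃ E ∈ J, f c = e E c ∧ (c, E) ∉ Sp)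
    (hD1 : ((N0.card + Sp.card : ℕ) : ℝ) ≤ Y) :
    ((N0.card + Sp.card : ℕ) : ℝ) ≤ J.card + 3600 * ε * k := by
  have hk0 : (100 : ℝ) ≤ k := by exact_mod_cast hk
  obtain ⟨I2, h1, h2, h3, h4⟩ := good_centers (H := H) (e := e) (L := L) (ι := ι) hε hε1
    (by omega) hW hW2
  have h4' : ((I2.card : ℕ) : ℝ) ≤ 3 * k := by exact_mod_cast h4
  have key := no_improve hs hι (θ := θ) (W := W) I2 ⌈Y⌉₊ ⌈(0.56 : ℝ) * k⌉₊ ⌊(0.34 : ℝ) * k⌋₊ h1 h2 J hJ Sp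
    (fun v hv => ⟨(hSp v hv).1, Nat.ceil_le.2 (hSp v hv).2⟩) N0 hN0H hN0 hN0J
    (by
      have : ((N0.card + Sp.card : ℕ) : ℝ) ≤ (⌈Y⌉₊ : ℝ) := hD1.trans (Nat.le_ceil _)
      exact_mod_cast this)
    (by
      have a1 : ((⌊(0.34 : ℝ) * k⌋₊ : ℕ) : ℝ) ≤ 0.34 * k := Nat.floor_le (by positivity)
      have a2 := Nat.le_ceil ((0.56 : ℝ) * k)
      have : ((N0.card + Sp.card + ⌊(0.34 : ℝ) * k⌋₊ : ℕ) : ℝ) < (⌈(0.56 : ℝ) * k⌉₊ : ℝ) := by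
        rw [Nat.cast_add]; linarith
      exact_mod_cast this)
    (by rw [Nat.cast_add]; linarith)
  have key' : ((N0.card + Sp.card : ℕ) : ℝ) + ((I2.card : ℕ) : ℝ) ≤ (J.card : ℝ) + k := by
    exact_mod_cast key
  linarith

end PM

namespace PM

open Classical in
lemma card_hit_le {n : ℕ} (B : Finset (Fin 3 → Fin n)) (U : Fin 3 → Finset (Fin n)) (u : ℕ)
    (hU : ∀ c, (U c).card ≤ u) (h : ∀ f ∈ B, ∃ c, f c ∈ U c) : B.card ≤ 3 * u * n ^ 2 := by
  have hsub : B ⊆ (Finset.univ : Finset (Fin 3)).biUnion (fun c => (U c).biUnion (fun x =>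
      (Finset.univ : Finset (Fin 3 → Fin n)).filter (fun f => f c = x))) := by
    intro f hf
    obtain ⟨c, hc⟩ := h f hf
    exact Finset.mem_biUnion.2 ⟨c, Finset.mem_univ _, Finset.mem_biUnion.2 ⟨f c, hc,
      Finset.mem_filter.2 ⟨Finset.mem_univ _, rfl⟩⟩⟩
  refine (Finset.card_le_card hsub).trans ?_
  have h1 : ∀ c : Fin 3, ((U c).biUnion (fun x =>
      (Finset.univ : Finset (Fin 3 → Fin n)).filter (fun f => f c = x))).card ≤ u * n ^ 2 := by
    intro c
    refine (Finset.card_biUnion_le_card_mul _ _ (n ^ 2) ?_).trans (Nat.mul_le_mul_right _ (hU c))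
    intro x _
    have := card_fix c x
    refine le_of_eq ?_
    rw [← this]
  refine (Finset.card_biUnion_le_card_mul _ _ _ (fun c _ => h1 c)).trans ?_
  simp [mul_assoc]

lemma card_le_of_matching {n : ℕ} (B : Finset (Fin 3 → Fin n)) (t : ℕ)
    (h : ∀ N ⊆ B, IsM N → N.card ≤ t) : B.card ≤ 3 * t * n ^ 2 := by
  classical
  obtain ⟨N, hN, hmax⟩ := Finset.exists_max_image (B.powerset.filter (fun N => IsM N))
    (fun N => N.card) ⟨∅, Finset.mem_filter.2 ⟨by simp, by simp [IsM]⟩⟩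
  obtain ⟨hNB, hNM⟩ := Finset.mem_filter.1 hN
  have hNB := Finset.mem_powerset.1 hNB
  refine card_hit_le B (fun c => used N c) t (fun c => (card_used_le N c).trans (h N hNB hNM)) ?_
  intro f hf
  by_contra hcon
  push Not at hcon
  have hd : ∀ g ∈ N, ∀ i, f i ≠ g i := fun g hg i heq => hcon i (by
    rw [heq]; exact mem_used hg i)
  have hM : IsM (insert f N) := by
    intro a ha b hb hab i
    rcases Finset.mem_insert.1 ha with h1 | h1
    · rcases Finset.mem_insert.1 hb with h2 | h2
      · exact absurd (h1.trans h2.symm) hab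
      · rw [h1]; exact hd b h2 i
    · rcases Finset.mem_insert.1 hb with h2 | h2
      · rw [h2]; exact (hd a h1 i).symm
      · exact hNM a h1 b h2 hab i
  have hfN : f ∉ N := fun hfN => hd f hfN 0 rfl
  have := hmax (insert f N) (Finset.mem_filter.2 ⟨Finset.mem_powerset.2
    (Finset.insert_subset hf hNB), hM⟩)
  rw [Finset.card_insert_of_notMem hfN] at this
  omega

open Classical in
lemma card_Sp {m : ℕ} (sp : Fin 3 → Fin m → Prop) (J : Finset (Fin m)) :
    ((Finset.univ : Finset (Fin 3 × Fin m)).filter (fun v => v.2 ∈ J ∧ sp v.1 v.2)).card =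
      ∑ E ∈ J, (Finset.univ.filter (fun c => sp c E)).card := by
  rw [Finset.card_eq_sum_card_fiberwise (t := J) (f := fun v => v.2)
    (fun v hv => (Finset.mem_filter.1 hv).2.1)]
  apply Finset.sum_congr rfl
  intro E hE
  apply Finset.card_bij (fun v _ => v.1)
  · rintro ⟨c, F⟩ hv
    obtain ⟨h1, h2⟩ := Finset.mem_filter.1 hv
    simp only at h2
    subst h2
    exact Finset.mem_filter.2 ⟨Finset.mem_univ _, (Finset.mem_filter.1 h1).2.2⟩
  · rintro ⟨c, F⟩ hv ⟨c', F'⟩ hv' h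
    have h2 := (Finset.mem_filter.1 hv).2
    have h2' := (Finset.mem_filter.1 hv').2
    simp only at h h2 h2'
    rw [h, h2, h2']
  · intro c hc
    refine ⟨(c, E), ?_, rfl⟩
    exact Finset.mem_filter.2 ⟨Finset.mem_filter.2 ⟨Finset.mem_univ _, hE, (Finset.mem_filter.1 hc).2⟩, rfl⟩

/-- The no-improvement property in abstract form. -/
def NI {n m : ℕ} (H : Finset (Fin 3 → Fin n)) (e : Fin m → Fin 3 → Fin n) (sp : Fin 3 → Fin m → Prop)
    (Rg : Finset (Fin m)) (X Y : ℝ) : Prop :=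
  ∀ (J : Finset (Fin m)) (Sp : Finset (Fin 3 × Fin m)) (N0 : Finset (Fin 3 → Fin n)),
    (∀ E ∈ J, E ∉ Rg) → (∀ v ∈ Sp, v.2 ∈ J ∧ sp v.1 v.2) → N0 ⊆ H → IsM N0 →
    (∀ f ∈ N0, ∀ c, ∃ E ∈ J, f c = e E c ∧ (c, E) ∉ Sp) →
    ((N0.card + Sp.card : ℕ) : ℝ) ≤ Y → ((N0.card + Sp.card : ℕ) : ℝ) ≤ J.card + X

variable {n m : ℕ} {H : Finset (Fin 3 → Fin n)} {e : Fin m → Fin 3 → Fin n}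

open Classical in
lemma two_lt {sp : Fin 3 → Fin m → Prop} {Rg : Finset (Fin m)} {X Y : ℝ} (hNI : NI H e sp Rg X Y)
    (t : ℕ) (hX : X < t) (hY : (10 * t : ℝ) ≤ Y) :
    (Finset.univ.filter (fun E => E ∉ Rg ∧ 2 ≤ (Finset.univ.filter (fun c => sp c E)).card)).card < t := by
  by_contra hcon
  push Not at hcon
  obtain ⟨J, hJs, hJc⟩ := Finset.exists_subset_card_eq hcon
  have hS := card_Sp sp J
  set Sp := (Finset.univ : Finset (Fin 3 × Fin m)).filter (fun v => v.2 ∈ J ∧ sp v.1 v.2) with hSp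
  have h2 : t * 2 ≤ Sp.card := by
    rw [hS, ← hJc, ← smul_eq_mul]
    apply Finset.card_nsmul_le_sum
    intro E hE
    exact (Finset.mem_filter.1 (hJs hE)).2.2
  have h3 : Sp.card ≤ t * 3 := by
    rw [hS, ← hJc, ← smul_eq_mul]
    apply Finset.sum_le_card_nsmul
    intro E hE
    refine (Finset.card_le_univ _).trans ?_
    simp
  have h2' : (t : ℝ) * 2 ≤ Sp.card := by exact_mod_cast h2
  have h3' : (Sp.card : ℝ) ≤ t * 3 := by exact_mod_cast h3
  have ht0 : (0 : ℝ) ≤ t := Nat.cast_nonneg _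
  have := hNI J Sp ∅ (fun E hE => (Finset.mem_filter.1 (hJs hE)).2.1)
    (fun v hv => (Finset.mem_filter.1 hv).2) (by simp) (by simp [IsM]) (by simp)
    (by simp only [Finset.card_empty, zero_add]; linarith)
  simp only [Finset.card_empty, zero_add, hJc] at this
  linarith

open Classical in
lemma B_card {sp : Fin 3 → Fin m → Prop} {Rg : Finset (Fin m)} {X Y : ℝ}
    (hinj : ∀ c E F, e E c = e F c → E = F) (hNI : NI H e sp Rg X Y)
    (t : ℕ) (hX : X < t) (hY : (10 * t : ℝ) ≤ Y) :
    (H.filter (fun f => ∀ c, ∃ E, f c = e E c ∧ ¬ sp c E ∧ E ∉ Rg ∧ ∃ c', sp c' E)).card ≤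
      3 * t * n ^ 2 := by
  apply card_le_of_matching
  intro N1 hN1 hM1
  by_contra hcon
  push Not at hcon
  obtain ⟨N0, hN0s, hN0c⟩ := Finset.exists_subset_card_eq hcon.le
  have hM0 := hM1.mono hN0s
  have hN0B := hN0s.trans hN1
  have hB : ∀ f ∈ N0, ∀ c, ∃ E, f c = e E c ∧ ¬ sp c E ∧ E ∉ Rg ∧ ∃ c', sp c' E := fun f hf =>
    (Finset.mem_filter.1 (hN0B hf)).2
  set J := (Finset.univ : Finset (Fin m)).filter (fun E => ∃ f ∈ N0, ∃ c, f c = e E c) with hJ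
  have hJp : ∀ E ∈ J, E ∉ Rg ∧ ∃ c', sp c' E := by
    intro E hE
    obtain ⟨f, hf, c, hc⟩ := (Finset.mem_filter.1 hE).2
    obtain ⟨E', h1, h2, h3, h4⟩ := hB f hf c
    have : E = E' := hinj c _ _ (hc.symm.trans h1)
    subst this
    exact ⟨h3, h4⟩
  have hJc : J.card ≤ 3 * t := by
    have hsub : J ⊆ (N0 ×ˢ (Finset.univ : Finset (Fin 3))).biUnion (fun p =>
        (Finset.univ : Finset (Fin m)).filter (fun E => p.1 p.2 = e E p.2)) := by
      intro E hE
      obtain ⟨f, hf, c, hc⟩ := (Finset.mem_filter.1 hE).2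
      exact Finset.mem_biUnion.2 ⟨(f, c), Finset.mem_product.2 ⟨hf, Finset.mem_univ _⟩,
        Finset.mem_filter.2 ⟨Finset.mem_univ _, hc⟩⟩
    refine (Finset.card_le_card hsub).trans ?_
    refine (Finset.card_biUnion_le_card_mul _ _ 1 ?_).trans ?_
    · rintro ⟨f, c⟩ _
      apply Finset.card_le_one.2
      intro E hE F hF
      exact hinj c _ _ ((Finset.mem_filter.1 hE).2.symm.trans (Finset.mem_filter.1 hF).2)
    · rw [Finset.card_product, hN0c]
      simp [mul_comm]
  have hS := card_Sp sp J
  set Sp := (Finset.univ : Finset (Fin 3 × Fin m)).filter (fun v => v.2 ∈ J ∧ sp v.1 v.2) with hSp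
  have h2 : J.card * 1 ≤ Sp.card := by
    rw [hS, ← smul_eq_mul]
    apply Finset.card_nsmul_le_sum
    intro E hE
    obtain ⟨c', hc'⟩ := (hJp E hE).2
    exact Finset.card_pos.2 ⟨c', Finset.mem_filter.2 ⟨Finset.mem_univ _, hc'⟩⟩
  have h3 : Sp.card ≤ J.card * 3 := by
    rw [hS, ← smul_eq_mul]
    apply Finset.sum_le_card_nsmul
    intro E hE
    refine (Finset.card_le_univ _).trans ?_
    simp
  have := hNI J Sp N0 (fun E hE => (hJp E hE).1)
    (fun v hv => (Finset.mem_filter.1 hv).2) (hN0B.trans (Finset.filter_subset _ _)) hM0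
    (by
      intro f hf c
      obtain ⟨E, h1, h2, h3, h4⟩ := hB f hf c
      exact ⟨E, Finset.mem_filter.2 ⟨Finset.mem_univ _, f, hf, c, h1⟩, h1, fun hmem =>
        h2 (Finset.mem_filter.1 hmem).2.2⟩)
    (by
      refine le_trans ?_ hY
      have : N0.card + Sp.card ≤ 10 * t := by omega
      exact_mod_cast this)
  have h2' : (J.card : ℝ) ≤ Sp.card := by exact_mod_cast (by omega : J.card ≤ Sp.card)
  rw [Nat.cast_add, hN0c] at this
  linarith

open Classical in
/-- From special vertices to the extremal structure. -/
lemma final_count {sp : Fin 3 → Fin m → Prop} {Rg : Finset (Fin m)} {k t : ℕ} {δ : ℝ}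
    (hinj : ∀ c E F, e E c = e F c → E = F) (hRg : Rg.card ≤ k)
    (hw : ∀ c, (1 / 3 - δ) * m ≤ (((Finset.univ.filter (fun E => sp c E)).card : ℕ) : ℝ))
    (h2 : (Finset.univ.filter (fun E => E ∉ Rg ∧ 2 ≤ (Finset.univ.filter (fun c => sp c E)).card)).card ≤ t)
    (hB : (H.filter (fun f => ∀ c, ∃ E, f c = e E c ∧ ¬ sp c E ∧ E ∉ Rg ∧ ∃ c', sp c' E)).card ≤
      3 * t * n ^ 2) :
    ∃ Z : Fin 3 → Finset (Fin n),
      (∀ c, (n : ℝ) - (1 / 3 + 2 * δ) * m - 2 * (t + k) ≤ (((Z c).card : ℕ) : ℝ)) ∧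
      (∀ c, (((Z c).card : ℕ) : ℝ) ≤ n - (1 / 3 - δ) * m) ∧
      (((H.filter (fun f => ∀ i, f i ∈ Z i)).card : ℕ) : ℝ) ≤
        (3 * ((n - m) + k + (3 * δ * m + 2 * (t + k))) + 3 * t) * (n : ℝ) ^ 2 := by
  set s : Fin m → ℕ := fun E => (Finset.univ.filter (fun c => sp c E)).card with hs
  set T2 := Finset.univ.filter (fun E => E ∉ Rg ∧ 2 ≤ s E) with hT2
  set Nul := Finset.univ.filter (fun E => s E = 0) with hNul
  set w : Fin 3 → ℕ := fun c => (Finset.univ.filter (fun E => sp c E)).card with hwdef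
  have hsum : ∑ c, w c = ∑ E, s E := by
    simp only [hwdef, hs, Finset.card_filter]
    exact Finset.sum_comm
  have hpt : ∀ E, s E + (if s E = 0 then 1 else 0) ≤ 1 + 2 * (if E ∈ T2 ∪ Rg then 1 else 0) := by
    intro E
    have h3 : s E ≤ 3 := (Finset.card_le_univ _).trans (by simp)
    by_cases hE : E ∈ T2 ∪ Rg
    · rw [if_pos hE]
      split_ifs <;> omega
    · rw [if_neg hE]
      have : ¬ 2 ≤ s E := by
        intro h
        apply hE
        by_cases hR : E ∈ Rg
        · exact Finset.mem_union_right _ hR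
        · exact Finset.mem_union_left _ (Finset.mem_filter.2 ⟨Finset.mem_univ _, hR, h⟩)
      split_ifs <;> omega
  have htot : ∑ E, s E + Nul.card ≤ m + 2 * (t + k) := by
    have h1 := Finset.sum_le_sum (fun E (_ : E ∈ Finset.univ) => hpt E)
    rw [Finset.sum_add_distrib, Finset.sum_add_distrib, ← Finset.mul_sum] at h1
    rw [← Finset.card_filter, ← Finset.card_filter] at h1
    have h4 : (Finset.univ.filter (fun E => E ∈ T2 ∪ Rg)).card ≤ t + k := by
      have : (Finset.univ.filter (fun E => E ∈ T2 ∪ Rg)) = T2 ∪ Rg := by ext; simp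
      rw [this]
      exact (Finset.card_union_le _ _).trans (add_le_add h2 hRg)
    simp only [Finset.sum_const, Finset.card_univ, Fintype.card_fin, smul_eq_mul, mul_one] at h1
    have : (Finset.univ.filter (fun E => s E = 0)).card = Nul.card := rfl
    omega
  have htot' : ((w 0 : ℕ) : ℝ) + (w 1 : ℕ) + (w 2 : ℕ) + (Nul.card : ℝ) ≤ m + 2 * (t + k) := by
    rw [← hsum, Fin.sum_univ_three] at htot
    exact_mod_cast htot
  have w0 := hw 0
  have w1 := hw 1
  have w2 := hw 2
  have hNul0 : (0 : ℝ) ≤ Nul.card := Nat.cast_nonneg _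
  have e0 : (((Finset.univ.filter (fun E => sp 0 E)).card : ℕ) : ℝ) = (w 0 : ℕ) := rfl
  have e1 : (((Finset.univ.filter (fun E => sp 1 E)).card : ℕ) : ℝ) = (w 1 : ℕ) := rfl
  have e2 : (((Finset.univ.filter (fun E => sp 2 E)).card : ℕ) : ℝ) = (w 2 : ℕ) := rfl
  rw [e0] at w0
  rw [e1] at w1
  rw [e2] at w2
  have hwu : ∀ c, ((w c : ℕ) : ℝ) ≤ (1 / 3 + 2 * δ) * m + 2 * (t + k) := by
    intro c
    fin_cases c
    · show ((w 0 : ℕ) : ℝ) ≤ _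
      linarith
    · show ((w 1 : ℕ) : ℝ) ≤ _
      linarith
    · show ((w 2 : ℕ) : ℝ) ≤ _
      linarith
  have hnul : (Nul.card : ℝ) ≤ 3 * δ * m + 2 * (t + k) := by linarith
  have hZc : ∀ c, (((((Finset.univ.filter (fun E => sp c E)).image (fun E => e E c))ᶜ).card : ℕ) : ℝ) =
      n - (w c : ℕ) := by
    intro c
    have h1 := Finset.card_add_card_compl ((Finset.univ.filter (fun E => sp c E)).image (fun E => e E c))
    rw [Finset.card_image_of_injective _ (fun E F h => hinj c E F h), Fintype.card_fin] at h1
    have h1' : ((w c : ℕ) : ℝ) + (((((Finset.univ.filter (fun E => sp c E)).image (fun E => e E c))ᶜ).card : ℕ) : ℝ) = n := by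
      exact_mod_cast h1
    linarith
  refine ⟨fun c => ((Finset.univ.filter (fun E => sp c E)).image (fun E => e E c))ᶜ, ?_, ?_, ?_⟩
  · intro c
    rw [hZc]
    linarith [hwu c]
  · intro c
    rw [hZc]
    have := hw c
    have : (1 / 3 - δ) * (m : ℝ) ≤ (w c : ℕ) := this
    linarith
  · set HZ := H.filter (fun f => ∀ i, f i ∈ ((Finset.univ.filter (fun E => sp i E)).image (fun E => e E i))ᶜ) with hHZ
    set BB := H.filter (fun f => ∀ c, ∃ E, f c = e E c ∧ ¬ sp c E ∧ E ∉ Rg ∧ ∃ c', sp c' E) with hBB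
    set U : Fin 3 → Finset (Fin n) := fun c =>
      (Finset.univ.image (fun E => e E c))ᶜ ∪ (Rg ∪ Nul).image (fun E => e E c) with hU
    have hmn : m ≤ n := by
      have := Finset.card_le_univ ((Finset.univ : Finset (Fin m)).image (fun E => e E 0))
      rw [Finset.card_image_of_injective _ (fun E F h => hinj 0 E F h)] at this
      simpa using this
    have hUc : ∀ c, (U c).card ≤ (n - m) + (k + Nul.card) := by
      intro c
      refine (Finset.card_union_le _ _).trans (add_le_add ?_ ?_)
      · rw [Finset.card_compl, Finset.card_image_of_injective _ (fun E F h => hinj c E F h)]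
        simp
      · exact Finset.card_image_le.trans ((Finset.card_union_le _ _).trans (by omega))
    have hrest : (HZ.filter (fun f => ¬ f ∈ BB)).card ≤ 3 * ((n - m) + (k + Nul.card)) * n ^ 2 := by
      apply card_hit_le _ U _ hUc
      intro f hf
      obtain ⟨h1, h3⟩ := Finset.mem_filter.1 hf
      obtain ⟨hfH, hfZ⟩ := Finset.mem_filter.1 h1
      by_contra hcon
      push Not at hcon
      apply h3
      refine Finset.mem_filter.2 ⟨hfH, fun c => ?_⟩
      have hc := hcon c
      rw [hU, Finset.mem_union, not_or, Finset.mem_compl, not_not] at hc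
      obtain ⟨ha, hb⟩ := hc
      obtain ⟨E, -, hE⟩ := Finset.mem_image.1 ha
      have hEn : E ∉ Rg ∪ Nul := fun hE' => hb (Finset.mem_image.2 ⟨E, hE', hE⟩)
      rw [Finset.mem_union, not_or] at hEn
      refine ⟨E, hE.symm, ?_, hEn.1, ?_⟩
      · intro hsp
        exact (Finset.mem_compl.1 (hfZ c)) (Finset.mem_image.2 ⟨E, Finset.mem_filter.2
          ⟨Finset.mem_univ _, hsp⟩, hE⟩)
      · have : s E ≠ 0 := fun h0 => hEn.2 (Finset.mem_filter.2 ⟨Finset.mem_univ _, h0⟩)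
        obtain ⟨c', hc'⟩ := Finset.card_pos.1 (Nat.pos_of_ne_zero this)
        exact ⟨c', (Finset.mem_filter.1 hc').2⟩
    have hsplit := Finset.card_filter_add_card_filter_not (s := HZ) (fun f => f ∈ BB)
    have hin : (HZ.filter (fun f => f ∈ BB)).card ≤ BB.card :=
      Finset.card_le_card (fun f hf => (Finset.mem_filter.1 hf).2)
    have htotal : HZ.card ≤ 3 * t * n ^ 2 + 3 * ((n - m) + (k + Nul.card)) * n ^ 2 := by omega
    have hcast : ((HZ.card : ℕ) : ℝ) ≤ 3 * t * (n : ℝ) ^ 2 + 3 * (((n : ℝ) - m) + (k + Nul.card)) * (n : ℝ) ^ 2 := by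
      have := (Nat.cast_le (α := ℝ)).2 htotal
      push_cast [Nat.cast_sub hmn] at this
      exact this
    have hn2 : (0 : ℝ) ≤ (n : ℝ) ^ 2 := by positivity
    have := mul_le_mul_of_nonneg_right hnul hn2
    refine (le_of_eq ?_).trans (hcast.trans ?_)
    · congr!
    · linarith

end PM

namespace PM

variable {n m k : ℕ} {H : Finset (Fin 3 → Fin n)} {e : Fin m → Fin 3 → Fin n}
  {L : Fin 3 → Finset (Fin n)}

open Classical in
lemma w_lower {θ ε η : ℝ} {ι : Fin k → Fin m} {W : Fin 3 → Finset (Fin k)} (hk : 0 < k) (hε : 0 < ε)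
    (hη : η ≤ ε / 10)
    (hW : ∀ c, (2 / 3 - 100 * ε) * k ≤ (((W c).card : ℕ) : ℝ) ∧
        (((W c).card : ℕ) : ℝ) ≤ (2 / 3 + 200 * ε) * k) (c : Fin 3)
    (hF : (5 / 9 - 2 * η) * k * m ≤
        ∑ y : Fin k, (((Finset.univ.filter (fun E => Gd H e L θ c E (ι y))).card : ℕ) : ℝ)) :
    (1 / 3 - 80000 * ε) * m ≤ (((Finset.univ.filter (fun E =>
      50000 * ε * k ≤ ((nb H e L θ ι W c E).card : ℝ))).card : ℕ) : ℝ) := by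
  have hk0 : (0 : ℝ) < k := by exact_mod_cast hk
  have hm0 : (0 : ℝ) ≤ m := Nat.cast_nonneg _
  set d : Fin k → ℝ := fun y => (((Finset.univ.filter (fun E => Gd H e L θ c E (ι y))).card : ℕ) : ℝ) with hd
  set Sx := Finset.univ.filter (fun E => 50000 * ε * k ≤ ((nb H e L θ ι W c E).card : ℝ)) with hSx
  have hsplit : ∑ y : Fin k, d y = ∑ y ∈ W (c + 1), d y + ∑ y ∈ (W (c + 1))ᶜ, d y :=
    (Finset.sum_add_sum_compl _ _).symm
  have hout : ∑ y ∈ (W (c + 1))ᶜ, d y ≤ (1 / 3 + 100 * ε) * k * m := by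
    have h1 : ∑ y ∈ (W (c + 1))ᶜ, d y ≤ ((W (c + 1))ᶜ).card • (m : ℝ) := by
      apply Finset.sum_le_card_nsmul
      intro y _
      have : (Finset.univ.filter (fun E => Gd H e L θ c E (ι y))).card ≤ m :=
        (Finset.card_le_univ _).trans (by simp)
      exact Nat.cast_le.2 this
    rw [nsmul_eq_mul] at h1
    refine h1.trans (mul_le_mul_of_nonneg_right ?_ hm0)
    have h2 := Finset.card_add_card_compl (W (c + 1))
    rw [Fintype.card_fin] at h2
    have h2' : (((W (c + 1)).card : ℕ) : ℝ) + ((((W (c + 1))ᶜ).card : ℕ) : ℝ) = k := by exact_mod_cast h2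
    have := (hW (c + 1)).1
    linarith
  have hsw : ∑ y ∈ W (c + 1), d y = ∑ E, ((nb H e L θ ι W c E).card : ℝ) := by
    have : ∑ y ∈ W (c + 1), (Finset.univ.filter (fun E => Gd H e L θ c E (ι y))).card =
        ∑ E, (nb H e L θ ι W c E).card := by
      unfold nb
      simp only [Finset.card_filter]
      exact Finset.sum_comm
    simp only [hd]
    exact_mod_cast this
  have hin : ∑ E, ((nb H e L θ ι W c E).card : ℝ) ≤ (Sx.card : ℝ) * ((2 / 3 + 200 * ε) * k) +
      m * (50000 * ε * k) := by
    rw [← Finset.sum_add_sum_compl Sx]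
    apply add_le_add
    · rw [← nsmul_eq_mul]
      apply Finset.sum_le_card_nsmul
      intro E _
      refine le_trans ?_ (hW (c + 1)).2
      exact_mod_cast Finset.card_le_card (Finset.filter_subset _ _)
    · have h1 : ∑ E ∈ Sxᶜ, ((nb H e L θ ι W c E).card : ℝ) ≤ (Sxᶜ).card • (50000 * ε * k) := by
        apply Finset.sum_le_card_nsmul
        intro E hE
        have := Finset.mem_compl.1 hE
        by_contra hcon
        push Not at hcon
        exact this (Finset.mem_filter.2 ⟨Finset.mem_univ _, hcon.le⟩)
      rw [nsmul_eq_mul] at h1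
      refine h1.trans (mul_le_mul_of_nonneg_right ?_ (by positivity))
      have : (Sxᶜ).card ≤ m := (Finset.card_le_univ _).trans (by simp)
      exact_mod_cast this
  have hSm : (Sx.card : ℝ) ≤ m := by
    have : Sx.card ≤ m := (Finset.card_le_univ _).trans (by simp)
    exact_mod_cast this
  have hall : (5 / 9 - 2 * η) * k * m ≤ (Sx.card : ℝ) * ((2 / 3 + 200 * ε) * k) +
      m * (50000 * ε * k) + (1 / 3 + 100 * ε) * k * m := by
    have : ∑ y : Fin k, d y ≤ (Sx.card : ℝ) * ((2 / 3 + 200 * ε) * k) +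
      m * (50000 * ε * k) + (1 / 3 + 100 * ε) * k * m := by
      rw [hsplit, hsw]; linarith
    exact hF.trans this
  have hdiv : (5 / 9 - 2 * η) * m ≤ (Sx.card : ℝ) * (2 / 3 + 200 * ε) +
      m * (50000 * ε) + (1 / 3 + 100 * ε) * m := by
    by_contra hcon
    push Not at hcon
    have := mul_lt_mul_of_pos_right hcon hk0
    linarith
  have a1 : η * m ≤ ε / 10 * m := mul_le_mul_of_nonneg_right hη hm0
  have a2 : ε * (Sx.card : ℝ) ≤ ε * m := mul_le_mul_of_nonneg_left hSm hε.le
  have a3 : 0 ≤ ε * m := by positivity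
  linarith

/-- In a locally optimal situation the hypergraph is extremal, hence has a perfect matching. -/
theorem setup_pm (hn : 10 ^ 30 ≤ n) (hthr : ∀ (c : Fin 3) (x : Fin n), threshold9 n < 9 * deg3 H c x)
    (hs : Setup H e L) (r : ℕ) (hr : 0 < r) (hLr : ∀ c, (L c).card = r)
    (hmn : (n : ℝ) - m ≤ 1 / 10 ^ 20 * n)
    (hkr : 4 * (k : ℝ) + 4 ≤ 1 / (4 * 10 ^ 17) * r) (hk : (10 : ℝ) ^ 34 ≤ k)
    (hkm : (k : ℝ) * (1 / m) ≤ (1 / 10 ^ 17) ^ 2 / 32)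
    (hexp : (3 * m + 3 : ℝ) < Real.exp ((1 / 10 ^ 17) ^ 2 * k / 8)) :
    ∃ M ⊆ H, IsM M ∧ M.card = n := by
  classical
  have hnR : (10 : ℝ) ^ 30 ≤ n := by exact_mod_cast hn
  have hn0 : (0 : ℝ) < n := by linarith [show (0 : ℝ) < 10 ^ 30 by norm_num]
  have hmle : m ≤ n := by
    have := Finset.card_le_univ ((Finset.univ : Finset (Fin m)).image (fun E => e E 0))
    rw [Finset.card_image_of_injective _ (fun E F h => hs.inj 0 E F h)] at this
    simpa using this
  have hmleR : (m : ℝ) ≤ n := by exact_mod_cast hmle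
  have hm0 : (0 : ℝ) < m := by linarith
  have hm0' : 0 < m := by exact_mod_cast hm0
  have hdeg := fun c x => deg_lower (by omega : 2 ≤ n) H hthr c x
  set τ : ℝ := 1 / (4 * 10 ^ 17) with hτ
  set η : ℝ := 1 / 10 ^ 17 with hη
  set ε : ℝ := 1 / 10 ^ 16 with hε
  have hε0 : 0 < ε := by rw [hε]; positivity
  set θ : ℝ := τ * r with hθ
  have hden : ∀ c, (5 / 9 - η) * (m : ℝ) ^ 2 ≤
      (((Finset.univ.filter (fun p : Fin m × Fin m => Gd H e L θ c p.1 p.2)).card : ℕ) : ℝ) := by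
    intro c
    refine le_trans ?_ (density hs r hr hLr hdeg τ (by rw [hτ]; positivity) c)
    have b1 : (n : ℝ) ≤ η / 8 * (n : ℝ) ^ 2 := by
      have : (1 : ℝ) ≤ η / 8 * n := by rw [hη]; linarith
      calc (n : ℝ) = 1 * n := by ring
        _ ≤ η / 8 * n * n := mul_le_mul_of_nonneg_right this hn0.le
        _ = _ := by ring
    have b2 : ((n : ℝ) - m) * n ≤ η / 1000 * (n : ℝ) ^ 2 := by
      calc ((n : ℝ) - m) * n ≤ (1 / 10 ^ 20 * n) * n := mul_le_mul_of_nonneg_right hmn hn0.le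
        _ = η / 1000 * (n : ℝ) ^ 2 := by rw [hη]; ring
    have b3 : (n : ℝ) ^ 2 ≤ 2 * (m : ℝ) ^ 2 := by
      have : (0.9 : ℝ) * n ≤ m := by linarith
      have h := mul_self_le_mul_self (by positivity) this
      linarith
    have b4 : (m : ℝ) ^ 2 ≤ (n : ℝ) ^ 2 := by
      have h := mul_self_le_mul_self hm0.le hmleR
      linarith
    have b5 : τ = η / 4 := by rw [hτ, hη]; ring
    have hη0 : 0 < η := by rw [hη]; positivity
    have b6 := mul_le_mul_of_nonneg_left b3 hη0.le
    rw [b5]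
    linarith
  obtain ⟨ι, hι, hF2, hF3⟩ := sample_A (fun c E F => Gd H e L θ c E F) η (by rw [hη]; positivity)
    (by rw [hη]; norm_num) hm0' hden hkm hexp
  have hk0 : (0 : ℝ) < k := lt_of_lt_of_le (by norm_num) hk
  have hk0' : 0 < k := by exact_mod_cast hk0
  have hk100 : 100 ≤ k := by
    have : (100 : ℝ) ≤ k := le_trans (by norm_num) hk
    exact_mod_cast this
  obtain ⟨W, hW1, hW2, hW3⟩ := structure_lemma k ε hε0 (by rw [hε]; norm_num)
    (le_trans (by rw [hε]; norm_num) hk) (fun c x y => Gd H e L θ c (ι x) (ι y))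
    (fun c => le_trans (mul_le_mul_of_nonneg_right (by rw [hε, hη]; norm_num) (by positivity)) (hF3 c))
    (fun I a a' h1 h2 h3 h4 => no_match hs ι hι (θ := θ) (by linarith) I a a' h1 h2 h3 h4)
  set sp : Fin 3 → Fin m → Prop := fun c E => 50000 * ε * k ≤ ((nb H e L θ ι W c E).card : ℝ) with hsp
  set Rg : Finset (Fin m) := Finset.univ.image ι with hRg
  have hεk : ε * k = 1 / 10 ^ 16 * k := by rw [hε]
  have hNI : NI H e sp Rg (3600 * ε * k) (50000 * ε * k) := by
    intro J Sp N0 hJ hSp hN0H hN0 hN0J hD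
    exact improve_bound hs hι (ε := ε) (θ := θ) hε0 (by rw [hε]; norm_num) hk100 (by linarith) hW1 hW3
      (50000 * ε * k) (by linarith) J
      (fun y hy => hJ _ hy (Finset.mem_image.2 ⟨y, Finset.mem_univ _, rfl⟩)) Sp hSp N0 hN0H hN0 hN0J hD
  obtain ⟨t, ht1, ht2⟩ : ∃ t : ℕ, 4000 * (ε * k) ≤ (t : ℝ) ∧ (t : ℝ) < 4000 * (ε * k) + 1 :=
    ⟨⌈4000 * (ε * k)⌉₊, Nat.le_ceil _, Nat.ceil_lt_add_one (by positivity)⟩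
  have hεk1 : 1 ≤ ε * k := by
    rw [hεk]
    exact le_trans (by norm_num) (mul_le_mul_of_nonneg_left hk (by norm_num))
  have hX : 3600 * ε * k < (t : ℝ) := by linarith
  have hY : (10 * t : ℝ) ≤ 50000 * ε * k := by linarith
  have hRgc : Rg.card ≤ k := Finset.card_image_le.trans (by simp)
  obtain ⟨Z, hZ1, hZ2, hZ3⟩ := final_count (H := H) (e := e) (sp := sp) (Rg := Rg) (k := k) (t := t)
    (δ := 80000 * ε) hs.inj hRgc
    (fun c => w_lower hk0' hε0 (by rw [hε, hη]; norm_num) hW1 c (hF2 c))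
    (two_lt hNI t hX hY).le (B_card hs.inj hNI t hX hY)
  have hkm' : (k : ℝ) ≤ 1 / 10 ^ 30 * n := by
    rw [mul_one_div, div_le_iff₀ hm0] at hkm
    have : η ^ 2 / 32 * (m : ℝ) ≤ 1 / 10 ^ 30 * n := by
      refine mul_le_mul ?_ hmleR hm0.le (by norm_num)
      rw [hη]; norm_num
    linarith only [this, hkm]
  have hεm : ε * m = 1 / 10 ^ 16 * m := by rw [hε]
  have htk : (t : ℝ) ≤ k := by
    have h1 : (t : ℝ) ≤ 4001 * (ε * k) := by linarith only [ht2, hεk1]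
    rw [hεk] at h1
    linarith only [h1, hk0]
  have hεm' : ε * m ≤ 1 / 10 ^ 16 * n := by
    rw [hεm]; exact mul_le_mul_of_nonneg_left hmleR (by norm_num)
  apply extremal_pm (le_trans (by norm_num) hn) H Z
  · intro c
    refine le_trans ?_ (hZ1 c)
    linarith only [hεm', hmleR, htk, hkm', hn0]
  · intro c
    refine (hZ2 c).trans ?_
    linarith
  · refine le_trans (le_of_eq ?_) (hZ3.trans ?_)
    · congr!
    · have : (3 * (((n : ℝ) - m) + k + (3 * (80000 * ε) * m + 2 * (t + k))) + 3 * t) ≤ 1 / 10 ^ 9 * n := by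
        linarith only [hεm', hmn, htk, hkm', hn0]
      calc _ ≤ 1 / 10 ^ 9 * n * (n : ℝ) ^ 2 := mul_le_mul_of_nonneg_right this (by positivity)
        _ = _ := by ring
  · exact hthr

end PM

namespace PM

lemma extend_one {n : ℕ} (Q : Fin 3 → Finset (Fin n)) (q : ℕ) (hQ : ∀ c, (Q c).card = q)
    (N : Finset (Fin 3 → Fin n)) (hN : IsM N) (hNQ : ∀ f ∈ N, ∀ c, f c ∉ Q c) (h : N.card + q < n) :
    ∃ g : Fin 3 → Fin n, (∀ f ∈ N, ∀ i, g i ≠ f i) ∧ ∀ c, g c ∉ Q c := by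
  classical
  have hex : ∀ c, ∃ x : Fin n, x ∉ Q c ∪ used N c := by
    intro c
    by_contra hcon
    push Not at hcon
    have h1 : (Finset.univ : Finset (Fin n)) ⊆ Q c ∪ used N c := fun x _ => hcon x
    have h2 := Finset.card_le_card h1
    have h3 := Finset.card_union_le (Q c) (used N c)
    have h4 := card_used_le N c
    have h5 := hQ c
    simp only [Finset.card_univ, Fintype.card_fin] at h2
    omega
  choose g hg using hex
  refine ⟨g, fun f hf i heq => ?_, fun c hc => hg c (Finset.mem_union_left _ hc)⟩
  exact hg i (Finset.mem_union_right _ (by rw [heq]; exact mem_used hf i))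

lemma extend_to {n : ℕ} (Q : Fin 3 → Finset (Fin n)) (q : ℕ) (hQ : ∀ c, (Q c).card = q)
    (N : Finset (Fin 3 → Fin n)) (hN : IsM N) (hNQ : ∀ f ∈ N, ∀ c, f c ∉ Q c) :
    ∀ d : ℕ, N.card + d + q ≤ n → ∃ N', N ⊆ N' ∧ IsM N' ∧ (∀ f ∈ N', ∀ c, f c ∉ Q c) ∧
      N'.card = N.card + d := by
  classical
  intro d
  induction d with
  | zero => intro _; exact ⟨N, Finset.Subset.refl _, hN, hNQ, rfl⟩
  | succ d ih =>
    intro h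
    obtain ⟨N1, h1, h2, h3, h4⟩ := ih (by omega)
    obtain ⟨g, hg1, hg2⟩ := extend_one Q q hQ N1 h2 h3 (by omega)
    refine ⟨insert g N1, h1.trans (Finset.subset_insert _ _), h2.insert hg1, ?_, ?_⟩
    · intro f hf
      rcases Finset.mem_insert.1 hf with h | h
      · rw [h]; exact hg2
      · exact h3 f h
    · rw [Finset.card_insert_of_notMem (fun hm => hg1 g hm 0 rfl)]
      omega

/-- Either there is a large matching avoiding `Q`, or we are in a locally optimal situation. -/
lemma core {n : ℕ} (H : Finset (Fin 3 → Fin n)) (Q : Fin 3 → Finset (Fin n)) (q r m : ℕ)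
    (hQ : ∀ c, (Q c).card = q) (hm : m + q + r = n) :
    (∃ N ⊆ H, IsM N ∧ (∀ f ∈ N, ∀ c, f c ∉ Q c) ∧ m ≤ N.card) ∨
    (∃ (e : Fin m → Fin 3 → Fin n) (L : Fin 3 → Finset (Fin n)), Setup H e L ∧ ∀ c, (L c).card = r) := by
  classical
  obtain ⟨N, hN, hmax⟩ := Finset.exists_max_image
    (H.powerset.filter (fun N => IsM N ∧ (∀ f ∈ N, ∀ c, f c ∉ Q c)))
    (fun N => N.card) ⟨∅, Finset.mem_filter.2 ⟨by simp, by simp [IsM], by simp⟩⟩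
  obtain ⟨hNH, hNM, hNQ⟩ := Finset.mem_filter.1 hN
  have hNH := Finset.mem_powerset.1 hNH
  by_cases hc : m ≤ N.card
  · exact Or.inl ⟨N, hNH, hNM, hNQ, hc⟩
  right
  push Not at hc
  obtain ⟨N', hNN', hM', hQ', hcard⟩ := extend_to Q q hQ N hNM hNQ (m - N.card) (by omega)
  have hcard : N'.card = m := by omega
  set eq := Finset.equivFinOfCardEq hcard with heq
  set e : Fin m → Fin 3 → Fin n := fun E => (eq.symm E).1 with he
  have heN : ∀ E, e E ∈ N' := fun E => (eq.symm E).2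
  have hinj : ∀ c E F, e E c = e F c → E = F := by
    intro c E F h
    by_contra hne
    have hne' : e E ≠ e F := by
      intro h'
      apply hne
      exact eq.symm.injective (Subtype.ext h')
    exact hM' _ (heN E) _ (heN F) hne' c h
  refine ⟨e, fun c => (Q c ∪ used N' c)ᶜ, ⟨hinj, ?_, ?_⟩, ?_⟩
  · intro c E hE
    exact Finset.mem_compl.1 hE (Finset.mem_union_right _ (mem_used (heN E) c))
  · intro S P hPH hPM hP
    by_contra hcon
    push Not at hcon
    set N1 := N.filter (fun f => f ∉ S.image e) with hN1
    have hdisj : ∀ f ∈ N1, ∀ p ∈ P, ∀ i, f i ≠ p i := by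
      intro f hf p hp i heq'
      obtain ⟨hfN, hfS⟩ := Finset.mem_filter.1 hf
      rcases hP p hp i with h | ⟨E, hE, h⟩
      · rw [← heq'] at h
        exact Finset.mem_compl.1 h (Finset.mem_union_right _ (mem_used (hNN' hfN) i))
      · rw [← heq'] at h
        apply hfS
        refine Finset.mem_image.2 ⟨E, hE, ?_⟩
        by_contra hne
        exact hM' _ (heN E) _ (hNN' hfN) hne i h.symm
    have hd : Disjoint N1 P := by
      rw [Finset.disjoint_left]
      intro f hf hp
      exact hdisj f hf f hp 0 rfl
    have hU : IsM (N1 ∪ P) := (hNM.mono (Finset.filter_subset _ _)).union hPM hdisj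
    have hUQ : ∀ f ∈ N1 ∪ P, ∀ c, f c ∉ Q c := by
      intro f hf c hfc
      rcases Finset.mem_union.1 hf with h | h
      · exact hNQ f (Finset.mem_filter.1 h).1 c hfc
      · rcases hP f h c with h' | ⟨E, hE, h'⟩
        · exact Finset.mem_compl.1 h' (Finset.mem_union_left _ hfc)
        · rw [h'] at hfc
          exact hQ' _ (heN E) c hfc
    have := hmax (N1 ∪ P) (Finset.mem_filter.2 ⟨Finset.mem_powerset.2 (Finset.union_subset
      ((Finset.filter_subset _ _).trans hNH) hPH), hU, hUQ⟩)
    rw [Finset.card_union_of_disjoint hd] at this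
    have hsub : N ⊆ N1 ∪ S.image e := by
      intro f hf
      by_cases h : f ∈ S.image e
      · exact Finset.mem_union_right _ h
      · exact Finset.mem_union_left _ (Finset.mem_filter.2 ⟨hf, h⟩)
    have h1 := Finset.card_le_card hsub
    have h2 := Finset.card_union_le N1 (S.image e)
    have h3 : (S.image e).card ≤ S.card := Finset.card_image_le
    omega
  · intro c
    rw [Finset.card_compl, Finset.card_union_of_disjoint, hQ, card_used hM', hcard, Fintype.card_fin]
    · omega
    · rw [Finset.disjoint_left]
      intro x hx hu
      obtain ⟨f, hf, hfx⟩ := Finset.mem_image.1 hu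
      exact hQ' f hf c (by rw [hfx]; exact hx)

end PM

namespace PM

set_option exponentiation.threshold 1000 in
lemma exp_big (n : ℕ) (hn : 10 ^ 320 ≤ n) : (n : ℝ) ^ 3 < Real.exp (n / 10 ^ 78) := by
  have hnR : (10 : ℝ) ^ 320 ≤ n := by exact_mod_cast hn
  have hn0 : (0 : ℝ) < n := lt_of_lt_of_le (by norm_num) hnR
  have h := Real.pow_div_factorial_le_exp ((n : ℝ) / 10 ^ 78) (by positivity) 4
  refine lt_of_lt_of_le ?_ h
  have h4 : ((Nat.factorial 4 : ℕ) : ℝ) = 24 := by norm_num [Nat.factorial]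
  rw [h4]
  have e1 : ((n : ℝ) / 10 ^ 78) ^ 4 / 24 = (n : ℝ) ^ 3 * (n * (1 / (24 * 10 ^ 312))) := by
    rw [div_pow, ← pow_mul]; ring
  rw [e1]
  have h2 : (1 : ℝ) < n * (1 / (24 * 10 ^ 312)) := by
    rw [mul_one_div, lt_div_iff₀ (by positivity)]
    exact lt_of_lt_of_le (by norm_num) hnR
  exact lt_mul_of_one_lt_right (by positivity) h2

lemma nat_div_lower (n d : ℕ) (hd : 0 < d) : (n : ℝ) / d - 1 ≤ ((n / d : ℕ) : ℝ) := by
  have h := Nat.lt_div_mul_add (a := n) hd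
  have h' : (n : ℝ) < ((n / d : ℕ) : ℝ) * d + d := by exact_mod_cast h
  have hd' : (0 : ℝ) < d := by exact_mod_cast hd
  rw [sub_le_iff_le_add, div_le_iff₀ hd']
  linarith

set_option exponentiation.threshold 1000 in
theorem main_pm {n : ℕ} (hn : 10 ^ 320 ≤ n) (H : Finset (Fin 3 → Fin n))
    (hthr : ∀ (c : Fin 3) (x : Fin n), threshold9 n < 9 * deg3 H c x) :
    ∃ M ⊆ H, IsM M ∧ M.card = n := by
  classical
  have hnR : (10 : ℝ) ^ 320 ≤ n := by exact_mod_cast hn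
  have hn0 : (0 : ℝ) < n := lt_of_lt_of_le (by norm_num) hnR
  have hn100 : (10 : ℝ) ^ 100 ≤ n := le_trans (by norm_num) hnR
  have hn30 : 10 ^ 30 ≤ n := le_trans (by norm_num) hn
  have hn6000 : 6000 ≤ n := le_trans (by norm_num) hn
  have hdeg := fun c x => deg_lower (by omega : 2 ≤ n) H hthr c x
  have hδ : ∀ c x, (0.55 : ℝ) * n ^ 2 ≤ deg3 H c x := by
    intro c x
    refine le_trans ?_ (hdeg c x)
    have : (1000 : ℝ) * n ≤ n * n := mul_le_mul_of_nonneg_right (by linarith only [hn100]) hn0.le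
    linarith only [this]
  obtain ⟨K, hKdef⟩ : ∃ K, K = n / 10 ^ 21 := ⟨_, rfl⟩
  obtain ⟨r, hrdef⟩ : ∃ r, r = K / 400 := ⟨_, rfl⟩
  obtain ⟨k, hkdef⟩ : ∃ k, k = r / (32 * 10 ^ 17) := ⟨_, rfl⟩
  have hK1 : (K : ℝ) ≤ n / 10 ^ 21 := by
    rw [hKdef]; exact_mod_cast Nat.cast_div_le (α := ℝ) (m := n) (n := 10 ^ 21)
  have hK2 : (n : ℝ) / 10 ^ 21 - 1 ≤ K := by
    rw [hKdef]; exact_mod_cast nat_div_lower n (10 ^ 21) (by norm_num)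
  have hr1 : (r : ℝ) ≤ K / 400 := by
    rw [hrdef]; exact_mod_cast Nat.cast_div_le (α := ℝ) (m := K) (n := 400)
  have hr2 : (K : ℝ) / 400 - 1 ≤ r := by
    rw [hrdef]; exact_mod_cast nat_div_lower K 400 (by norm_num)
  have hk1 : (k : ℝ) ≤ r / (32 * 10 ^ 17) := by
    rw [hkdef]; exact_mod_cast Nat.cast_div_le (α := ℝ) (m := r) (n := 32 * 10 ^ 17)
  have hk2 : (r : ℝ) / (32 * 10 ^ 17) - 1 ≤ k := by
    rw [hkdef]; exact_mod_cast nat_div_lower r (32 * 10 ^ 17) (by norm_num)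
  clear hKdef hrdef hkdef
  have hexp := exp_big n hn
  obtain ⟨A, hAc, hAconf, hAabs⟩ := absorb_exists hn6000 H hδ K
    (by
      rw [mul_div_assoc', div_le_iff₀ hn0]
      linarith only [hK1, hn0])
    (by
      refine lt_of_lt_of_le hexp (Real.exp_le_exp.2 ?_)
      linarith only [hK2, hn100])
  set V := A.filter (fun ω => ω.1 ∈ H ∧ ω.2 ∈ H ∧ ∀ i, ω.1 i ≠ ω.2 i) with hV
  have hVA : V ⊆ A := Finset.filter_subset _ _
  have hVp : ∀ ω ∈ V, ω.1 ∈ H ∧ ω.2 ∈ H ∧ ∀ i, ω.1 i ≠ ω.2 i := fun ω hω => (Finset.mem_filter.1 hω).2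
  have hVconf : ∀ a ∈ V, ∀ b ∈ V, a ≠ b → ¬ Conf a b := fun a ha b hb => hAconf a (hVA ha) b (hVA hb)
  have hVabs : ∀ T, r ≤ (V.filter (fun ω => Absorbs H ω T)).card := by
    intro T
    have h1 : A.filter (fun ω => Absorbs H ω T) ⊆ V.filter (fun ω => Absorbs H ω T) := by
      intro ω hω
      obtain ⟨h2, h3⟩ := Finset.mem_filter.1 hω
      exact Finset.mem_filter.2 ⟨Finset.mem_filter.2 ⟨h2, h3.1, h3.2.1, h3.2.2.1⟩, h3⟩
    have h2 := Finset.card_le_card h1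
    have h3 : ((A.filter (fun ω => Absorbs H ω T)).card : ℝ) ≤
      ((V.filter (fun ω => Absorbs H ω T)).card : ℝ) := by exact_mod_cast h2
    have h4 := hAabs T
    have h5 : (r : ℝ) ≤ ((V.filter (fun ω => Absorbs H ω T)).card : ℝ) := by
      refine le_trans ?_ h3
      refine le_trans ?_ (le_trans h4 (le_of_eq ?_))
      · linarith only [hr1]
      · congr!
    exact_mod_cast h5
  have hVK : V.card ≤ K := hAc ▸ Finset.card_le_card hVA
  set Q : Fin 3 → Finset (Fin n) := fun c => V.image (fun ω => ω.1 c) ∪ V.image (fun ω => ω.2 c) with hQ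
  have hQc : ∀ c, (Q c).card = 2 * V.card := by
    intro c
    rw [hQ]
    simp only
    rw [Finset.card_union_of_disjoint, Finset.card_image_of_injOn, Finset.card_image_of_injOn]
    · omega
    · intro a ha b hb h
      by_contra hne
      exact hVconf a ha b hb hne ⟨c, Or.inr (Or.inr (Or.inr h))⟩
    · intro a ha b hb h
      by_contra hne
      exact hVconf a ha b hb hne ⟨c, Or.inl h⟩
    · rw [Finset.disjoint_left]
      intro x hx hy
      obtain ⟨a, ha, hax⟩ := Finset.mem_image.1 hx
      obtain ⟨b, hb, hbx⟩ := Finset.mem_image.1 hy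
      by_cases hab : a = b
      · subst hab
        exact (hVp a ha).2.2 c (hax.trans hbx.symm)
      · exact hVconf a ha b hb hab ⟨c, Or.inr (Or.inl (hax.trans hbx.symm))⟩
  have hVR : (V.card : ℝ) ≤ K := by exact_mod_cast hVK
  have hqr : 2 * V.card + r ≤ n := by
    have : ((2 * V.card + r : ℕ) : ℝ) ≤ n := by
      push_cast
      linarith only [hVR, hK1, hr1, hn0]
    exact_mod_cast this
  obtain ⟨m, hm⟩ : ∃ m, m + 2 * V.card + r = n := ⟨n - 2 * V.card - r, by omega⟩
  have hmR : (m : ℝ) + 2 * V.card + r = n := by exact_mod_cast hm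
  rcases core H Q (2 * V.card) r m hQc hm with ⟨N, hNH, hNM, hNQ, hNc⟩ | ⟨e, L, hs, hLr⟩
  · have hle : N.card + 2 * V.card ≤ n := by
      have h1 : (used N 0 ∪ Q 0).card ≤ n := (Finset.card_le_univ _).trans (by simp)
      rw [Finset.card_union_of_disjoint, card_used hNM, hQc] at h1
      · exact h1
      · rw [Finset.disjoint_left]
        intro x hx hq
        obtain ⟨f, hf, hfx⟩ := Finset.mem_image.1 hx
        exact hNQ f hf 0 (by rw [hfx]; exact hq)
    obtain ⟨M, h1, h2, h3⟩ := absorb_finish H (n - (N.card + 2 * V.card)) N V hNH hNM hVp hVconf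
      (by
        intro g hg ω hω i
        constructor
        · intro h
          exact hNQ g hg i (Finset.mem_union_left _ (Finset.mem_image.2 ⟨ω, hω, h.symm⟩))
        · intro h
          exact hNQ g hg i (Finset.mem_union_right _ (Finset.mem_image.2 ⟨ω, hω, h.symm⟩)))
      (by omega)
      (by
        intro T
        refine le_trans (by omega : _ ≤ r) (le_trans (hVabs T) (le_of_eq ?_))
        congr!)
    exact ⟨M, h1, h2, h3⟩
  · have hmn : (n : ℝ) - m ≤ 1 / 10 ^ 20 * n := by
      linarith only [hmR, hVR, hK1, hr1, hn0]
    have hm0 : (0 : ℝ) < m := by linarith only [hmn, hn0]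
    have hmle : (m : ℝ) ≤ n := by
      have v1 : (0 : ℝ) ≤ V.card := Nat.cast_nonneg _
      have v2 : (0 : ℝ) ≤ r := Nat.cast_nonneg _
      linarith only [v1, v2, hmR]
    have hkn : (n : ℝ) / 10 ^ 43 ≤ k := by linarith only [hk2, hr2, hK2, hn100]
    refine setup_pm (k := k) hn30 hthr hs r ?_ hLr hmn ?_ ?_ ?_ ?_
    · have : (0 : ℝ) < r := by linarith only [hr2, hK2, hn100]
      exact_mod_cast this
    · linarith only [hk1, hr2, hK2, hn100]
    · linarith only [hkn, hn100]
    · rw [mul_one_div, div_le_iff₀ hm0]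
      linarith only [hk1, hr1, hK1, hmn, hn0]
    · have h1 : (3 * m + 3 : ℝ) < (n : ℝ) ^ 3 := by
        have a1 : (10 : ℝ) * n ≤ n * n := mul_le_mul_of_nonneg_right (by linarith only [hn100]) hn0.le
        have a2 : (n : ℝ) * n * 1 ≤ n * n * n := mul_le_mul_of_nonneg_left (by linarith only [hn100]) (by positivity)
        have a3 : (n : ℝ) ^ 3 = n * n * n := by ring
        rw [a3]
        linarith only [a1, a2, hmle, hn100]
      refine h1.trans (lt_of_lt_of_le hexp (Real.exp_le_exp.2 ?_))
      linarith only [hkn, hn0]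

end PM

/-- There exists `n₀` such that every 3-partite 3-graph with `n > n₀` vertices in each
class and `δ₁(H) > (5n²-6n)/9` if `n ≡ 0 (mod 3)`, `δ₁(H) > (5n²-4n-1)/9` if
`n ≡ 1 (mod 3)`, and `δ₁(H) > (5n²-8n+5)/9` if `n ≡ 2 (mod 3)`, contains a perfect
matching. -/
theorem exact_perfect_matching :
    ∃ n₀ : ℕ, ∀ n : ℕ, n₀ < n → ∀ H : Finset (Fin 3 → Fin n),
      (∀ (c : Fin 3) (x : Fin n), threshold9 n < 9 * deg3 H c x) →
      ∃ M : Finset (Fin 3 → Fin n), M ⊆ H ∧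
        (∀ e ∈ M, ∀ f ∈ M, e ≠ f → ∀ i, e i ≠ f i) ∧ M.card = n := by
  refine ⟨10 ^ 320, fun n hn H hthr => ?_⟩
  obtain ⟨M, h1, h2, h3⟩ := PM.main_pm hn.le H hthr
  exact ⟨M, h1, h2, h3⟩
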